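/- arXiv:2508.08119 — 2 statements merged into one kernel-verified Lean document; each statement's English description precedes it below -/
import Mathlib

section
/- Let t ≥ 49 be an integer and let G be a finite simple graph that is connected, has no bridge, and does not admit a totally odd immersion of K_t. Suppose S ⊆ V(G) is the set of branch vertices of a totally even immersion of K_{1400t} in G. Then there exists a set X ⊆ E(G) of size at most 14000·t² such that some connected component C of the graph obtained from G by deleting the edges in X induces a bipartite graph and contains more than 700t of the vertices of S. -/
open SimpleGraph

/-- An immersion of `H` in `G`: an injection `φ` of the vertices of `H` into `G`
(the branch vertices), together with, for each edge `uv` of `H`, a trail in `G`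
from `φ u` to `φ v` (the branch trails), such that the branch trails are
pairwise edge-disjoint.  The trail assigned to the reversed adjacency is the
reversed trail, so there is one branch trail per edge of `H`. -/
structure Immersion {V : Type*} {W : Type*} (G : SimpleGraph V) (H : SimpleGraph W) where
  φ : W ↪ V
  trail : ∀ ⦃u v : W⦄, H.Adj u v → G.Walk (φ u) (φ v)
  isTrail : ∀ ⦃u v : W⦄ (h : H.Adj u v), (trail h).IsTrail
  symm : ∀ ⦃u v : W⦄ (h : H.Adj u v), trail h.symm = (trail h).reverse
  disjoint : ∀ ⦃u v a b : W⦄ (h₁ : H.Adj u v) (h₂ : H.Adj a b),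
      s(u, v) ≠ s(a, b) → List.Disjoint (trail h₁).edges (trail h₂).edges

/-- `G` admits an immersion of `H`. -/
def HasImmersion {V W : Type*} (G : SimpleGraph V) (H : SimpleGraph W) : Prop :=
  Nonempty (Immersion G H)

/-- `G` admits a totally odd immersion of `H`: every branch trail has odd length. -/
def HasTotallyOddImmersion {V W : Type*} (G : SimpleGraph V) (H : SimpleGraph W) : Prop :=
  ∃ I : Immersion G H, ∀ ⦃u v : W⦄ (h : H.Adj u v), Odd (I.trail h).length

/-- `G` admits a totally even immersion of `H`: every branch trail has even length. -/
def HasTotallyEvenImmersion {V W : Type*} (G : SimpleGraph V) (H : SimpleGraph W) : Prop :=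
  ∃ I : Immersion G H, ∀ ⦃u v : W⦄ (h : H.Adj u v), Even (I.trail h).length

section Dihedral
variable {Y : Type*} (f g : Equiv.Perm Y)

lemma dih_g (hf : f * f = 1) (hg : g * g = 1) (z : ℤ) (y : Y) :
    g (((g * f) ^ z) y) = ((g * f) ^ (-z)) (g y) := by
  have hgi : g⁻¹ = g := inv_eq_of_mul_eq_one_left hg
  have hfi : f⁻¹ = f := inv_eq_of_mul_eq_one_left hf
  have h1 : g * (g * f) * g⁻¹ = (g * f)⁻¹ := by
    rw [mul_inv_rev, hgi, hfi, ← mul_assoc, hg, one_mul]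
  have h2 : g * (g * f) ^ z * g⁻¹ = (g * f) ^ (-z) := by
    rw [← conj_zpow, h1, inv_zpow, zpow_neg]
  have h3 : g * (g * f) ^ z = (g * f) ^ (-z) * g := by
    rw [← h2]; group
  have := congrArg (fun p : Equiv.Perm Y => p y) h3
  simpa using this

lemma dih_f (hf : f * f = 1) (hg : g * g = 1) (z : ℤ) (y : Y) :
    f (((g * f) ^ z) y) = ((g * f) ^ (-z-1)) (g y) := by
  have h : f (((g * f) ^ z) y) = g (((g * f) ^ (z+1)) y) := by
    rw [add_comm, zpow_add, zpow_one]
    simp only [Equiv.Perm.mul_apply]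
    have := congrArg (fun p : Equiv.Perm Y => p (f (((g * f) ^ z) y))) hg
    simpa using this.symm
  rw [h, dih_g f g hf hg]
  congr 2; ring_nf

lemma dih_period [Finite Y] (hf : f * f = 1) (hg : g * g = 1) (a : Y) (ha : g a = a)
    (hfix : ∀ y, f y = y → g y = y) (hfa : f a ≠ a) :
    ∃ h : ℕ, 1 ≤ h ∧ ∀ z : ℤ, ((g * f) ^ z) a = a ↔ (2 * h : ℤ) ∣ z := by
  set σ := g * f with hσ
  have key : ∀ z : ℤ, (σ ^ z) a = a ↔ (Function.minimalPeriod σ a : ℤ) ∣ z := fun z =>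
    MulAction.zpow_smul_eq_iff_minimalPeriod_dvd (a := σ) (b := a) (n := z)
  set n := Function.minimalPeriod σ a
  have hn0 : n ≠ 0 := by
    intro h0
    have h1 : (σ ^ (orderOf σ : ℤ)) a = a := by
      rw [zpow_natCast, pow_orderOf_eq_one]; rfl
    rw [key, h0] at h1
    have := (isOfFinOrder_of_finite σ).orderOf_pos
    rw [Nat.cast_zero, zero_dvd_iff] at h1
    omega
  rcases Nat.even_or_odd' n with ⟨h, hh | hh⟩
  · refine ⟨h, by omega, fun z => ?_⟩
    rw [key, hh]; push_cast; rfl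
  · exfalso
    have h1 : f ((σ ^ (h : ℤ)) a) = (σ ^ (h : ℤ)) a := by
      rw [hσ, dih_f f g hf hg, ha, ← hσ]
      have : (σ ^ (-(2*h+1) : ℤ)) a = a := by
        rw [key, hh]; push_cast; exact (dvd_neg).2 (dvd_refl _)
      have h2 : (-(h:ℤ) - 1) = h + (-(2*h+1)) := by ring
      rw [h2, zpow_add]
      simp only [Equiv.Perm.mul_apply, this]
    have h2 := hfix _ h1
    have h3 : σ ((σ ^ (h : ℤ)) a) = (σ ^ (h : ℤ)) a := by
      rw [hσ] at *
      rw [Equiv.Perm.mul_apply, h1, h2]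
    have h4 : σ a = a := by
      have : (σ ^ (h:ℤ)) (σ a) = (σ ^ (h:ℤ)) a := by
        rw [← h3, ← Equiv.Perm.mul_apply, ← Equiv.Perm.mul_apply, ← zpow_one_add, ← zpow_add_one,
          add_comm]
      exact (Equiv.injective _) this
    apply hfa
    have : g (f a) = g a := by rw [ha]; exact h4
    exact g.injective this
end Dihedral

/-- choose representatives of a fixed point free involution -/
lemma exists_reps {τ : Type*} [Fintype τ] [DecidableEq τ] (A : Finset τ) (k : ℕ)
    (hA : A.card = 2 * k) (p : τ → τ) (h1 : ∀ a ∈ A, p a ∈ A) (h2 : ∀ a ∈ A, p (p a) = a)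
    (h3 : ∀ a ∈ A, p a ≠ a) :
    ∃ s : Fin k → τ, (∀ i, s i ∈ A) ∧ Function.Injective s ∧ ∀ i j, s i ≠ p (s j) := by
  classical
  let e := Fintype.equivFin τ
  let R := A.filter (fun a => e a < e (p a))
  have hd : A = R ∪ R.image p := by
    ext a
    simp only [R, Finset.mem_union, Finset.mem_filter, Finset.mem_image]
    constructor
    · intro ha
      rcases lt_trichotomy (e a) (e (p a)) with h | h | h
      · exact Or.inl ⟨ha, h⟩
      · exact absurd (e.injective h).symm (h3 a ha)
      · exact Or.inr ⟨p a, ⟨h1 a ha, by rwa [h2 a ha]⟩, h2 a ha⟩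
    · rintro (h | ⟨b, ⟨hb, -⟩, rfl⟩)
      · exact h.1
      · exact h1 b hb
  have hdis : Disjoint R (R.image p) := by
    rw [Finset.disjoint_left]
    intro a ha hb
    simp only [R, Finset.mem_filter, Finset.mem_image] at ha hb
    obtain ⟨b, ⟨hbA, hb⟩, rfl⟩ := hb
    rw [h2 b hbA] at ha
    exact lt_asymm hb ha.2
  have hc : (R.image p).card = R.card := by
    apply Finset.card_image_of_injOn
    intro a ha b hb hab
    simp only [R, Finset.coe_filter, Set.mem_ofPred_eq] at ha hb
    rw [← h2 a ha.1, ← h2 b hb.1]; exact congrArg p hab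
  have hR : R.card = k := by
    have := Finset.card_union_of_disjoint hdis
    rw [← hd, hA, hc] at this; omega
  let s := R.equivFinOfCardEq hR
  refine ⟨fun i => (s.symm i : τ), fun i => ?_, fun i j hij => ?_, fun i j hij => ?_⟩
  · exact (Finset.mem_filter.1 (s.symm i).2).1
  · exact s.symm.injective (Subtype.ext hij)
  · exact Finset.disjoint_left.1 hdis (s.symm i).2
      (Finset.mem_image.2 ⟨_, (s.symm j).2, hij.symm⟩)

section Aux
variable {V : Type*} (G : SimpleGraph V) {τ : Type*} (loc : τ → V) (μ : Type*)

/-- nodes: dart nodes (two layers), terminals, extra nodes -/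
abbrev Nd := (G.Dart × Bool) ⊕ (τ ⊕ μ)

def auxRel : Nd G (τ := τ) μ → Nd G (τ := τ) μ → Prop
  | .inl (d, b), .inl (d', b') => (d.fst = d'.fst ∧ b ≠ b') ∨ (d' = d.symm ∧ b = b')
  | .inl (d, b), .inr (.inl α) => b = false ∧ d.fst = loc α
  | .inr (.inl α), .inl (d, b) => b = false ∧ d.fst = loc α
  | .inr (.inl _), .inr (.inr _) => True
  | .inr (.inr _), .inr (.inl _) => True
  | _, _ => False

def auxG : SimpleGraph (Nd G (τ := τ) μ) where
  Adj := auxRel G loc μ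
  symm := ⟨by
    rintro (⟨d, b⟩ | α | m) (⟨d', b'⟩ | α' | m') <;> simp only [auxRel, imp_self]
    rintro (⟨h1, h2⟩ | ⟨rfl, h2⟩)
    · exact Or.inl ⟨h1.symm, h2.symm⟩
    · exact Or.inr ⟨by simp, h2.symm⟩⟩
  loopless := ⟨by
    rintro (⟨d, b⟩ | α | m) <;> simp only [auxRel, not_false_eq_true]
    simp [(Dart.symm_ne _).symm]⟩

/-- A packing of k edge-disjoint odd trails joining distinct terminals. -/
def Pack (k : ℕ) : Prop :=
  ∃ (s e : Fin k → τ) (w : ∀ i, G.Walk (loc (s i)) (loc (e i))),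
    (∀ i, (w i).IsTrail ∧ Odd (w i).length) ∧
    (∀ i j, i ≠ j → List.Disjoint (w i).edges (w j).edges) ∧
    Function.Injective (Sum.elim s e)
end Aux

section Orbit
variable {V : Type*} {G : SimpleGraph V} {τ : Type*} (loc : τ → V)

/-- nodes without the extra ones -/
abbrev Yd (G : SimpleGraph V) (τ : Type*) := (G.Dart × Bool) ⊕ τ

def ypos : Yd G τ → V
  | .inl (d, _) => d.fst
  | .inr α => loc α

def ylay : Yd G τ → Bool
  | .inl (_, b) => b
  | .inr _ => true

def yRel : Yd G τ → Yd G τ → Prop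
  | .inl (d, b), .inl (d', b') => (d.fst = d'.fst ∧ b ≠ b') ∨ (d' = d.symm ∧ b = b')
  | .inl (d, b), .inr α => b = false ∧ d.fst = loc α
  | .inr α, .inl (d, b) => b = false ∧ d.fst = loc α
  | .inr _, .inr _ => False

def gfun : Yd G τ → Yd G τ
  | .inl (d, b) => .inl (d, !b)
  | .inr α => .inr α

lemma gfun_gfun (y : Yd G τ) : gfun (gfun y) = y := by
  rcases y with ⟨d, b⟩ | α <;> simp [gfun]

def gperm (G : SimpleGraph V) (τ : Type*) : Equiv.Perm (Yd G τ) := ⟨gfun, gfun, gfun_gfun, gfun_gfun⟩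

lemma gperm_sq : gperm G τ * gperm G τ = 1 := by
  ext y; simp [gperm, gfun_gfun]

open Classical in
noncomputable def rung (f : Equiv.Perm (Yd G τ)) : Yd G τ → Option (Sym2 V)
  | .inl (d, b) => if f (.inl (d, b)) = .inl (d.symm, b) then some d.edge else none
  | .inr _ => none

variable (f : Equiv.Perm (Yd G τ)) 
  
lemma step_walk (hadj : ∀ y, f y ≠ y → yRel loc y (f y)) (hfix : ∀ y, f y = y → ∃ α, y = .inr α)
    (y : Yd G τ) (d : G.Dart) (b : Bool) (h : f y = .inl (d, b)) :
    (rung f y = none ∧ ypos loc ((gperm G τ * f) y) = ypos loc y ∧ ylay ((gperm G τ * f) y) = ylay y) ∨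
    (∃ _ : G.Adj (ypos loc y) (ypos loc ((gperm G τ * f) y)),
      rung f y = some s(ypos loc y, ypos loc ((gperm G τ * f) y)) ∧
      ylay ((gperm G τ * f) y) = !ylay y) := by
  have hs : (gperm G τ * f) y = .inl (d, !b) := by
    simp [h, gperm, gfun]
  rw [hs]
  have hne : f y ≠ y := by
    intro h'
    obtain ⟨α, rfl⟩ := hfix y h'
    rw [h'] at h; cases h
  have hr := hadj y hne
  rw [h] at hr
  rcases y with ⟨d', b'⟩ | α
  · by_cases hc : d = d'.symm ∧ b = b'
    · right
      obtain ⟨rfl, rfl⟩ := hc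
      refine ⟨d'.adj, ?_, ?_⟩
      · simp only [rung, h]; simp [ypos, Dart.edge]
      · simp [ylay]
    · left
      simp only [yRel] at hr
      rcases hr with hr | hr
      · refine ⟨?_, ?_, ?_⟩
        · simp only [rung, h]; rw [if_neg]; rw [h]; simpa using hc
        · simp [ypos, hr.1]
        · have := hr.2
          simp only [ylay]; revert this; cases b <;> cases b' <;> simp
      · exact absurd ⟨hr.1, hr.2.symm⟩ hc
  · left
    simp only [yRel] at hr
    refine ⟨rfl, by simp [ypos, hr.2], by simp [ylay, hr.1]⟩

lemma long_walk (hadj : ∀ y, f y ≠ y → yRel loc y (f y))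
    (hfix : ∀ y, f y = y → ∃ α, y = .inr α) (y : Yd G τ) (n : ℕ)
    (hn : ∀ j < n, ∃ d b, f (((gperm G τ * f) ^ j) y) = .inl (d, b)) :
    ∃ w : G.Walk (ypos loc y) (ypos loc (((gperm G τ * f) ^ n) y)),
      (Even w.length ↔ ylay y = ylay (((gperm G τ * f) ^ n) y)) ∧
      w.edges = (List.range n).filterMap (fun j => rung f (((gperm G τ * f) ^ j) y)) := by
  induction n with
  | zero => exact ⟨(Walk.nil : G.Walk (ypos loc y) (ypos loc y)), iff_of_true (show Even 0 by simp) rfl, rfl⟩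
  | succ n ih =>
    obtain ⟨w, h1, h2⟩ := ih (fun j hj => hn j (by omega))
    obtain ⟨d, b, hdb⟩ := hn n (by omega)
    have hs := step_walk loc f hadj hfix _ d b hdb
    have e : ((gperm G τ * f) ^ (n+1)) y = (gperm G τ * f) (((gperm G τ * f) ^ n) y) := by
      rw [pow_succ', Equiv.Perm.mul_apply]
    rw [e]
    rcases hs with ⟨h3, h4, h5⟩ | ⟨h3, h4, h5⟩
    · refine ⟨w.copy rfl h4.symm, ?_, ?_⟩
      · rw [h5, Walk.length_copy]; exact h1
      · rw [List.range_succ, List.filterMap_append]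
        rw [Walk.edges_copy, h2]; simp [h3]
    · refine ⟨w.concat h3, ?_, ?_⟩
      · rw [h5, Walk.length_concat, Nat.even_add_one, h1]
        cases ylay y <;> cases ylay (((gperm G τ * f) ^ n) y) <;> simp
      · rw [List.range_succ, List.filterMap_append, Walk.edges_concat, h2]
        simp [h4]

lemma rung_eq (hff : f * f = 1) {y y' : Yd G τ} {e : Sym2 V} (h : rung f y = some e) (h' : rung f y' = some e) :
    (y' = y ∨ y' = f y ∨ y' = gperm G τ y ∨ y' = (gperm G τ * f) y) ∧
    (y' = y ∨ y' = f y ∨ (gperm G τ * f) ((gperm G τ * f) y) = y) := by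
  rcases y with ⟨d, b⟩ | α
  swap
  · simp [rung] at h
  rcases y' with ⟨d', b'⟩ | α
  swap
  · simp [rung] at h'
  simp only [rung] at h h'
  split_ifs at h with hf
  split_ifs at h' with hf'
  have he : d'.edge = d.edge := by
    rw [Option.some.inj h, Option.some.inj h']
  rw [dart_edge_eq_iff] at he
  have hb : b' = b ∨ b' = !b := by cases b <;> cases b' <;> simp
  have hg : ∀ (d : G.Dart) b, gperm G τ (.inl (d, b)) = .inl (d, !b) :=
    fun d b => rfl
  have hs : (gperm G τ * f) (.inl (d, b)) = .inl (d.symm, !b) := by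
    rw [Equiv.Perm.mul_apply, hf, hg]
  rcases he with rfl | rfl <;> rcases hb with rfl | rfl
  · simp
  · refine ⟨by simp [hg], Or.inr (Or.inr ?_)⟩
    rw [hs, Equiv.Perm.mul_apply]
    have h3 : f (.inl (d'.symm, !b)) = .inl (d', !b) := by
      rw [← hf', ← Equiv.Perm.mul_apply, hff]; rfl
    rw [h3, hg]; simp
  · simp [hf]
  · refine ⟨by rw [hs]; simp, Or.inr (Or.inr ?_)⟩
    rw [hs, Equiv.Perm.mul_apply, hf', hg]; simp
end Orbit

section Orbit2
variable {V : Type*} {G : SimpleGraph V} {τ : Type*} (loc : τ → V)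
variable (f : Equiv.Perm (Yd G τ)) 

lemma gperm_inr (α : τ) : gperm G τ (.inr α) = .inr α := rfl

lemma gperm_fix {y : Yd G τ} (h : gperm G τ y = y) : ∃ α, y = .inr α := by
  rcases y with ⟨d, b⟩ | α
  · exfalso
    have : (Sum.inl (d, !b) : Yd G τ) = .inl (d, b) := h
    simp at this
  · exact ⟨α, rfl⟩

lemma sig_shift {y : Yd G τ} {z z' : ℤ} (σ : Equiv.Perm (Yd G τ)) :
    (σ ^ z) y = (σ ^ z') y ↔ (σ ^ (z - z')) y = y := by
  constructor
  · intro h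
    have : (σ ^ (z - z')) y = (σ ^ (-z')) ((σ ^ z) y) := by
      rw [← Equiv.Perm.mul_apply, ← zpow_add]; congr 2; ring
    rw [this, h, ← Equiv.Perm.mul_apply, ← zpow_add]; simp
  · intro h
    have : (σ ^ z) y = (σ ^ z') ((σ ^ (z-z')) y) := by
      rw [← Equiv.Perm.mul_apply, ← zpow_add]; congr 2; ring
    rw [this, h]

lemma orbit_trail [Finite (Yd G τ)] (hff : f * f = 1)
    (hadj : ∀ y, f y ≠ y → yRel loc y (f y))
    (hfix : ∀ y, f y = y → ∃ α, y = .inr α) (α : τ) (hα : f (.inr α) ≠ .inr α) :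
    ∃ (h : ℕ) (β : τ) (w : G.Walk (loc α) (loc β)), 1 ≤ h ∧
      (∀ z : ℤ, ((gperm G τ * f) ^ z) (.inr α) = .inr α ↔ (2 * h : ℤ) ∣ z) ∧
      ((gperm G τ * f) ^ (h : ℤ)) (.inr α) = .inr β ∧
      w.IsTrail ∧ Odd w.length ∧
      ∀ e ∈ w.edges, ∃ z : ℤ, rung f (((gperm G τ * f) ^ z) (.inr α)) = some e := by
  have hgg := gperm_sq (G := G) (τ := τ)
  obtain ⟨h, h1, hper⟩ := dih_period f (gperm G τ) hff hgg (.inr α) rfl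
    (fun y hy => by obtain ⟨α, rfl⟩ := hfix y hy; rfl) hα
  have hG := fun z : ℤ => dih_g f (gperm G τ) hff hgg z (.inr α)
  have hF := fun z : ℤ => dih_f f (gperm G τ) hff hgg z (.inr α)
  simp only [gperm_inr] at hG hF
  generalize hσ : gperm G τ * f = σ at *
  have hβ : ∃ β, (σ ^ (h : ℤ)) (.inr α) = .inr β := by
    apply gperm_fix
    rw [hG, sig_shift, hper]
    exact ⟨-1, by ring⟩
  obtain ⟨β, hβ⟩ := hβ
  have hn : ∀ j < h - 1, ∃ d b, f ((σ ^ j) (.inr α)) = .inl (d, b) := by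
    intro j hj
    rcases hy : f ((σ ^ j) (.inr α)) with ⟨d, b⟩ | γ
    · exact ⟨d, b, rfl⟩
    · exfalso
      have h2 := hF j
      rw [zpow_natCast, hy] at h2
      have h3 : gperm G τ ((σ ^ (-(j:ℤ) - 1)) (.inr α)) = (σ ^ (-(j:ℤ) - 1)) (.inr α) := by
        rw [← h2]; rfl
      rw [hG, sig_shift, hper] at h3
      have := Int.le_of_dvd (by omega) h3
      omega
  have hlw := long_walk loc f hadj hfix (.inr α) (h - 1) (by rw [hσ]; exact hn)
  rw [hσ] at hlw
  -- last node
  have hlast : ∃ d : G.Dart, (σ ^ (h-1)) (.inr α) = .inl (d, false) ∧ d.fst = loc β := by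
    have hf1 : f ((σ ^ (h-1)) (.inr α)) = .inr β := by
      have := hF ((h-1 : ℕ) : ℤ)
      rw [zpow_natCast] at this
      rw [this, ← hβ, sig_shift, hper]
      refine ⟨-1, ?_⟩
      push_cast [h1]; ring
    have hne : f ((σ ^ (h-1)) (.inr α)) ≠ ((σ ^ (h-1)) (.inr α)) := by
      rw [hf1, ← hβ, ← zpow_natCast, Ne, sig_shift, hper]
      push_cast [h1]
      ring_nf
      intro h2
      have := Int.le_of_dvd (by omega) h2
      omega
    have hr := hadj _ hne
    rw [hf1] at hr
    rcases hy : (σ ^ (h-1)) (.inr α) with ⟨d, b⟩ | γ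
    · rw [hy] at hr
      simp only [yRel] at hr
      exact ⟨d, by rw [hr.1], hr.2⟩
    · rw [hy] at hr
      exact absurd hr (by simp [yRel])
  obtain ⟨d, hd1, hd2⟩ := hlast
  rw [hd1] at hlw
  obtain ⟨w, hw1, hw2⟩ := hlw
  have hp1 : ypos loc (.inr α : Yd G τ) = loc α := rfl
  have hp2 : ypos loc (.inl (d, false) : Yd G τ) = loc β := hd2
  refine ⟨h, β, w.copy hp1 hp2, h1, hper, hβ, ?_, ?_, ?_⟩
  · rw [Walk.isTrail_def, Walk.edges_copy, hw2]
    rw [List.Nodup, List.pairwise_filterMap]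
    refine List.nodup_range.pairwise_of_forall_ne ?_
    intro i hi j hj hij e he e' he' hee
    subst hee
    rw [List.mem_range] at hi hj
    obtain ⟨-, hr⟩ := rung_eq f hff he he'
    rw [hσ] at hr
    simp only [← zpow_natCast] at hr
    rw [hF, sig_shift, sig_shift, hper, hper, ← Equiv.Perm.mul_apply, ← Equiv.Perm.mul_apply] at hr
    rcases hr with hr | hr | hr
    · by_cases hlt : i < j
      · have := Int.le_of_dvd (by omega) hr
        omega
      · rw [← dvd_neg] at hr
        have := Int.le_of_dvd (by omega) hr
        omega
    · have := Int.le_of_dvd (by omega) hr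
      omega
    · rw [mul_assoc, ← zpow_one_add, ← zpow_one_add, sig_shift, hper] at hr
      have := Int.le_of_dvd (by omega) hr
      omega
  · rw [Walk.length_copy, ← Nat.not_even_iff_odd, hw1]
    simp [ylay]
  · intro e he
    rw [Walk.edges_copy, hw2, List.mem_filterMap] at he
    obtain ⟨j, -, hj⟩ := he
    exact ⟨j, by rw [zpow_natCast]; exact hj⟩
end Orbit2

section Orbit3
variable {V : Type*} {G : SimpleGraph V} {τ : Type*} (loc : τ → V)
variable (f : Equiv.Perm (Yd G τ)) 

lemma pack_of_perm [Finite V] [Fintype τ] [DecidableEq τ] (hff : f * f = 1)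
    (hadj : ∀ y, f y ≠ y → yRel loc y (f y))
    (hfix : ∀ y, f y = y → ∃ α, y = .inr α) (k : ℕ) (A : Finset τ)
    (hA : ∀ α, α ∈ A ↔ f (.inr α) ≠ .inr α) (hAc : A.card = 2 * k) : Pack G loc k := by
  classical
  have : Fintype V := Fintype.ofFinite V
  have : Finite (Yd G τ) := inferInstance
  have hgg := gperm_sq (G := G) (τ := τ)
  have key := fun α : {α // α ∈ A} => orbit_trail loc f hff hadj hfix α ((hA α).1 α.2)
  choose h β w h1 hper hβ htr hodd hedge using key
  have hG := fun α (z : ℤ) => dih_g f (gperm G τ) hff hgg z (.inr α)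
  have hF := fun α (z : ℤ) => dih_f f (gperm G τ) hff hgg z (.inr α)
  simp only [gperm_inr] at hG hF
  have hre := fun y y' e => rung_eq (y := y) (y' := y') (e := e) f hff
  generalize hσ : gperm G τ * f = σ at *
  let p : τ → τ := fun α => if hα : α ∈ A then β ⟨α, hα⟩ else α
  have hpA : ∀ α (hα : α ∈ A), p α = β ⟨α, hα⟩ := fun α hα => dif_pos hα
  have hp1 : ∀ a ∈ A, p a ∈ A := by
    intro a ha
    rw [hpA a ha, hA, ← hβ, hF, Ne, sig_shift, hper]
    intro h2
    have h3 : (2 * h ⟨a, ha⟩ : ℤ) ∣ 1 := by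
      have := dvd_add h2 (dvd_refl (2 * h ⟨a, ha⟩ : ℤ))
      ring_nf at this
      rw [← dvd_neg] at this
      simpa [mul_comm] using this
    have := Int.le_of_dvd (by omega) h3
    have := h1 ⟨a, ha⟩
    omega
  have hp2 : ∀ a ∈ A, p (p a) = a := by
    intro a ha
    have hb := hp1 a ha
    rw [hpA _ hb]
    have e1 : (Sum.inr (p a) : Yd G τ) = (σ ^ (h ⟨a, ha⟩ : ℤ)) (.inr a) := by
      rw [hpA a ha]; exact (hβ _).symm
    have hh : h ⟨p a, hb⟩ = h ⟨a, ha⟩ := by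
      have : ∀ z : ℤ, (2 * h ⟨p a, hb⟩ : ℤ) ∣ z ↔ (2 * h ⟨a, ha⟩ : ℤ) ∣ z := by
        intro z
        rw [← hper, ← hper]
        rw [e1, ← Equiv.Perm.mul_apply, ← zpow_add, sig_shift]; simp
      have := Int.natAbs_eq_of_dvd_dvd ((this _).2 dvd_rfl) ((this _).1 dvd_rfl)
      omega
    have e2 := hβ ⟨p a, hb⟩
    rw [hh, e1, ← Equiv.Perm.mul_apply, ← zpow_add] at e2
    have e3 : (σ ^ ((h ⟨a, ha⟩ : ℤ) + h ⟨a, ha⟩)) (.inr a) = .inr a := by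
      exact (hper ⟨a, ha⟩ _).2 ⟨1, by ring⟩
    rw [e3] at e2
    exact (Sum.inr.inj e2).symm
  have hp3 : ∀ a ∈ A, p a ≠ a := by
    intro a ha he
    have e2 := hβ ⟨a, ha⟩
    rw [← hpA a ha, he, hper] at e2
    have := h1 ⟨a, ha⟩
    have := Int.le_of_dvd (by omega) e2
    omega
  have hdisj : ∀ (a c : {α // α ∈ A}), c ≠ a → c.1 ≠ p a → List.Disjoint (w a).edges (w c).edges := by
    intro a c hca hcp e he he'
    obtain ⟨z, hz⟩ := hedge a e he
    obtain ⟨z', hz'⟩ := hedge c e he'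
    have hr := (hre _ _ e hz hz').1
    have : ∃ u : ℤ, (σ ^ z') (Sum.inr c.1) = (σ ^ u) (Sum.inr a.1) := by
      rcases hr with hr | hr | hr | hr
      · exact ⟨z, hr⟩
      · exact ⟨_, hr.trans (hF _ _)⟩
      · exact ⟨_, hr.trans (hG _ _)⟩
      · refine ⟨1 + z, hr.trans ?_⟩
        rw [zpow_one_add]; rfl
    obtain ⟨u, hu⟩ := this
    have hc : (Sum.inr c.1 : Yd G τ) = (σ ^ (u - z')) (Sum.inr a.1) := by
      have : (Sum.inr c.1 : Yd G τ) = (σ ^ (-z')) ((σ ^ z') (Sum.inr c.1)) := by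
        rw [← Equiv.Perm.mul_apply, ← zpow_add]; simp
      rw [this, hu, ← Equiv.Perm.mul_apply, ← zpow_add]; congr 2; ring
    generalize u - z' = x at hc
    have h4 : gperm G τ (Sum.inr c.1) = Sum.inr c.1 := rfl
    rw [hc, hG, sig_shift, hper] at h4
    have h5 : (h a : ℤ) ∣ x := by
      obtain ⟨m, hm⟩ := h4
      exact ⟨-m, by linarith⟩
    obtain ⟨m, rfl⟩ := h5
    rcases Int.even_or_odd' m with ⟨q, rfl | rfl⟩
    · apply hca
      have : (σ ^ ((h a : ℤ) * (2 * q))) (.inr a.1) = .inr a.1 := by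
        rw [hper]; exact ⟨q, by ring⟩
      rw [this] at hc
      exact Subtype.ext (Sum.inr.inj hc)
    · apply hcp
      have : (σ ^ ((h a : ℤ) * (2 * q + 1))) (.inr a.1) = (σ ^ (h a : ℤ)) (.inr a.1) := by
        rw [sig_shift, hper]; exact ⟨q, by ring⟩
      rw [this, hβ] at hc
      rw [hpA _ a.2]
      exact (Sum.inr.inj hc)
  obtain ⟨s, hs1, hs2, hs3⟩ := exists_reps A k hAc p hp1 hp2 hp3
  refine ⟨s, fun i => β ⟨s i, hs1 i⟩, fun i => w ⟨s i, hs1 i⟩, fun i => ⟨htr _, hodd _⟩, ?_, ?_⟩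
  · intro i j hij
    apply hdisj
    · intro h; exact hij (hs2 (congrArg Subtype.val h)).symm
    · exact hs3 _ _
  · refine Function.Injective.sumElim hs2 ?_ ?_
    · intro i j hij
      simp only [← hpA] at hij
      apply hs2
      rw [← hp2 _ (hs1 i), ← hp2 _ (hs1 j), hij]
    · intro i j
      rw [← hpA]
      exact hs3 i j

/-- matching gives pack -/
lemma pack_of_matching [Finite V] [Fintype τ] (k : ℕ) (m : ℕ) (hm : Fintype.card τ = m + 2 * k)
    (M : (auxG G loc (Fin m)).Subgraph) (hM : M.IsPerfectMatching) : Pack G loc k := by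
  classical
  have : Fintype V := Fintype.ofFinite V
  rw [Subgraph.isPerfectMatching_iff] at hM
  choose p hp1 hp2 using hM
  have hpp : ∀ x, p (p x) = x := fun x => (hp2 (p x) x (hp1 x).symm).symm
  let emb : Yd G τ → Nd G (τ := τ) (Fin m) := Sum.elim Sum.inl (fun α => .inr (.inl α))
  let ff : Yd G τ → Yd G τ := fun y => match p (emb y) with
    | .inl x => .inl x
    | .inr (.inl α) => .inr α
    | .inr (.inr _) => y
  have hE : ∀ y, (emb (ff y) = p (emb y)) ∨ (ff y = y ∧ ∃ e, p (emb y) = .inr (.inr e)) := by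
    intro y
    simp only [ff]
    rcases p (emb y) with x | α | e <;> simp [emb]
  have hinj : Function.Injective emb := by
    rintro (a | a) (b | b) <;> simp [emb]
  have hff : ∀ y, ff (ff y) = y := by
    intro y
    rcases hE y with h | ⟨h, -⟩
    · have h2 : p (emb (ff y)) = emb y := by rw [h, hpp]
      rcases hE (ff y) with h3 | ⟨h3, e, h4⟩
      · apply hinj; rw [h3, h2]
      · exfalso
        rw [h2] at h4
        rcases y with y | y <;> simp [emb] at h4
    · rw [h, h]
  have hEadj : ∀ y y', (auxG G loc (Fin m)).Adj (emb y) (emb y') → yRel loc y y' := by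
    rintro (⟨d, b⟩ | a) (⟨d', b'⟩ | a') h <;> exact h
  have hne : ∀ y, emb (ff y) = p (emb y) → ff y ≠ y := by
    intro y h h'
    rw [h'] at h
    have := (hp1 (emb y)).adj_sub
    rw [← h] at this
    exact this.ne rfl
  let f : Equiv.Perm (Yd G τ) := ⟨ff, ff, hff, hff⟩
  have hf : ∀ y, f y = ff y := fun _ => rfl
  let A : Finset τ := Finset.univ.filter (fun α => f (.inr α) ≠ .inr α)
  refine pack_of_perm loc f (by ext y; simp [hf, hff]) ?_ ?_ k A (by simp [A]) ?_
  · intro y hy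
    rcases hE y with h | ⟨h, -⟩
    · apply hEadj
      rw [hf, h]
      exact (hp1 _).adj_sub
    · exact absurd h hy
  · intro y hy
    rcases hE y with h | ⟨h, e, he⟩
    · exact absurd hy (hne y h)
    · rcases y with ⟨d, b⟩ | α
      · exfalso
        have := (hp1 (emb (.inl (d, b)))).adj_sub
        rw [he] at this
        exact this
      · exact ⟨α, rfl⟩
  · have hex : ∀ e : Fin m, ∃ α, p (.inr (.inr e)) = .inr (.inl α) := by
      intro e
      have := (hp1 (.inr (.inr e))).adj_sub
      rcases h : p (.inr (.inr e)) with ⟨d, b⟩ | α | e'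
      · rw [h] at this; exact absurd this (by simp [auxG, auxRel])
      · exact ⟨α, rfl⟩
      · rw [h] at this; exact absurd this (by simp [auxG, auxRel])
    choose q hq using hex
    have hq2 : ∀ e, p (.inr (.inl (q e))) = .inr (.inr e) := fun e => by rw [← hq, hpp]
    have hqi : Function.Injective q := by
      intro e e' h
      have := hq2 e
      rw [h, hq2] at this
      simpa using this.symm
    have hAcompl : Aᶜ = Finset.univ.image q := by
      ext α
      simp only [A, Finset.mem_compl, Finset.mem_filter, Finset.mem_univ, true_and, not_not,
        Finset.mem_image]
      constructor
      · intro h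
        rcases hE (.inr α) with h' | ⟨-, e, he⟩
        · exact absurd h (hne _ h')
        · refine ⟨e, ?_⟩
          have h3 := hq e
          rw [← he, hpp] at h3
          simp [emb] at h3
          exact h3.symm
      · rintro ⟨e, rfl⟩
        have := hq2 e
        change ff _ = _
        simp only [ff, emb, Sum.elim_inr, this]
    have h1 := Finset.card_compl A
    rw [hAcompl, Finset.card_image_of_injective _ hqi, Finset.card_univ, Fintype.card_fin, hm] at h1
    have := Finset.card_le_univ A
    omega
end Orbit3

section Count
set_option linter.unusedSectionVars false
open Finset

lemma opt_count {X C : Type*} [Fintype X] [Fintype C] [DecidableEq C] (f : X → Option C)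
    (P : X → Prop) [DecidablePred P] :
    (univ.filter P).card = (univ.filter (fun x => f x = none ∧ P x)).card +
      ∑ c, (univ.filter (fun x => f x = some c ∧ P x)).card := by
  rw [Finset.card_eq_sum_card_fiberwise (f := f) (t := univ) (by simp), Fintype.sum_option]
  simp only [Finset.filter_filter, and_comm]

variable {Dt τ E C : Type*} [Fintype Dt] [Fintype τ] [Fintype E] [Fintype C] [DecidableEq C]
  (cD : Dt × Bool → Option C) (cT : τ → Option C) (cE : E → Option C)

def gx (x : Dt × Bool) : Dt × Bool := (x.1, !x.2)

lemma gx_gx (x : Dt × Bool) : gx (gx x) = x := by simp [gx]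

lemma gx_ne (x : Dt × Bool) : gx x ≠ x := by
  rcases x with ⟨d, b⟩; simp [gx]

lemma parity_nodes (hg : ∀ d c c', cD (d, false) = some c → cD (d, true) = some c' → c = c') (c : C) :
    Even ((univ.filter (fun x => cD x = some c ∧ ¬ cD (gx x) = none)).card) := by
  have hg' : ∀ x c c', cD x = some c → cD (gx x) = some c' → c = c' := by
    rintro ⟨d, _ | _⟩ c c' h h'
    · exact hg d c c' h h'
    · exact (hg d c' c h' h).symm
  have hsum : ∑ x ∈ univ.filter (fun x => cD x = some c ∧ ¬ cD (gx x) = none), (1 : ZMod 2) = 0 := by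
    apply Finset.sum_involution (fun x _ => gx x)
    · intro a ha; decide
    · intro a ha _; exact gx_ne a
    · intro a ha
      simp only [mem_filter, mem_univ, true_and] at ha ⊢
      obtain ⟨c', hc'⟩ := Option.ne_none_iff_exists'.1 ha.2
      rw [gx_gx, ha.1, hc', hg' a c c' ha.1 hc']; simp
    · intro a ha; exact gx_gx a
  rw [sum_const, nsmul_eq_mul, mul_one] at hsum
  exact (ZMod.natCast_eq_zero_iff_even).1 hsum

lemma count_main (k : ℕ) (hτ : Fintype.card τ = Fintype.card E + 2 * k)
    (hg : ∀ d c c', cD (d, false) = some c → cD (d, true) = some c' → c = c')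
    (hTE : ∀ α e c c', cT α = some c → cE e = some c' → c = c')
    (hodd : (univ.filter (fun x => cD x = none)).card + (univ.filter (fun x => cT x = none)).card
      + (univ.filter (fun x => cE x = none)).card + 2 ≤
      (univ.filter (fun c => Odd ((univ.filter (fun x => cD x = some c)).card +
        (univ.filter (fun x => cT x = some c)).card + (univ.filter (fun x => cE x = some c)).card))).card) :
    (∀ e, cE e = none) ∧ ∃ ε : C → ℕ,
      (∀ c, (univ.filter (fun x => cT x = some c)).card +
        (univ.filter (fun x => cD x = some c ∧ cD (gx x) = none)).card ≤ ε c + 1) ∧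
      ∑ c, ε c + 2 * (univ.filter (fun x => cT x = none)).card +
        2 * (univ.filter (fun d => cD (d, false) = none ∧ cD (d, true) = none)).card < 2 * k := by
  classical
  set a : C → ℕ := fun c => (univ.filter (fun x => cT x = some c)).card with ha
  set e : C → ℕ := fun c => (univ.filter (fun x => cE x = some c)).card with he
  set j : C → ℕ := fun c => (univ.filter (fun x => cD x = some c ∧ cD (gx x) = none)).card with hj
  set o : C → ℕ := fun c => if Odd ((univ.filter (fun x => cD x = some c)).card + a c + e c) then 1 else 0 with ho
  have hosum : ∑ c, o c = (univ.filter (fun c => Odd ((univ.filter (fun x => cD x = some c)).card +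
        (univ.filter (fun x => cT x = some c)).card + (univ.filter (fun x => cE x = some c)).card))).card := by
    rw [Finset.card_filter]
  rw [← hosum] at hodd
  have ho1 : ∀ c, o c ≤ 1 := fun c => by simp only [ho]; split_ifs <;> simp
  have hoaje : ∀ c, o c ≤ a c + j c + e c := by
    intro c
    simp only [ho]
    split_ifs with h
    · by_contra h2
      have h3 := parity_nodes cD hg c
      have h4 := Finset.card_filter_add_card_filter_not (s := univ.filter (fun x => cD x = some c))
        (fun x => cD (gx x) = none)
      rw [filter_filter, filter_filter] at h4
      have h5 : j c = 0 := by omega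
      simp only [hj] at h5
      rw [h5, zero_add] at h4
      rw [h4] at h3
      have h6 : a c = 0 := by omega
      have h7 : e c = 0 := by omega
      rw [h6, h7] at h
      exact (Nat.not_odd_iff_even.2 h3) (by simpa using h)
    · simp
  have hw : (univ.filter (fun x => cD x = none)).card = ∑ c, j c +
      2 * (univ.filter (fun d => cD (d, false) = none ∧ cD (d, true) = none)).card := by
    have h1 := Finset.card_filter_add_card_filter_not (s := univ.filter (fun x => cD x = none))
        (fun x => cD (gx x) = none)
    rw [filter_filter, filter_filter] at h1
    have h2 : (univ.filter (fun x => cD x = none ∧ ¬ cD (gx x) = none)).card = ∑ c, j c := by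
      have h3 : (univ.filter (fun x => cD x = none ∧ ¬ cD (gx x) = none)).card =
          (univ.filter (fun x => ¬ cD x = none ∧ cD (gx x) = none)).card := by
        apply Finset.card_bij (fun x _ => gx x)
        · intro x hx; simp only [mem_filter, mem_univ, true_and] at hx ⊢
          rw [gx_gx]; exact ⟨hx.2, hx.1⟩
        · intro x _ y _ h; rw [← gx_gx x, h, gx_gx]
        · intro x hx; simp only [mem_filter, mem_univ, true_and] at hx 
          exact ⟨gx x, by simp only [mem_filter, mem_univ, true_and, gx_gx]; exact ⟨hx.2, hx.1⟩, gx_gx x⟩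
      rw [h3, opt_count cD]
      have h4 : (univ.filter (fun x => cD x = none ∧ ¬ cD x = none ∧ cD (gx x) = none)).card = 0 := by
        rw [card_eq_zero, filter_eq_empty_iff]; tauto
      rw [h4, zero_add]
      apply sum_congr rfl
      intro c _
      simp only [hj]
      congr 1
      apply filter_congr
      intro x _
      constructor
      · tauto
      · intro h; simp [h.1, h.2]
    have h5 : (univ.filter (fun x => cD x = none ∧ cD (gx x) = none)).card = 
       2 * (univ.filter (fun d => cD (d, false) = none ∧ cD (d, true) = none)).card := by
      have : (univ.filter (fun x => cD x = none ∧ cD (gx x) = none)) =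
        (univ.filter (fun d => cD (d, false) = none ∧ cD (d, true) = none)) ×ˢ univ := by
        ext ⟨d, b⟩
        rw [mem_filter, mem_product, mem_filter]
        cases b <;> simp [gx, and_comm]
      rw [this, card_product]; simp [mul_comm]
    omega
  have hT : Fintype.card τ = (univ.filter (fun x => cT x = none)).card + ∑ c, a c := by
    have := opt_count cT (fun _ => True)
    simpa using this
  have hE : Fintype.card E = (univ.filter (fun x => cE x = none)).card + ∑ c, e c := by
    have := opt_count cE (fun _ => True)
    simpa using this
  have hall : ∀ e, cE e = none := by
    by_contra hcon
    push Not at hcon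
    obtain ⟨e0, he0⟩ := hcon
    obtain ⟨c0, hc0⟩ := Option.ne_none_iff_exists'.1 he0
    by_cases hTW : ∀ α, cT α = none
    · have ha0 : ∀ c, a c = 0 := by
        intro c; simp only [ha]; rw [card_eq_zero, filter_eq_empty_iff]; simp [hTW]
      have h1 : ∑ c, o c ≤ ∑ c, (j c + e c) :=
        sum_le_sum (fun c _ => by have := hoaje c; have := ha0 c; omega)
      rw [sum_add_distrib] at h1
      simp only [ha0, sum_const_zero] at hT
      omega
    · push Not at hTW
      obtain ⟨α0, hα0⟩ := hTW
      obtain ⟨c1, hc1⟩ := Option.ne_none_iff_exists'.1 hα0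
      have h10 : c1 = c0 := hTE _ _ _ _ hc1 hc0
      subst h10
      have h0 : ∀ c ≠ c1, a c + e c = 0 := by
        intro c hc
        have h1 : a c = 0 := by
          simp only [ha]; rw [card_eq_zero, filter_eq_empty_iff]
          intro α _ h; exact hc (hTE _ _ _ _ h hc0)
        have h2 : e c = 0 := by
          simp only [he]; rw [card_eq_zero, filter_eq_empty_iff]
          intro e' _ h; exact hc (hTE _ _ _ _ hc1 h).symm
        omega
      have h1 : ∑ c, o c ≤ ∑ c, (j c + if c = c1 then 1 else 0) := by
        refine sum_le_sum (fun c _ => ?_)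
        split_ifs with h
        · have := ho1 c; omega
        · have := hoaje c; have := h0 c h; omega
      rw [sum_add_distrib, sum_ite_eq' univ c1] at h1
      simp only [mem_univ, if_true] at h1
      omega
  refine ⟨hall, fun c => a c + j c - o c, fun c => ?_, ?_⟩
  · have := ho1 c
    change a c + j c ≤ (a c + j c - o c) + 1
    omega
  · have he0 : ∀ c, e c = 0 := by
      intro c; simp only [he]; rw [card_eq_zero, filter_eq_empty_iff]; simp [hall]
    have h1 : ∑ c, (a c + j c - o c) + ∑ c, o c = ∑ c, a c + ∑ c, j c := by
      rw [← sum_add_distrib, ← sum_add_distrib]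
      refine sum_congr rfl (fun c _ => ?_)
      have := hoaje c; have := he0 c; omega
    simp only [he0, sum_const_zero] at hE
    change ∑ c, (a c + j c - o c) + _ + _ < _
    omega
end Count

lemma bridge_of_cut {V : Type*} {G : SimpleGraph V} (hconn : G.Connected)
    (hbr : ∀ e, ¬ G.IsBridge e) (S : Set V) {u v : V} (hu : u ∈ S) (hv : v ∉ S) (e : Sym2 V)
    (h : ∀ d : G.Dart, d.fst ∈ S → d.snd ∉ S → d.edge = e) : False := by
  obtain ⟨p⟩ := hconn u v
  obtain ⟨d, -, hd1, hd2⟩ := p.exists_boundary_dart S hu hv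
  refine hbr s(d.fst, d.snd) ?_
  rw [isBridge_iff]
  rintro ⟨q⟩
  obtain ⟨d', -, h1, h2⟩ := q.exists_boundary_dart S hd1 hd2
  have hadj := d'.adj
  have := h ⟨d'.toProd, (by simpa using hadj : _ ∧ _).1⟩ h1 h2
  have h3 := h d hd1 hd2
  simp only [Dart.edge] at this h3
  rw [← h3] at this
  simp only [deleteEdges_adj] at hadj
  exact hadj.2 this

section Cut
open Finset
variable {V : Type*} (G : SimpleGraph V) {τ : Type*} (loc : τ → V)

def CutC (k : ℕ) : Prop := ∃ X ⊆ G.edgeSet, X.ncard ≤ 4 * k ∧ ∃ bad : Finset τ, bad.card ≤ 4 * k ∧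
  ∀ α β, α ≠ β → α ∉ bad → β ∉ bad → loc α = loc β →
    ((G.deleteEdges X).induce ((G.deleteEdges X).connectedComponentMk (loc α)).supp).Colorable 2

variable {G} {loc} 
variable {C : Type*} [Fintype C] [DecidableEq C]
  {cD : G.Dart × Bool → Option C} {cT : τ → Option C}

lemma lobe (hconn : G.Connected) (hbr : ∀ e, ¬ G.IsBridge e)
    (h1 : ∀ d d' : G.Dart, ∀ b c c', d.fst = d'.fst → cD (d, b) = some c → cD (d', !b) = some c' → c = c')
    (h2 : ∀ d : G.Dart, ∀ b c c', cD (d, b) = some c → cD (d.symm, b) = some c' → c = c')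
    (v0 : V) (hv0 : ∀ d : G.Dart, d.fst = v0 → cD (d, false) = none)
    (d0 : G.Dart) (b0 : Bool) (c : C) (hx : cD (d0, b0) = some c)
    (hj : ∀ d b, cD (d, b) = some c → cD (d, !b) = none → d = d0 ∧ b = b0)
    (hni : (∃ d', d'.fst = d0.fst ∧ cD (d', !b0) ≠ none) ∨ cD (d0.symm, b0) ≠ none) :
    ∃ d, (cD (d, false) = none ∧ cD (d, true) = none) ∧
      ((∃ d1 : G.Dart, d1.fst = d.fst ∧ ∀ b, cD (d1, b) = some c) ∨ ∀ b, cD (d.symm, b) = some c) := by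
  by_contra hcon
  simp only [not_exists, not_and, not_or] at hcon
  have hgate : ∀ d b, cD (d, b) = some c → ¬ (d = d0 ∧ b = b0) → ∀ b', cD (d, b') = some c := by
    intro d b h hne b'
    have h3 : cD (d, !b) ≠ none := fun h4 => hne (hj d b h h4)
    obtain ⟨c', hc'⟩ := Option.ne_none_iff_exists'.1 h3
    have := h1 d d b c c' rfl h hc'
    subst this
    by_cases hb : b' = b
    · rw [hb]; exact h
    · have : b' = !b := by revert hb; cases b <;> cases b' <;> simp
      rw [this]; exact hc'
  -- a dart whose nodes are each in W or in c
  have htri : ∀ d : G.Dart, (∀ b c', cD (d, b) = some c' → c' = c) →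
      d = d0 ∨ (∀ b, cD (d, b) = some c) ∨ (cD (d, false) = none ∧ cD (d, true) = none) := by
    intro d hd
    by_cases hd0 : d = d0
    · exact Or.inl hd0
    right
    by_cases hb : ∃ b, cD (d, b) ≠ none
    · obtain ⟨b, hb⟩ := hb
      obtain ⟨c', hc'⟩ := Option.ne_none_iff_exists'.1 hb
      have := hd b c' hc'
      subst this
      exact Or.inl (hgate d b hc' (by tauto))
    · push Not at hb
      exact Or.inr ⟨hb _, hb _⟩
  let S : Set V := {v | ∃ d : G.Dart, d.fst = v ∧ ∀ b, cD (d, b) = some c}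
  have hne : ∃ u, u ∈ S := by
    rcases hni with ⟨d', hd', hn⟩ | hn
    · obtain ⟨c', hc'⟩ := Option.ne_none_iff_exists'.1 hn
      have := h1 d0 d' b0 c c' hd'.symm hx hc'
      subst this
      exact ⟨_, d', rfl, hgate d' _ hc' (by simp)⟩
    · obtain ⟨c', hc'⟩ := Option.ne_none_iff_exists'.1 hn
      have := h2 d0 b0 c c' hx hc'
      subst this
      exact ⟨_, d0.symm, rfl, hgate _ _ hc' (fun h => Dart.symm_ne d0 h.1)⟩
  obtain ⟨u, hu⟩ := hne
  have hv : v0 ∉ S := by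
    rintro ⟨d, hd, hf⟩
    have := hv0 d hd
    rw [hf false] at this; cases this
  refine bridge_of_cut hconn hbr S hu hv d0.edge ?_
  intro d hd1 hd2
  obtain ⟨d1, hd1e, hfull⟩ := hd1
  have ht := htri d (by
    intro b c' h
    exact (h1 d1 d (!b) c c' hd1e (hfull _) (by simpa using h)).symm)
  rcases ht with rfl | ht | ht
  · rfl
  · have ht2 := htri d.symm (by
      intro b c' h
      exact (h2 d b c c' (ht b) h).symm)
    rcases ht2 with rfl | ht2 | ht2
    · simp
    · exact absurd ⟨d.symm, rfl, ht2⟩ hd2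
    · have := (hcon d.symm ht2).2
      rw [Dart.symm_symm] at this
      exact (this ht).elim
  · exact ((hcon d ht).1 d1 hd1e hfull).elim

lemma color_comp
    (X : Set (Sym2 V)) 
    (hX1 : ∀ d : G.Dart, cD (d, false) = none → cD (d, true) = none → d.edge ∈ X)
    (hX2 : ∀ d : G.Dart, ∀ b, cD (d, !b) = none → cD (d, b) ≠ none → 
      ((∃ d', d'.fst = d.fst ∧ cD (d', !b) ≠ none) ∨ cD (d.symm, b) ≠ none) → d.edge ∈ X)
    (v0 : V) (hv0 : ∀ d : G.Dart, d.fst = v0 → cD (d, false) = none) :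
    ((G.deleteEdges X).induce ((G.deleteEdges X).connectedComponentMk v0).supp).Colorable 2 := by
  classical
  let P : Bool → V → Prop := fun b v => ∀ d : G.Dart, d.fst = v → cD (d, b) = none
  have hstep : ∀ b u v, (G.deleteEdges X).Adj u v → P b u → P (!b) v := by
    intro b u v huv hP
    rw [deleteEdges_adj] at huv
    obtain ⟨hadj, hnX⟩ := huv
    let d : G.Dart := ⟨(u, v), hadj⟩
    have hdX : d.edge ∉ X := hnX
    have hb : ∀ d : G.Dart, d.edge ∉ X → ∀ b, cD (d, b) = none → cD (d, !b) ≠ none := by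
      intro d hd b h h'
      cases b
      · exact hd (hX1 d h h')
      · exact hd (hX1 d h' h)
    have e1 : cD (d, b) = none := hP d rfl
    have e2 := hb d hdX b e1
    have e3 : cD (d.symm, !b) = none := by
      by_contra h
      exact hdX (hX2 d (!b) (by simpa using e1) e2 (Or.inr h))
    have hdX' : d.symm.edge ∉ X := by simpa using hdX
    have e4 := hb d.symm hdX' _ e3
    intro d' hd'
    by_contra h
    apply hdX'
    refine hX2 d.symm b e3 (by simpa using e4) (Or.inl ⟨d', hd', h⟩)
  have hreach : ∀ u, (G.deleteEdges X).Reachable v0 u → P false u ∨ P true u := by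
    intro u hu
    have gen : ∀ u v, (G.deleteEdges X).Walk u v → P false u ∨ P true u → P false v ∨ P true v := by
      intro u v p
      induction p with
      | nil => exact id
      | cons h p ih =>
        rintro (h' | h')
        · exact ih (Or.inr (hstep false _ _ h h'))
        · exact ih (Or.inl (hstep true _ _ h h'))
    obtain ⟨p⟩ := hu
    exact gen _ _ p (Or.inl hv0)
  refine ⟨Coloring.mk (fun x => if P false x.1 then (0 : Fin 2) else 1) ?_⟩
  rintro ⟨u, hu⟩ ⟨v, hv⟩ huv
  simp only [comap_adj, Function.Embedding.subtype_apply] at huv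
  rw [ConnectedComponent.mem_supp_iff, ConnectedComponent.eq] at hu hv
  have hu' := hreach u hu.symm
  by_cases hPu : P false u
  · have h2 := hstep _ _ _ huv hPu
    have : ¬ P false v := by
      intro h3
      have h4 := (deleteEdges_adj.1 huv)
      let d : G.Dart := ⟨(v, u), h4.1.symm⟩
      have := hX1 d (h3 d rfl) (h2 d rfl)
      apply h4.2
      simpa [d, Dart.edge, Sym2.eq_swap] using this
    simp [hPu, this]
  · have h2 := hstep true _ _ huv (by tauto)
    have h3 : P false v := h2
    simp [hPu, h3]
end Cut

section Cut2
open Finset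
variable {V : Type*} {G : SimpleGraph V} {τ : Type*} {loc : τ → V}
variable {C : Type*} [Fintype C] [DecidableEq C]
  {cD : G.Dart × Bool → Option C} {cT : τ → Option C}

lemma cut_of_cls [Fintype V] [Fintype τ] [Fintype G.Dart] [DecidableEq τ] (hconn : G.Connected) (hbr : ∀ e, ¬ G.IsBridge e)
    (h1 : ∀ d d' : G.Dart, ∀ b c c', d.fst = d'.fst → cD (d, b) = some c → cD (d', !b) = some c' → c = c')
    (h2 : ∀ d : G.Dart, ∀ b c c', cD (d, b) = some c → cD (d.symm, b) = some c' → c = c')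
    (h3 : ∀ d : G.Dart, ∀ α c c', cD (d, false) = some c → cT α = some c' → d.fst = loc α → c = c')
    (k : ℕ) (ε : C → ℕ)
    (hε : ∀ c, (univ.filter (fun x => cT x = some c)).card +
        (univ.filter (fun x => cD x = some c ∧ cD (gx x) = none)).card ≤ ε c + 1)
    (hsum : ∑ c, ε c + 2 * (univ.filter (fun x => cT x = none)).card +
        2 * (univ.filter (fun d => cD (d, false) = none ∧ cD (d, true) = none)).card < 2 * k) :
    CutC G loc k := by
  classical
  let bad : Finset τ := univ.filter (fun x => cT x = none) ∪
    (univ.filter (fun c => 1 ≤ ε c)).biUnion (fun c => univ.filter (fun x => cT x = some c))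
  have hbad : bad.card ≤ 4 * k := by
    refine (card_union_le _ _).trans ?_
    have h4 : ((univ.filter (fun c => 1 ≤ ε c)).biUnion
        (fun c => univ.filter (fun x => cT x = some c))).card ≤ ∑ c, 2 * ε c := by
      refine card_biUnion_le.trans ?_
      refine (sum_le_sum (g := fun c => 2 * ε c) ?_).trans (sum_le_sum_of_subset (filter_subset _ _))
      intro c hc
      rw [mem_filter] at hc
      have := hε c
      omega
    rw [← mul_sum] at h4
    omega
  have hnb : ∀ α, α ∉ bad → ∃ c, cT α = some c ∧ ε c = 0 := by
    intro α hα
    simp only [bad, mem_union, mem_filter, mem_univ, true_and, mem_biUnion, not_or, not_exists, not_and] at hα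
    obtain ⟨c, hc⟩ := Option.ne_none_iff_exists'.1 hα.1
    refine ⟨c, hc, ?_⟩
    by_contra h
    exact hα.2 c (by omega) hc
  have hPX : ∀ α β, α ≠ β → α ∉ bad → β ∉ bad → loc α = loc β →
      ∀ d : G.Dart, d.fst = loc α → cD (d, false) = none := by
    intro α β hne hα hβ hl d hd
    by_contra hn
    obtain ⟨c, hc⟩ := Option.ne_none_iff_exists'.1 hn
    obtain ⟨c1, hc1, he1⟩ := hnb α hα
    obtain ⟨c2, hc2, he2⟩ := hnb β hβ
    have e1 := h3 d α c c1 hc hc1 hd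
    have e2 := h3 d β c c2 hc hc2 (hd.trans hl)
    subst e1; subst e2
    have h5 : 2 ≤ (univ.filter (fun x => cT x = some c)).card := by
      rw [← card_pair hne]
      apply card_le_card
      intro x hx
      simp only [mem_insert, mem_singleton] at hx
      rcases hx with rfl | rfl <;> simp [hc1, hc2]
    have := hε c
    omega
  by_cases hex : ∃ α β, α ≠ β ∧ α ∉ bad ∧ β ∉ bad ∧ loc α = loc β
  swap
  · refine ⟨∅, by simp, by simp, bad, hbad, ?_⟩
    intro α β ha hb hc hd
    exact absurd ⟨α, β, ha, hb, hc, hd⟩ hex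
  obtain ⟨α0, β0, hn0, hα0, hβ0, hl0⟩ := hex
  have hv0 := hPX α0 β0 hn0 hα0 hβ0 hl0
  let B2 : Finset G.Dart := univ.filter (fun d => cD (d, false) = none ∧ cD (d, true) = none)
  let NG : Finset (G.Dart × Bool) := univ.filter (fun x => (cD x ≠ none ∧ cD (gx x) = none) ∧
    ((∃ d', d'.fst = x.1.fst ∧ cD (d', !x.2) ≠ none) ∨ cD (x.1.symm, x.2) ≠ none))
  let XF : Finset (Sym2 V) := (B2 ∪ NG.image Prod.fst).image Dart.edge
  have hNG : NG.card ≤ 2 * ∑ c, ε c + 2 * B2.card := by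
    have hsplit := Finset.card_filter_add_card_filter_not (s := NG) (fun x => ∃ c, cD x = some c ∧ 1 ≤ ε c)
    have hA : (NG.filter (fun x => ∃ c, cD x = some c ∧ 1 ≤ ε c)).card ≤ 2 * ∑ c, ε c := by
      have hsub : NG.filter (fun x => ∃ c, cD x = some c ∧ 1 ≤ ε c) ⊆
        (univ.filter (fun c => 1 ≤ ε c)).biUnion (fun c => univ.filter (fun x => cD x = some c ∧ cD (gx x) = none)) := by
        intro x hx
        simp only [NG, mem_filter, mem_univ, true_and] at hx
        obtain ⟨⟨⟨_, hg⟩, _⟩, c, hc, hc1⟩ := hx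
        simp only [mem_biUnion, mem_filter, mem_univ, true_and]
        exact ⟨c, hc1, hc, hg⟩
      refine (card_le_card hsub).trans (card_biUnion_le.trans ?_)
      rw [mul_sum]
      refine (sum_le_sum (g := fun c => 2 * ε c) ?_).trans (sum_le_sum_of_subset (filter_subset _ _))
      intro c hc
      rw [mem_filter] at hc
      have := hε c
      omega
    have hB : (NG.filter (fun x => ¬ ∃ c, cD x = some c ∧ 1 ≤ ε c)).card ≤ 2 * B2.card := by
      have hdata : ∀ x ∈ NG.filter (fun x => ¬ ∃ c, cD x = some c ∧ 1 ≤ ε c), ∃ c, cD x = some c ∧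
          (∀ y, cD y = some c → cD (gx y) = none → y = x) ∧
          ∃ q : G.Dart × Bool, q.1 ∈ B2 ∧ 
            ((q.2 = true ∧ ∃ d1 : G.Dart, d1.fst = q.1.fst ∧ ∀ b, cD (d1, b) = some c) ∨
             (q.2 = false ∧ ∀ b, cD (q.1.symm, b) = some c)) := by
        rintro ⟨d0, b0⟩ hx
        simp only [NG, mem_filter, mem_univ, true_and] at hx
        obtain ⟨⟨⟨hx1, hx2⟩, hx3⟩, hx4⟩ := hx
        obtain ⟨c, hc⟩ := Option.ne_none_iff_exists'.1 hx1
        have hc0 : ε c = 0 := by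
          by_contra h
          exact hx4 ⟨c, hc, by omega⟩
        have hu : ∀ y, cD y = some c → cD (gx y) = none → y = (d0, b0) := by
          intro y hy1 hy2
          have h5 : (univ.filter (fun x => cD x = some c ∧ cD (gx x) = none)).card ≤ 1 := by
            have := hε c
            omega
          rw [card_le_one] at h5
          exact h5 y (by simp only [mem_filter, mem_univ, true_and]; exact ⟨hy1, hy2⟩) (d0, b0)
            (by simp only [mem_filter, mem_univ, true_and]; exact ⟨hc, hx2⟩)
        refine ⟨c, hc, hu, ?_⟩
        obtain ⟨d, hd1, hd2⟩ := lobe hconn hbr h1 h2 (loc α0) hv0 d0 b0 c hc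
          (fun d b e1 e2 => by simpa using hu (d, b) e1 e2) hx3
        rcases hd2 with hd2 | hd2
        · exact ⟨(d, true), by simp only [B2, mem_filter, mem_univ, true_and]; exact hd1, Or.inl ⟨rfl, hd2⟩⟩
        · exact ⟨(d, false), by simp only [B2, mem_filter, mem_univ, true_and]; exact hd1, Or.inr ⟨rfl, hd2⟩⟩
      choose! c hc hcu q hq1 hq2 using hdata
      have : (B2 ×ˢ (univ : Finset Bool)).card = 2 * B2.card := by
        rw [card_product]; simp [mul_comm]
      rw [← this]
      apply card_le_card_of_injOn q
      · intro x hx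
        simp only [coe_product, Set.mem_prod, coe_univ, Set.mem_univ, and_true]
        exact hq1 x hx
      · intro x hx y hy hxy
        have e : c x hx = c y hy := by
          rcases hq2 x hx with ⟨a1, d1, a2, a3⟩ | ⟨a1, a2⟩ <;>
          rcases hq2 y hy with ⟨b1, d2, b2, b3⟩ | ⟨b1, b2⟩
          · exact h1 d1 d2 false _ _ (by rw [a2, b2, hxy]) (a3 _) (b3 _)
          · rw [hxy, b1] at a1; cases a1
          · rw [hxy, b1] at a1; cases a1
          · rw [hxy] at a2
            have := (a2 false).symm.trans (b2 false)
            exact Option.some.inj this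
        have hyg : cD (gx y) = none := by
          have := hy
          simp only [NG, mem_filter, mem_univ, true_and, coe_filter, Set.mem_ofPred_eq] at this
          exact this.1.1.2
        exact (hcu x hx y (by rw [e]; exact hc y hy) hyg).symm
    omega
  refine ⟨↑XF, ?_, ?_, bad, hbad, ?_⟩
  · intro e he
    simp only [XF, coe_image, Set.mem_image] at he
    obtain ⟨d, -, rfl⟩ := he
    exact d.edge_mem
  · rw [Set.ncard_coe_finset]
    have h5 : XF.card ≤ B2.card + NG.card :=
      card_image_le.trans ((card_union_le _ _).trans (Nat.add_le_add_left card_image_le _))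
    change _ + _ + 2 * B2.card < _ at hsum
    omega
  · intro α β hne hα hβ hl
    apply color_comp (cD := cD)
    · intro d e1 e2
      simp only [XF, coe_image, Set.mem_image]
      exact ⟨d, by simp [B2, e1, e2], rfl⟩
    · intro d b e1 e2 e3
      simp only [XF, coe_image, Set.mem_image]
      refine ⟨d, ?_, rfl⟩
      rw [mem_coe, mem_union]
      right
      rw [mem_image]
      refine ⟨(d, b), ?_, rfl⟩
      simp only [NG, mem_filter, mem_univ, true_and]
      exact ⟨⟨e2, e1⟩, e3⟩
    · exact hPX α β hne hα hβ hl
end Cut2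

section EP
open Finset
universe u0

/-- labelling from a Tutte violator -/
lemma tutte_label {N : Type u0} [Fintype N] (H : SimpleGraph N) (heven : Even (Nat.card N))
    (hno : ¬ ∃ M : H.Subgraph, M.IsPerfectMatching) :
    ∃ (C : Type u0) (_ : Fintype C) (cls : N → Option C),
      (∀ x y c c', H.Adj x y → cls x = some c → cls y = some c' → c = c') ∧
      {x | cls x = none}.ncard + 2 ≤ {c | Odd {x | cls x = some c}.ncard}.ncard := by
  classical
  rw [tutte] at hno
  push Not at hno
  obtain ⟨W, hW⟩ := hno
  rw [IsTutteViolator] at hW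
  set K := ((⊤ : H.Subgraph).deleteVerts W).coe with hK
  have hmem : ∀ x, x ∈ ((⊤ : H.Subgraph).deleteVerts W).verts ↔ x ∉ W := by
    intro x; simp
  let cls : N → Option K.ConnectedComponent := fun x =>
    if h : x ∈ ((⊤ : H.Subgraph).deleteVerts W).verts then some (K.connectedComponentMk ⟨x, h⟩) else none
  have hnone : {x | cls x = none} = W := by
    ext x
    simp only [cls, Set.mem_ofPred_eq]
    split_ifs with h
    · simpa using (hmem x).1 h
    · simp only [true_iff]; by_contra h2; exact h ((hmem x).2 h2)
  have hsome : ∀ c, {x | cls x = some c}.ncard = c.supp.ncard := by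
    intro c
    have : {x | cls x = some c} = Subtype.val '' c.supp := by
      ext x
      simp only [cls, Set.mem_ofPred_eq, Set.mem_image]
      constructor
      · intro h
        split_ifs at h with h2
        exact ⟨⟨x, h2⟩, by simpa using h, rfl⟩
      · rintro ⟨⟨y, hy⟩, hyc, rfl⟩
        rw [dif_pos hy]
        simpa using hyc
    rw [this, Set.ncard_image_of_injective _ Subtype.val_injective]
  refine ⟨K.ConnectedComponent, Fintype.ofFinite _, cls, ?_, ?_⟩
  · intro x y c c' hxy hx hy
    simp only [cls] at hx hy
    split_ifs at hx with h1
    split_ifs at hy with h2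
    rw [← Option.some.inj hx, ← Option.some.inj hy, ConnectedComponent.eq]
    apply Adj.reachable
    rw [hK]
    simp only [Subgraph.coe_adj, Subgraph.deleteVerts_adj, Subgraph.top_adj]
    refine ⟨trivial, (hmem x).1 h1, trivial, (hmem y).1 h2, hxy⟩
  · rw [hnone]
    have e : {c | Odd {x | cls x = some c}.ncard} = K.oddComponents := by
      ext c
      simp only [Set.mem_ofPred_eq, hsome, oddComponents]
    rw [e]
    have hpar := K.odd_ncard_oddComponents
    have hcard : Nat.card ((⊤ : H.Subgraph).deleteVerts W).verts + W.ncard = Nat.card N := by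
      have : ((⊤ : H.Subgraph).deleteVerts W).verts = Wᶜ := by ext x; simp
      rw [Nat.card_coe_set_eq, this, add_comm, Set.ncard_add_ncard_compl]
    by_contra hlt
    have h1 : K.oddComponents.ncard = W.ncard + 1 := by omega
    rw [h1, Nat.odd_iff, Nat.odd_iff] at hpar
    rw [Nat.even_iff] at heven
    omega

theorem EP {V : Type*} [Fintype V] {G : SimpleGraph V} {τ : Type*} [Fintype τ] (loc : τ → V)
    (hconn : G.Connected) (hbr : ∀ e, ¬ G.IsBridge e) (k : ℕ) (hk : 2 * k ≤ Fintype.card τ) :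
    Pack G loc k ∨ CutC G loc k := by
  classical
  by_cases hM : ∃ M : (auxG G loc (Fin (Fintype.card τ - 2 * k))).Subgraph, M.IsPerfectMatching
  · obtain ⟨M, hM⟩ := hM
    exact Or.inl (pack_of_matching loc k _ (by omega) M hM)
  right
  obtain ⟨C, hC, cls, hadj, hcount⟩ := tutte_label _ (by
    rw [Nat.card_eq_fintype_card, Fintype.card_sum, Fintype.card_sum, Fintype.card_prod,
      Fintype.card_bool, Fintype.card_fin, Nat.even_iff]
    omega) hM
  have hfilt : ∀ (P : Nd G (τ := τ) (Fin (Fintype.card τ - 2 * k)) → Prop), {x | P x}.ncard =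
      (univ.filter (fun x => P (.inl x))).card + (univ.filter (fun x => P (.inr (.inl x)))).card
       + (univ.filter (fun x => P (.inr (.inr x)))).card := by
    intro P
    rw [Set.ncard_eq_toFinset_card', Set.toFinset_ofPred, card_filter, Fintype.sum_sum_type,
      Fintype.sum_sum_type, card_filter, card_filter, card_filter, add_assoc]
  rw [hfilt, Set.ncard_eq_toFinset_card', Set.toFinset_ofPred] at hcount
  simp only [hfilt] at hcount
  obtain ⟨-, ε, hε1, hε2⟩ := count_main (fun x => cls (.inl x)) (fun x => cls (.inr (.inl x)))
    (fun x => cls (.inr (.inr x))) k (by rw [Fintype.card_fin]; omega)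
    (fun d c c' h1 h2 => hadj _ _ c c' (by simp [auxG, auxRel]) h1 h2)
    (fun α e c c' h1 h2 => hadj _ _ c c' (by simp [auxG, auxRel]) h1 h2)
    (by convert hcount)
  refine cut_of_cls (cD := fun x => cls (.inl x)) (cT := fun x => cls (.inr (.inl x)))
    hconn hbr ?_ ?_ ?_ k ε hε1 hε2
  · intro d d' b c c' h e1 e2
    exact hadj _ _ c c' (by simp [auxG, auxRel, h]) e1 e2
  · intro d b c c' e1 e2
    exact hadj _ _ c c' (by simp [auxG, auxRel]) e1 e2
  · intro d α c c' e1 e2 h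
    exact hadj _ _ c c' (by simp [auxG, auxRel, h]) e1 e2
end EP

section Finish
open Finset
variable {V : Type*} {G : SimpleGraph V}

lemma hit_count {n : ℕ} (I : Immersion G (⊤ : SimpleGraph (Fin n))) (X : Finset (Sym2 V))
    [DecidablePred (fun p : Fin n × Fin n => ∃ h : (⊤ : SimpleGraph (Fin n)).Adj p.1 p.2, ∃ e ∈ X, e ∈ (I.trail h).edges)] :
    (univ.filter (fun p : Fin n × Fin n => ∃ h : (⊤ : SimpleGraph (Fin n)).Adj p.1 p.2,
      ∃ e ∈ X, e ∈ (I.trail h).edges)).card ≤ 2 * X.card := by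
  classical
  set P := (univ.filter (fun p : Fin n × Fin n => ∃ h : (⊤ : SimpleGraph (Fin n)).Adj p.1 p.2,
      ∃ e ∈ X, e ∈ (I.trail h).edges)) with hP
  have hdata : ∀ p ∈ P, ∃ e ∈ X, ∃ h : (⊤ : SimpleGraph (Fin n)).Adj p.1 p.2, e ∈ (I.trail h).edges := by
    intro p hp
    rw [hP, mem_filter] at hp
    obtain ⟨-, h, e, he, h2⟩ := hp
    exact ⟨e, he, h, h2⟩
  rcases P.eq_empty_or_nonempty with hemp | ⟨p0, hp0⟩
  · rw [hemp]; simp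
  have : Nonempty (Sym2 V) := ⟨(hdata p0 hp0).choose⟩
  choose! e he hadj hmem using hdata
  have : (X ×ˢ (univ : Finset Bool)).card = 2 * X.card := by
    rw [card_product]; simp [mul_comm]
  rw [← this]
  apply card_le_card_of_injOn (fun p => (e p, decide (p.1 < p.2)))
  · intro p hp
    simp only [coe_product, Set.mem_prod, coe_univ, Set.mem_univ, and_true]
    exact he p hp
  · rintro ⟨a, b⟩ hx ⟨a', b'⟩ hy hxy
    simp only [Prod.mk.injEq, decide_eq_decide] at hxy
    have h1 := hmem _ hx
    have h2 := hmem _ hy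
    rw [← hxy.1] at h2
    have h3 : s(a, b) = s(a', b') := by
      by_contra hne
      exact I.disjoint (hadj _ hx) (hadj _ hy) hne h1 h2
    have h4 : a ≠ b := hadj _ hx
    rw [Sym2.eq_iff] at h3
    rcases h3 with ⟨rfl, rfl⟩ | ⟨rfl, rfl⟩
    · rfl
    · exfalso
      rcases lt_or_gt_of_ne h4 with h | h
      · exact lt_asymm h (hxy.2.1 h)
      · exact lt_asymm h (hxy.2.2 h)

def idxA {t : ℕ} (a : Fin (1000 * t)) : Fin (1400 * t) := ⟨400 * t + a.1, by omega⟩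

lemma idxA_inj {t : ℕ} : Function.Injective (idxA (t := t)) := by
  intro a b h
  simp only [idxA, Fin.mk.injEq] at h
  exact Fin.ext (by omega)

lemma cut_finish [Fintype V] (t : ℕ) (ht : 49 ≤ t) (I : Immersion G (⊤ : SimpleGraph (Fin (1400 * t))))
    (hC : CutC G (fun p : Fin (1000 * t) × Fin t => I.φ (idxA p.1)) (t ^ 2)) :
    ∃ X ⊆ G.edgeSet, X.ncard ≤ 14000 * t ^ 2 ∧
      ∃ C : (G.deleteEdges X).ConnectedComponent,
        ((G.deleteEdges X).induce C.supp).Colorable 2 ∧ 700 * t < (Set.range I.φ ∩ C.supp).ncard := by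
  classical
  obtain ⟨X, hXE, hX, bad, hbad, hcol⟩ := hC
  refine ⟨X, hXE, by omega, ?_⟩
  have hXf : X.Finite := Set.toFinite X
  have hh := hit_count I hXf.toFinset
  set P := (univ.filter (fun p : Fin (1400 * t) × Fin (1400 * t) => ∃ h : (⊤ : SimpleGraph (Fin (1400 * t))).Adj p.1 p.2,
      ∃ e ∈ hXf.toFinset, e ∈ (I.trail h).edges)) with hP
  rw [← Set.ncard_eq_toFinset_card X hXf] at hh
  let good : Finset (Fin (1000 * t)) := univ.filter
    (fun a => ∃ i j : Fin t, i ≠ j ∧ (a, i) ∉ bad ∧ (a, j) ∉ bad)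
  have hgc : goodᶜ.card * (t - 1) ≤ 4 * t ^ 2 := by
    refine le_trans ?_ hbad
    rw [card_eq_sum_card_fiberwise (f := Prod.fst) (t := univ) (s := bad) (by simp)]
    refine le_trans ?_ (sum_le_sum_of_subset (subset_univ goodᶜ))
    rw [← smul_eq_mul]
    refine card_nsmul_le_sum _ _ _ ?_
    intro a ha
    simp only [good, mem_compl, mem_filter, mem_univ, true_and, not_exists, not_and, not_not] at ha
    have h1 : (univ.filter (fun i : Fin t => (a, i) ∉ bad)).card ≤ 1 := by
      rw [card_le_one]
      intro i hi j hj
      simp only [mem_filter, mem_univ, true_and] at hi hj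
      by_contra hij
      exact hj (ha i j hij hi)
    have h2 := card_filter_add_card_filter_not (s := (univ : Finset (Fin t))) (fun i => (a, i) ∈ bad)
    rw [card_univ, Fintype.card_fin] at h2
    have h3 : (univ.filter (fun i : Fin t => (a, i) ∈ bad)).card ≤ (bad.filter (fun x => x.1 = a)).card := by
      apply card_le_card_of_injOn (fun i => (a, i))
      · intro i hi
        simpa using hi
      · intro i _ j _ h; simpa using h
    omega
  have hex : ∃ a ∈ good, (P.filter (fun p => p.1 = idxA a)).card ≤ t := by
    by_contra hcon
    push Not at hcon
    have h1 : good.card * (t + 1) ≤ P.card := by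
      have h2 : ∑ a ∈ good, (P.filter (fun p => p.1 = idxA a)).card ≤ P.card := by
        rw [← card_biUnion]
        · apply card_le_card
          intro p hp
          simp only [mem_biUnion, mem_filter] at hp
          obtain ⟨a, -, hp, -⟩ := hp
          exact hp
        · intro a _ b _ hab
          rw [Function.onFun, Finset.disjoint_left]
          intro p hp hq
          rw [mem_filter] at hp hq
          exact hab (idxA_inj (hp.2.symm.trans hq.2))
      refine le_trans ?_ h2
      rw [← smul_eq_mul]
      refine card_nsmul_le_sum _ _ _ ?_
      intro a ha
      exact hcon a ha
    have h2 := card_add_card_compl good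
    rw [Fintype.card_fin] at h2
    obtain ⟨s, rfl⟩ : ∃ s, t = s + 1 := ⟨t - 1, by omega⟩
    simp only [Nat.add_sub_cancel] at hgc
    have h3 : goodᶜ.card ≤ 5 * (s + 1) := by
      by_contra h
      push Not at h
      have := Nat.mul_le_mul_right s h
      nlinarith
    have h4 : 995 * (s + 1) ≤ good.card := by omega
    have := Nat.mul_le_mul_right (s + 1 + 1) h4
    nlinarith
  obtain ⟨a, hag, haP⟩ := hex
  simp only [good, mem_filter, mem_univ, true_and] at hag
  obtain ⟨i, j, hij, hi, hj⟩ := hag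
  refine ⟨_, hcol (a, i) (a, j) (by simpa using hij) hi hj rfl, ?_⟩
  let R : Finset (Fin (1400 * t)) := univ \ (P.filter (fun p => p.1 = idxA a)).image Prod.snd
  have hR : 1399 * t ≤ R.card := by
    have h1 := le_card_sdiff ((P.filter (fun p => p.1 = idxA a)).image Prod.snd) univ
    have h2 : ((P.filter (fun p => p.1 = idxA a)).image Prod.snd).card ≤ t := card_image_le.trans haP
    rw [card_univ, Fintype.card_fin] at h1
    change _ ≤ R.card at h1
    omega
  have hsub : ((R.map I.φ : Finset V) : Set V) ⊆ Set.range I.φ ∩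
      ((G.deleteEdges X).connectedComponentMk (I.φ (idxA a))).supp := by
    intro v hv
    simp only [coe_map, Set.mem_image] at hv
    obtain ⟨b, hb, rfl⟩ := hv
    refine ⟨⟨b, rfl⟩, ?_⟩
    rw [ConnectedComponent.mem_supp_iff, ConnectedComponent.eq]
    by_cases hab : idxA a = b
    · rw [hab]
    · have hadj : (⊤ : SimpleGraph (Fin (1400 * t))).Adj (idxA a) b := hab
      have hw : ∀ e ∈ (I.trail hadj).edges, e ∉ X := by
        intro e he heX
        simp only [R, coe_sdiff, Set.mem_sdiff, mem_coe, mem_image, mem_filter, not_exists, not_and] at hb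
        refine hb.2 (idxA a, b) ?_ rfl
        rw [hP, mem_filter]
        exact ⟨⟨mem_univ _, hadj, e, by simpa using heX, he⟩, rfl⟩
      exact ⟨((I.trail hadj).toDeleteEdges X hw).reverse⟩
  have h5 := Set.ncard_le_ncard hsub (Set.toFinite _)
  rw [Set.ncard_coe_finset, card_map] at h5
  change 700 * t < (Set.range I.φ ∩ ((G.deleteEdges X).connectedComponentMk (I.φ (idxA a))).supp).ncard
  omega
end Finish

section Chg
variable {κ : Type*} [DecidableEq κ]

/-- number of changes in a list -/
def chg : List κ → ℕ
  | [] => 0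
  | [_] => 0
  | x :: y :: l => (if x = y then 0 else 1) + chg (y :: l)

lemma chg_split (l1 : List κ) (c : κ) (l2 : List κ) :
    chg (l1 ++ c :: l2) = chg (l1 ++ [c]) + chg (c :: l2) := by
  induction l1 with
  | nil => simp [chg]
  | cons x l ih =>
    cases l with
    | nil => simp [chg]
    | cons y l => simp only [List.cons_append, chg] at ih ⊢; rw [ih]; ring

lemma chg_le_append (l : List κ) (c : κ) : chg l ≤ chg (l ++ [c]) := by
  induction l with
  | nil => simp [chg]
  | cons x l ih =>
    cases l with
    | nil => simp [chg]
    | cons y l => simp only [List.cons_append, chg] at ih ⊢; omega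

lemma chg_const (l : List κ) (c : κ) (h : ∀ x ∈ l, x = c) : chg l = 0 := by
  induction l with
  | nil => rfl
  | cons x l ih =>
    cases l with
    | nil => rfl
    | cons y l =>
      have h1 := h x (by simp)
      have h2 := h y (by simp)
      simp only [chg, h1, h2, if_true, zero_add]
      rw [← h2]
      exact ih (fun z hz => h z (by simp only [List.mem_cons] at hz ⊢; tauto))

lemma chg_eq_zero (l : List κ) (h : chg l = 0) : ∀ x ∈ l, ∀ y ∈ l, x = y := by
  induction l with
  | nil => simp
  | cons x l ih =>
    cases l with
    | nil => simp
    | cons y l =>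
      simp only [chg] at h
      have hxy : x = y := by
        by_contra hne
        rw [if_neg hne] at h; omega
      have h2 := ih (by omega)
      subst hxy
      intro u hu v hv
      apply h2
      · simp only [List.mem_cons] at hu ⊢; tauto
      · simp only [List.mem_cons] at hv ⊢; tauto

lemma chg_reverse (l : List κ) : chg l.reverse = chg l := by
  induction l with
  | nil => rfl
  | cons x l ih =>
    cases l with
    | nil => rfl
    | cons y l =>
      rw [List.reverse_cons, List.reverse_cons, List.append_assoc, List.singleton_append, chg_split,
        ← List.reverse_cons, ih]
      simp only [chg]
      by_cases h : x = y
      · simp [h]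
      · simp [h, Ne.symm h]; omega
end Chg

section Reroute
variable {V : Type*} {G : SimpleGraph V} 

lemma exists_split {p q x x' : V} (Q : G.Walk p q) (h : G.Adj x x')
    (hd : (⟨(x, x'), h⟩ : G.Dart) ∈ Q.darts) :
    ∃ (R1 : G.Walk p x) (R2 : G.Walk x' q), Q = R1.append (Walk.cons h R2) := by
  induction Q with
  | nil => simp at hd
  | cons h' Q ih =>
    rw [Walk.darts_cons, List.mem_cons] at hd
    rcases hd with hd | hd
    · simp only [Dart.mk.injEq, Prod.mk.injEq] at hd
      obtain ⟨rfl, rfl⟩ := hd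
      exact ⟨Walk.nil, Q, rfl⟩
    · obtain ⟨R1, R2, rfl⟩ := ih hd
      exact ⟨Walk.cons h' R1, R2, rfl⟩

variable {κ : Type*} [DecidableEq κ] (cl : Sym2 V → κ)

def cost {u v : V} (w : G.Walk u v) : ℕ := chg (w.edges.map cl)

lemma reroute_core (c : κ) {a x x' p q : V} (T1 : G.Walk a x) (hT : T1.IsTrail)
    (hTc : ∀ e ∈ T1.edges, cl e = c) (hadj : G.Adj x x') (hc : cl s(x, x') = c)
    (R1 : G.Walk p x) (R2 : G.Walk x' q) (Q : G.Walk p q) (hQe : Q = R1.append (Walk.cons hadj R2))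
    (hQ : Q.IsTrail) (hodd : Odd Q.length) (hdis : T1.edges.Disjoint Q.edges) :
    (Q.edges.map cl).head? = some c ∨ (Q.edges.map cl).getLast? = some c ∨
    (∃ N : G.Walk p a, N.IsTrail ∧ Odd N.length ∧ (∀ e ∈ N.edges, e ∈ T1.edges ∨ e ∈ Q.edges) ∧
      cost cl N < cost cl Q) ∨
    (∃ N : G.Walk q a, N.IsTrail ∧ Odd N.length ∧ (∀ e ∈ N.edges, e ∈ T1.edges ∨ e ∈ Q.edges) ∧
      cost cl N < cost cl Q) := by
  have hlen : Q.length = R1.length + (R2.length + 1) := by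
    rw [hQe, Walk.length_append, Walk.length_cons]
  have hedges : Q.edges = R1.edges ++ s(x, x') :: R2.edges := by
    rw [hQe, Walk.edges_append, Walk.edges_cons]
  have hcost : cost cl Q = chg (R1.edges.map cl ++ [c]) + chg (c :: R2.edges.map cl) := by
    rw [cost, hedges, List.map_append, List.map_cons, hc, chg_split]
  have hTr : ∀ z ∈ (T1.edges.map cl), z = c := by
    intro z hz
    rw [List.mem_map] at hz
    obtain ⟨e, he, rfl⟩ := hz
    exact hTc e he
  rw [Walk.isTrail_def] at hQ hT
  rw [hedges] at hQ hdis
  rw [List.nodup_append] at hQ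
  obtain ⟨hn1, hn2, hn3⟩ := hQ
  by_cases hpar : Even T1.length ↔ Even R1.length
  · -- N1 = T1 e R2
    by_cases h0 : chg (R1.edges.map cl ++ [c]) = 0
    · left
      rw [hedges, List.map_append, List.map_cons, hc]
      have h1 := chg_eq_zero _ h0
      cases hm : R1.edges.map cl with
      | nil => simp
      | cons y l =>
        rw [hm] at h1
        have := h1 y (by simp) c (by simp)
        simp [this]
    · right; right; right
      refine ⟨(T1.append (Walk.cons hadj R2)).reverse, ?_, ?_, ?_, ?_⟩
      · rw [Walk.reverse_isTrail_iff, Walk.isTrail_def, Walk.edges_append, Walk.edges_cons, List.nodup_append]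
        refine ⟨hT, hn2, ?_⟩
        rintro e he f hf rfl
        exact hdis he (by simp only [List.mem_append]; exact Or.inr hf)
      · rw [Walk.length_reverse, Walk.length_append, Walk.length_cons]
        rw [hlen] at hodd
        rw [Nat.odd_add] at hodd ⊢
        rw [← hodd, ← Nat.not_even_iff_odd, ← Nat.not_even_iff_odd, hpar]
      · intro e he
        rw [Walk.edges_reverse, List.mem_reverse, Walk.edges_append, List.mem_append, Walk.edges_cons] at he
        rcases he with he | he
        · exact Or.inl he
        · right; rw [hedges, List.mem_append]; exact Or.inr he
      · rw [cost, Walk.edges_reverse, List.map_reverse, chg_reverse, hcost, Walk.edges_append,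
          Walk.edges_cons, List.map_append, List.map_cons, hc, chg_split, chg_const _ c]
        · omega
        · intro z hz
          rw [List.mem_append, List.mem_singleton] at hz
          exact hz.elim (hTr z) id
  · by_cases h0 : chg (c :: R2.edges.map cl) = 0
    · right; left
      rw [hedges, List.map_append, List.map_cons, hc, List.getLast?_append]
      have h1 := chg_eq_zero _ h0
      have h2 : (c :: R2.edges.map cl).getLast? = some c := by
        rw [List.getLast?_eq_some_getLast (by simp)]
        congr 1
        exact h1 _ (List.getLast_mem _) _ (by simp)
      rw [h2]; rfl
    · right; right; left
      refine ⟨R1.append T1.reverse, ?_, ?_, ?_, ?_⟩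
      · rw [Walk.isTrail_def, Walk.edges_append, Walk.edges_reverse, List.nodup_append]
        refine ⟨hn1, List.nodup_reverse.2 hT, ?_⟩
        rintro e he f hf rfl
        exact hdis (List.mem_reverse.1 hf) (by simp only [List.mem_append]; exact Or.inl he)
      · rw [Walk.length_append, Walk.length_reverse, Nat.odd_add, ← Nat.not_even_iff_odd]
        tauto
      · intro e he
        rw [Walk.edges_append, Walk.edges_reverse, List.mem_append, List.mem_reverse] at he
        rcases he with he | he
        · right; rw [hedges, List.mem_append]; exact Or.inl he
        · exact Or.inl he
      · have : chg (R1.edges.map cl ++ (T1.edges.map cl).reverse) ≤ chg (R1.edges.map cl ++ [c]) := by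
          cases hm : (T1.edges.map cl).reverse with
          | nil => rw [List.append_nil]; exact chg_le_append _ _
          | cons y l =>
            have hall : ∀ z ∈ y :: l, z = c := by
              intro z hz
              rw [← hm, List.mem_reverse] at hz
              exact hTr z hz
            rw [chg_split, chg_const (y :: l) c hall, hall y (by simp)]; simp
        rw [hcost, cost, Walk.edges_append, Walk.edges_reverse, List.map_append, List.map_reverse]
        omega

lemma reroute (c : κ) {a x x' p q : V} (T1 : G.Walk a x) (hT : T1.IsTrail)
    (hTc : ∀ e ∈ T1.edges, cl e = c) (hadj : G.Adj x x') (hc : cl s(x, x') = c)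
    (Q : G.Walk p q) (hmem : s(x, x') ∈ Q.edges)
    (hQ : Q.IsTrail) (hodd : Odd Q.length) (hdis : T1.edges.Disjoint Q.edges) :
    (Q.edges.map cl).head? = some c ∨ (Q.edges.map cl).getLast? = some c ∨
    (∃ N : G.Walk p a, N.IsTrail ∧ Odd N.length ∧ (∀ e ∈ N.edges, e ∈ T1.edges ∨ e ∈ Q.edges) ∧
      cost cl N < cost cl Q) ∨
    (∃ N : G.Walk q a, N.IsTrail ∧ Odd N.length ∧ (∀ e ∈ N.edges, e ∈ T1.edges ∨ e ∈ Q.edges) ∧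
      cost cl N < cost cl Q) := by
  have hmem' := hmem
  rw [Walk.edges, List.mem_map] at hmem'
  obtain ⟨d, hd, hde⟩ := hmem'
  have : d = ⟨(x, x'), hadj⟩ ∨ d = ⟨(x', x), hadj.symm⟩ := by
    have h1 : d.edge = (⟨(x, x'), hadj⟩ : G.Dart).edge := hde
    rw [dart_edge_eq_iff] at h1
    exact h1
  rcases this with rfl | rfl
  · obtain ⟨R1, R2, h⟩ := exists_split Q hadj hd
    exact reroute_core cl c T1 hT hTc hadj hc R1 R2 Q h hQ hodd hdis
  · have hd' : (⟨(x, x'), hadj⟩ : G.Dart) ∈ Q.reverse.darts := by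
      rw [Walk.darts_reverse, List.mem_reverse, List.mem_map]
      exact ⟨_, hd, rfl⟩
    obtain ⟨R1, R2, h⟩ := exists_split Q.reverse hadj hd'
    have := reroute_core cl c T1 hT hTc hadj hc R1 R2 Q.reverse h (by simpa using hQ) (by simpa using hodd)
      (by rw [Walk.edges_reverse]; intro e he hf; exact hdis he (List.mem_reverse.1 hf))
    simp only [cost, Walk.edges_reverse, List.map_reverse, chg_reverse, List.head?_reverse,
      List.getLast?_reverse, List.mem_reverse] at this
    rcases this with h | h | h | h
    · exact Or.inr (Or.inl h)
    · exact Or.inl h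
    · exact Or.inr (Or.inr (Or.inr h))
    · exact Or.inr (Or.inr (Or.inl h))
end Reroute

section Minimal
variable {V : Type*} {G : SimpleGraph V}

lemma first_hit (P : Sym2 V → Prop) {u v : V} (T : G.Walk u v) (h : ∃ e ∈ T.edges, P e) :
    ∃ (x x' : V) (hx : G.Adj x x') (T1 : G.Walk u x) (T2 : G.Walk x' v),
      T = T1.append (Walk.cons hx T2) ∧ P s(x, x') ∧ ∀ e ∈ T1.edges, ¬ P e := by
  classical
  induction T with
  | nil => simp at h
  | @cons a b c hab T ih =>
    by_cases hP : P s(a, b)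
    · exact ⟨a, b, hab, Walk.nil, T, rfl, hP, by simp⟩
    · have : ∃ e ∈ T.edges, P e := by
        obtain ⟨e, he, hPe⟩ := h
        rw [Walk.edges_cons, List.mem_cons] at he
        rcases he with rfl | he
        · exact absurd hPe hP
        · exact ⟨e, he, hPe⟩
      obtain ⟨x, x', hx, T1, T2, rfl, h1, h2⟩ := ih this
      refine ⟨x, x', hx, Walk.cons hab T1, T2, rfl, h1, ?_⟩
      intro e he
      rw [Walk.edges_cons, List.mem_cons] at he
      rcases he with rfl | he
      · exact hP
      · exact h2 e he

/-- A walk joining the images of two indices. -/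
structure Tr {A : Type*} (G : SimpleGraph V) (ψ : A → V) where
  p : A
  q : A
  w : G.Walk (ψ p) (ψ q)

/-- load of the index `a` on a single walk -/
def Tr.load {A : Type*} [DecidableEq A] {ψ : A → V} (Q : Tr G ψ) (a : A) : ℕ :=
  (if Q.p = a then 1 else 0) + (if Q.q = a then 1 else 0)

/-- A packing of odd trails with capacity `D`. -/
def GoodP {A : Type*} [DecidableEq A] {ψ : A → V} {k : ℕ} (D : ℕ) (Q : Fin k → Tr G ψ) : Prop :=
  (∀ i, (Q i).w.IsTrail ∧ Odd (Q i).w.length) ∧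
  (∀ i j, i ≠ j → List.Disjoint (Q i).w.edges (Q j).w.edges) ∧
  (∀ a, ∑ i, (Q i).load a ≤ D)

lemma pack_goodP {A : Type*} [DecidableEq A] {ψ : A → V} {k D : ℕ}
    (h : Pack G (fun p : A × Fin D => ψ p.1) k) : ∃ Q : Fin k → Tr G ψ, GoodP D Q := by
  classical
  obtain ⟨s, e, w, h1, h2, h3⟩ := h
  refine ⟨fun i => ⟨(s i).1, (e i).1, w i⟩, h1, h2, ?_⟩
  intro a
  have : ∑ i, Tr.load (⟨(s i).1, (e i).1, w i⟩ : Tr G ψ) a =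
      (Finset.univ.filter (fun x : Fin k ⊕ Fin k => (Sum.elim s e x).1 = a)).card := by
    rw [Finset.card_filter, Fintype.sum_sum_type]
    simp only [Tr.load, Sum.elim_inl, Sum.elim_inr]
    rw [Finset.sum_add_distrib]
    congr 1 <;> exact Finset.sum_congr rfl (fun x _ => by congr)
  rw [this]
  have h4 : (Finset.univ : Finset (Fin D)).card = D := by simp
  conv_rhs => rw [← h4]
  apply Finset.card_le_card_of_injOn (fun x => (Sum.elim s e x).2)
  · intro x _; simp
  · intro x hx y hy hxy
    simp only [Finset.coe_filter, Finset.mem_univ, true_and, Set.mem_ofPred_eq] at hx hy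
    exact h3 (Prod.ext (hx.trans hy.symm) hxy)

open Classical in
/-- class of an edge with respect to an immersion -/
noncomputable def cls {n : ℕ} (I : Immersion G (⊤ : SimpleGraph (Fin n))) (e : Sym2 V) :
    Option (Sym2 (Fin n)) :=
  if h : ∃ (u v : Fin n) (h : (⊤ : SimpleGraph (Fin n)).Adj u v), e ∈ (I.trail h).edges then
    some s(h.choose, h.choose_spec.choose) else none

lemma cls_eq {n : ℕ} (I : Immersion G (⊤ : SimpleGraph (Fin n))) (e : Sym2 V) {u v : Fin n}
    (h : (⊤ : SimpleGraph (Fin n)).Adj u v) (he : e ∈ (I.trail h).edges) :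
    cls I e = some s(u, v) := by
  have hex : ∃ (u v : Fin n) (h : (⊤ : SimpleGraph (Fin n)).Adj u v), e ∈ (I.trail h).edges :=
    ⟨u, v, h, he⟩
  rw [cls, dif_pos hex]
  congr 1
  by_contra hne
  obtain ⟨h2, he2⟩ := hex.choose_spec.choose_spec
  exact I.disjoint h2 h hne he2 he

lemma load_update {A : Type*} [DecidableEq A] {ψ : A → V} {k : ℕ} (Q : Fin k → Tr G ψ) (i : Fin k)
    (z a : A) (hz : z = (Q i).p ∨ z = (Q i).q) (N : G.Walk (ψ z) (ψ a)) (v : A) :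
    ∑ j, (Function.update Q i ⟨z, a, N⟩ j).load v ≤ ∑ j, (Q j).load v + (if a = v then 1 else 0) := by
  rw [← Finset.add_sum_erase _ _ (Finset.mem_univ i), ← Finset.add_sum_erase _ (fun j => (Q j).load v) (Finset.mem_univ i)]
  rw [Finset.sum_congr rfl (g := fun j => (Q j).load v)]
  · rw [Function.update_self]
    simp only [Tr.load]
    rcases hz with rfl | rfl <;> split_ifs <;> omega
  · intro j hj
    rw [Function.update_of_ne (Finset.ne_of_mem_erase hj)]

lemma goodP_update {A : Type*} [DecidableEq A] {ψ : A → V} {k D : ℕ} (Q : Fin k → Tr G ψ)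
    (hQ : GoodP D Q) (i : Fin k)
    (z a : A) (hz : z = (Q i).p ∨ z = (Q i).q) (ha : ∑ j, (Q j).load a < D)
    (N : G.Walk (ψ z) (ψ a)) (hN : N.IsTrail) (hodd : Odd N.length)
    (hsub : ∀ j, j ≠ i → N.edges.Disjoint (Q j).w.edges) :
    GoodP D (Function.update Q i ⟨z, a, N⟩) := by
  refine ⟨?_, ?_, ?_⟩
  · intro j
    by_cases hj : j = i
    · subst hj; rw [Function.update_self]; exact ⟨hN, hodd⟩
    · rw [Function.update_of_ne hj]; exact hQ.1 j
  · intro j l hjl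
    by_cases hj : j = i
    · subst hj
      rw [Function.update_self, Function.update_of_ne hjl.symm]; exact hsub l hjl.symm
    · by_cases hl : l = i
      · subst hl
        rw [Function.update_self, Function.update_of_ne hj]; exact (hsub j hj).symm
      · rw [Function.update_of_ne hj, Function.update_of_ne hl]; exact hQ.2.1 j l hjl
  · intro v
    have h1 := load_update Q i z a hz N v
    have h2 := hQ.2.2 v
    by_cases hv : a = v
    · subst hv; rw [if_pos rfl] at h1; omega
    · rw [if_neg hv] at h1; omega

lemma cost_update {A : Type*} {ψ : A → V} {k : ℕ} (c : Tr G ψ → ℕ) (Q : Fin k → Tr G ψ) (i : Fin k)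
    (N : Tr G ψ) (h : c N < c (Q i)) : ∑ j, c (Function.update Q i N j) < ∑ j, c (Q j) := by
  rw [← Finset.add_sum_erase _ _ (Finset.mem_univ i), ← Finset.add_sum_erase _ (fun j => c (Q j)) (Finset.mem_univ i)]
  rw [Finset.sum_congr rfl (g := fun j => c (Q j))]
  · rw [Function.update_self]; omega
  · intro j hj
    rw [Function.update_of_ne (Finset.ne_of_mem_erase hj)]

lemma minimal_pack {A : Type*} [DecidableEq A] {n k D : ℕ}
    (I : Immersion G (⊤ : SimpleGraph (Fin n))) (idx : A → Fin n)
    (h0 : ∃ Q : Fin k → Tr G (fun a => I.φ (idx a)), GoodP D Q) :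
    ∃ Q : Fin k → Tr G (fun a => I.φ (idx a)), GoodP D Q ∧
      ∃ F : Finset (Sym2 (Fin n)), F.card ≤ 2 * k ∧
        ∀ a : A, ∑ j, (Q j).load a < D → ∀ (b : Fin n)
          (h : (⊤ : SimpleGraph (Fin n)).Adj (idx a) b), s(idx a, b) ∉ F →
          ∀ i, (I.trail h).edges.Disjoint (Q i).w.edges := by
  classical
  obtain ⟨Q, hQ, hmin⟩ : ∃ Q : Fin k → Tr G (fun a => I.φ (idx a)), GoodP D Q ∧
      ∀ Q' : Fin k → Tr G (fun a => I.φ (idx a)), GoodP D Q' →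
        ∑ j, cost (cls I) (Q j).w ≤ ∑ j, cost (cls I) (Q' j).w := by
    have hex : ∃ m, ∃ Q : Fin k → Tr G (fun a => I.φ (idx a)), GoodP D Q ∧
        ∑ j, cost (cls I) (Q j).w = m := by
      obtain ⟨Q, hQ⟩ := h0; exact ⟨_, Q, hQ, rfl⟩
    obtain ⟨Q, hQ, hm⟩ := Nat.find_spec hex
    refine ⟨Q, hQ, fun Q' hQ' => ?_⟩
    rw [hm]
    exact Nat.find_min' hex ⟨Q', hQ', rfl⟩
  refine ⟨Q, hQ, ?_⟩
  let lab : Fin k → Bool → Option (Option (Sym2 (Fin n))) := fun i b =>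
    if b then ((Q i).w.edges.map (cls I)).head? else ((Q i).w.edges.map (cls I)).getLast?
  let F' : Finset (Option (Option (Sym2 (Fin n)))) :=
    Finset.univ.image (fun x : Fin k × Bool => lab x.1 x.2)
  refine ⟨Finset.univ.filter (fun s => some (some s) ∈ F'), ?_, ?_⟩
  · calc _ ≤ F'.card := by
          apply Finset.card_le_card_of_injOn (fun s => some (some s))
          · intro s hs; exact (Finset.mem_filter.1 hs).2
          · intro x _ y _ h; simpa using h
      _ ≤ (Finset.univ : Finset (Fin k × Bool)).card := Finset.card_image_le
      _ = 2 * k := by simp [mul_comm]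
  · intro a ha b h hF
    by_contra hcon
    push Not at hcon
    obtain ⟨i0, hi0⟩ := hcon
    have hit : ∃ e ∈ (I.trail h).edges, ∃ i, e ∈ (Q i).w.edges := by
      by_contra hc
      push Not at hc
      exact hi0 (fun e he hf => hc e he i0 hf)
    obtain ⟨x, x', hx, T1, T2, hT, ⟨i, hi⟩, hT1⟩ := first_hit _ _ hit
    push Not at hT1
    have htr := I.isTrail h
    have hcl : ∀ e ∈ (I.trail h).edges, cls I e = some s(idx a, b) := fun e he => cls_eq I e h he
    rw [hT] at htr hcl
    have hsub1 : ∀ e ∈ T1.edges, cls I e = some s(idx a, b) := fun e he => hcl e (by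
      rw [Walk.edges_append, List.mem_append]; exact Or.inl he)
    have hnot : ∀ bb, lab i bb ≠ some (some s(idx a, b)) := by
      intro bb hbb
      apply hF
      rw [Finset.mem_filter]
      exact ⟨Finset.mem_univ _, Finset.mem_image.2 ⟨(i, bb), Finset.mem_univ _, hbb⟩⟩
    have key : ∀ z : A, (z = (Q i).p ∨ z = (Q i).q) → ∀ N : G.Walk (I.φ (idx z)) (I.φ (idx a)),
        N.IsTrail → Odd N.length → (∀ e ∈ N.edges, e ∈ T1.edges ∨ e ∈ (Q i).w.edges) →
        ¬ cost (cls I) N < cost (cls I) (Q i).w := by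
      intro z hz N hN hodd hsub hcost
      have hg := goodP_update Q hQ i z a hz ha N hN hodd (by
        intro j hj e he hf
        rcases hsub e he with h1 | h1
        · exact hT1 e h1 j hf
        · exact hQ.2.1 i j hj.symm h1 hf)
      have h1 := hmin _ hg
      have h2 := cost_update (fun X : Tr G (fun a => I.φ (idx a)) => cost (cls I) X.w) Q i ⟨z, a, N⟩ hcost
      omega
    rcases reroute (cls I) (some s(idx a, b)) T1 (htr.of_append_left) hsub1 hx
      (hcl _ (by rw [Walk.edges_append, List.mem_append, Walk.edges_cons]; simp)) (Q i).w hi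
      (hQ.1 i).1 (hQ.1 i).2 (fun e he hf => hT1 e he i hf) with h1 | h1 | ⟨N, h1, h2, h3, h4⟩ | ⟨N, h1, h2, h3, h4⟩
    · exact hnot true (by simpa [lab] using h1)
    · exact hnot false (by simpa [lab] using h1)
    · exact key _ (Or.inl rfl) N h1 h2 h3 h4
    · exact key _ (Or.inr rfl) N h1 h2 h3 h4

end Minimal

section Build
variable {V : Type*} {G : SimpleGraph V}

lemma build_odd {t : ℕ} (ψ : Fin t ↪ V)
    (R : ∀ d : {x : Fin t × Fin t // x.1 < x.2}, G.Walk (ψ d.1.1) (ψ d.1.2))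
    (hR : ∀ d, (R d).IsTrail ∧ Odd (R d).length)
    (hdis : ∀ d d', d ≠ d' → (R d).edges.Disjoint (R d').edges) :
    HasTotallyOddImmersion G (⊤ : SimpleGraph (Fin t)) := by
  classical
  let T : ∀ ⦃u v : Fin t⦄, (⊤ : SimpleGraph (Fin t)).Adj u v → G.Walk (ψ u) (ψ v) := fun u v h =>
    if hlt : u < v then R ⟨(u, v), hlt⟩ else
      (R ⟨(v, u), lt_of_le_of_ne (not_lt.1 hlt) h.ne.symm⟩).reverse
  have hT : ∀ ⦃u v : Fin t⦄ (h : (⊤ : SimpleGraph (Fin t)).Adj u v), ∃ d : {x : Fin t × Fin t // x.1 < x.2},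
      s(d.1.1, d.1.2) = s(u, v) ∧ (T h).length = (R d).length ∧ (∀ e, e ∈ (T h).edges ↔ e ∈ (R d).edges) ∧
      ((R d).IsTrail → (T h).IsTrail) := by
    intro u v h
    by_cases hlt : u < v
    · refine ⟨⟨(u, v), hlt⟩, rfl, ?_⟩
      simp only [T, dif_pos hlt]
      exact ⟨trivial, fun _ => by trivial, id⟩
    · refine ⟨⟨(v, u), lt_of_le_of_ne (not_lt.1 hlt) h.ne.symm⟩, Sym2.eq_swap, ?_⟩
      simp only [T, dif_neg hlt]
      refine ⟨Walk.length_reverse _, fun e => ?_, fun h => ?_⟩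
      · rw [Walk.edges_reverse, List.mem_reverse]
      · rwa [Walk.reverse_isTrail_iff]
  refine ⟨⟨ψ, T, ?_, ?_, ?_⟩, ?_⟩
  · intro u v h
    obtain ⟨d, -, -, -, h1⟩ := hT h
    exact h1 (hR d).1
  · intro u v h
    rcases lt_or_gt_of_ne h.ne with hlt | hlt
    · simp only [T, dif_pos hlt, dif_neg (not_lt.2 hlt.le)]
    · simp only [T, dif_pos hlt, dif_neg (not_lt.2 hlt.le), Walk.reverse_reverse]
  · intro u v a b h1 h2 hne e he hf
    obtain ⟨d, h3, -, h4, -⟩ := hT h1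
    obtain ⟨d', h3', -, h4', -⟩ := hT h2
    refine hdis d d' ?_ ((h4 e).1 he) ((h4' e).1 hf)
    rintro rfl
    exact hne (h3.symm.trans h3')
  · intro u v h
    obtain ⟨d, -, h1, -, -⟩ := hT h
    show Odd (T h).length
    rw [h1]; exact (hR d).2

lemma greedy {H A : Type*} [Fintype H] [DecidableEq H] [DecidableEq A] (avail : H → Finset A)
    (conf : H → H → Prop) [DecidableRel conf] (hsym : ∀ x y, conf x y → conf y x) (m : ℕ)
    (hdeg : ∀ h, (Finset.univ.filter (fun x => conf h x)).card ≤ m)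
    (hav : ∀ h, m < (avail h).card) :
    ∃ f : H → A, (∀ h, f h ∈ avail h) ∧ ∀ h h', h ≠ h' → conf h h' → f h ≠ f h' := by
  have main : ∀ s : Finset H, ∃ f : H → A, (∀ h, f h ∈ avail h) ∧
      ∀ h ∈ s, ∀ h' ∈ s, h ≠ h' → conf h h' → f h ≠ f h' := by
    intro s
    induction s using Finset.induction_on with
    | empty =>
      have : ∀ h, ∃ x, x ∈ avail h := fun h => Finset.card_pos.1 (by have := hav h; omega)
      choose f hf using this
      exact ⟨f, hf, by simp⟩
    | insert a s ha ih =>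
      obtain ⟨f, h1, h2⟩ := ih
      obtain ⟨x, hx, hx2⟩ : ∃ x ∈ avail a, x ∉ (Finset.univ.filter (fun x => conf a x)).image f := by
        apply Finset.exists_mem_notMem_of_card_lt_card
        exact lt_of_le_of_lt (Finset.card_image_le.trans (hdeg a)) (hav a)
      have hx3 : ∀ h, conf a h → x ≠ f h := by
        rintro h hc rfl
        exact hx2 (Finset.mem_image.2 ⟨h, by simpa using hc, rfl⟩)
      refine ⟨Function.update f a x, ?_, ?_⟩
      · intro h
        by_cases hh : h = a
        · subst hh; rwa [Function.update_self]
        · rw [Function.update_of_ne hh]; exact h1 h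
      · intro h hh h' hh' hne hc
        rw [Finset.mem_insert] at hh hh'
        by_cases e1 : h = a
        · subst e1
          rw [Function.update_self, Function.update_of_ne hne.symm]
          exact hx3 _ hc
        · by_cases e2 : h' = a
          · subst e2
            rw [Function.update_self, Function.update_of_ne hne]
            exact (hx3 _ (hsym _ _ hc)).symm
          · rw [Function.update_of_ne e1, Function.update_of_ne e2]
            exact h2 h (hh.resolve_left e1) h' (hh'.resolve_left e2) hne hc
  obtain ⟨f, h1, h2⟩ := main Finset.univ
  exact ⟨f, h1, fun h h' => h2 h (Finset.mem_univ _) h' (Finset.mem_univ _)⟩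

lemma half {n : ℕ} (I : Immersion G (⊤ : SimpleGraph (Fin n)))
    (hEven : ∀ ⦃u v : Fin n⦄ (h : (⊤ : SimpleGraph (Fin n)).Adj u v), Even (I.trail h).length)
    (P : Sym2 V → Prop) (β x p : Fin n) (h1 : (⊤ : SimpleGraph (Fin n)).Adj x β)
    (h2 : (⊤ : SimpleGraph (Fin n)).Adj x p) (h3 : β ≠ p)
    (hP1 : ∀ e ∈ (I.trail h1).edges, ¬ P e) (hP2 : ∀ e ∈ (I.trail h2).edges, ¬ P e) :
    ∃ L : G.Walk (I.φ β) (I.φ p), L.IsTrail ∧ Even L.length ∧ (∀ e ∈ L.edges, ¬ P e) ∧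
      ∀ e ∈ L.edges, cls I e = some s(x, β) ∨ cls I e = some s(x, p) := by
  have hd : (I.trail h1).edges.Disjoint (I.trail h2).edges := by
    apply I.disjoint
    intro h
    rw [Sym2.eq_iff] at h
    rcases h with ⟨-, h⟩ | ⟨h, h'⟩
    · exact h3 h
    · exact h3 (h'.trans h)
  refine ⟨(I.trail h1).reverse.append (I.trail h2), ?_, ?_, ?_, ?_⟩
  · rw [Walk.isTrail_def, Walk.edges_append, Walk.edges_reverse, List.nodup_append]
    refine ⟨List.nodup_reverse.2 (I.isTrail h1).edges_nodup, (I.isTrail h2).edges_nodup, ?_⟩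
    rintro a ha b hb rfl
    exact hd (List.mem_reverse.1 ha) hb
  · rw [Walk.length_append, Walk.length_reverse]
    exact (hEven h1).add (hEven h2)
  · intro e he
    rw [Walk.edges_append, Walk.edges_reverse, List.mem_append, List.mem_reverse] at he
    exact he.elim (hP1 e) (hP2 e)
  · intro e he
    rw [Walk.edges_append, Walk.edges_reverse, List.mem_append, List.mem_reverse] at he
    exact he.imp (cls_eq I e h1) (cls_eq I e h2)

/-- Demands and half-demands. -/
abbrev Dem (t : ℕ) := {x : Fin t × Fin t // x.1 < x.2}

/-- The end of a half-demand. -/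
def hEnd {t : ℕ} (h : Dem t × Bool) : Fin t := cond h.2 h.1.1.1 h.1.1.2

/-- The end of the packed trail associated with a half-demand. -/
def qEnd {A : Type*} {ψ : A → V} {t k : ℕ} (Q : Fin k → Tr G ψ) (ε : Dem t → Fin k)
    (h : Dem t × Bool) : A := cond h.2 (Q (ε h.1)).p (Q (ε h.1)).q

lemma assemble_routes {t k n : ℕ} {ψ : Fin n ↪ V} (b : Fin t ↪ Fin n) {A : Type*} (idx : A → Fin n)
    (Q : Fin k → Tr G (fun a => ψ (idx a)))
    (hQ1 : ∀ i, (Q i).w.IsTrail ∧ Odd (Q i).w.length)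
    (hQ2 : ∀ i j, i ≠ j → List.Disjoint (Q i).w.edges (Q j).w.edges)
    (ε : Dem t → Fin k) (hε : Function.Injective ε)
    (L : ∀ h : Dem t × Bool, G.Walk (ψ (b (hEnd h))) (ψ (idx (qEnd Q ε h))))
    (hL : ∀ h, (L h).IsTrail ∧ Even (L h).length)
    (hLQ : ∀ h i, (L h).edges.Disjoint (Q i).w.edges)
    (hLL : ∀ h h', h ≠ h' → (L h).edges.Disjoint (L h').edges) :
    HasTotallyOddImmersion G (⊤ : SimpleGraph (Fin t)) := by
  let L1 : ∀ d : Dem t, G.Walk (ψ (b d.1.1)) (ψ (idx (Q (ε d)).p)) := fun d => L (d, true)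
  let L2 : ∀ d : Dem t, G.Walk (ψ (b d.1.2)) (ψ (idx (Q (ε d)).q)) := fun d => L (d, false)
  let R : ∀ d : Dem t, G.Walk (ψ (b d.1.1)) (ψ (b d.1.2)) := fun d =>
    (L1 d).append ((Q (ε d)).w.append (L2 d).reverse)
  have hmem : ∀ d e, e ∈ (R d).edges ↔ e ∈ (L (d, true)).edges ∨ e ∈ (Q (ε d)).w.edges ∨ e ∈ (L (d, false)).edges := by
    intro d e
    show e ∈ ((L1 d).append ((Q (ε d)).w.append (L2 d).reverse)).edges ↔ e ∈ (L1 d).edges ∨ _ ∨ e ∈ (L2 d).edges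
    rw [Walk.edges_append, Walk.edges_append, Walk.edges_reverse, List.mem_append, List.mem_append, List.mem_reverse]
  refine build_odd (b.trans ψ) R ?_ ?_
  · intro d
    have h1 : (L1 d).IsTrail ∧ Even (L1 d).length := hL (d, true)
    have h2 : (L2 d).IsTrail ∧ Even (L2 d).length := hL (d, false)
    have h3 : ∀ i, (L1 d).edges.Disjoint (Q i).w.edges := hLQ (d, true)
    have h4 : ∀ i, (L2 d).edges.Disjoint (Q i).w.edges := hLQ (d, false)
    have h5 : (L1 d).edges.Disjoint (L2 d).edges := hLL (d, true) (d, false) (by simp)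
    constructor
    · show ((L1 d).append ((Q (ε d)).w.append (L2 d).reverse)).IsTrail
      rw [Walk.isTrail_def, Walk.edges_append, Walk.edges_append, Walk.edges_reverse, List.nodup_append,
        List.nodup_append]
      refine ⟨h1.1.edges_nodup, ⟨(hQ1 _).1.edges_nodup, List.nodup_reverse.2 h2.1.edges_nodup, ?_⟩, ?_⟩
      · rintro x hx y hy rfl
        exact h4 _ (List.mem_reverse.1 hy) hx
      · rintro x hx y hy rfl
        rw [List.mem_append, List.mem_reverse] at hy
        rcases hy with hy | hy
        · exact h3 _ hx hy
        · exact h5 hx hy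
    · show Odd ((L1 d).append ((Q (ε d)).w.append (L2 d).reverse)).length
      rw [Walk.length_append, Walk.length_append, Walk.length_reverse]
      exact h1.2.add_odd ((hQ1 _).2.add_even h2.2)
  · intro d d' hne e he hf
    replace he := (hmem d e).1 he
    replace hf := (hmem d' e).1 hf
    have a1 : ∀ x y, ((d, x) : Dem t × Bool) ≠ (d', y) := fun x y h => hne (Prod.ext_iff.1 h).1
    rcases he with he | he | he <;> rcases hf with hf | hf | hf
    · exact hLL _ _ (a1 _ _) he hf
    · exact hLQ _ _ he hf
    · exact hLL _ _ (a1 _ _) he hf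
    · exact hLQ _ _ hf he
    · exact hQ2 _ _ (fun h => hne (hε h)) he hf
    · exact hLQ _ _ hf he
    · exact hLL _ _ (a1 _ _) he hf
    · exact hLQ _ _ he hf
    · exact hLL _ _ (a1 _ _) he hf

end Build

section Count
variable {V : Type*} {G : SimpleGraph V}

lemma dem_card (t : ℕ) : 2 * Fintype.card (Dem t) ≤ t ^ 2 := by
  have h1 : Fintype.card (Dem t ⊕ Dem t) ≤ Fintype.card (Fin t × Fin t) := by
    apply Fintype.card_le_of_injective (fun x => Sum.elim (fun d : Dem t => d.1) (fun d : Dem t => d.1.swap) x)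
    rintro (⟨⟨a, b⟩, h⟩ | ⟨⟨a, b⟩, h⟩) (⟨⟨c, d⟩, h'⟩ | ⟨⟨c, d⟩, h'⟩) hh
    · simpa using hh
    · simp only [Sum.elim_inl, Sum.elim_inr, Prod.swap, Prod.mk.injEq] at hh h h'
      omega
    · simp only [Sum.elim_inl, Sum.elim_inr, Prod.swap, Prod.mk.injEq] at hh h h'
      omega
    · simp only [Sum.elim_inr, Prod.swap, Prod.mk.injEq] at hh
      simp [hh.1, hh.2]
  rw [Fintype.card_sum, Fintype.card_prod, Fintype.card_fin] at h1
  nlinarith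

lemma hEnd_count {t : ℕ} (i : Fin t) :
    (Finset.univ.filter (fun h : Dem t × Bool => hEnd h = i)).card ≤ t := by
  have h4 : (Finset.univ : Finset (Fin t)).card = t := by simp
  conv_rhs => rw [← h4]
  apply Finset.card_le_card_of_injOn (fun h => cond h.2 h.1.1.2 h.1.1.1)
  · intro x _; simp
  · rintro ⟨⟨⟨a, b⟩, h⟩, x⟩ hx ⟨⟨⟨c, d⟩, h'⟩, y⟩ hy hxy
    replace hx := (Finset.mem_filter.1 hx).2
    replace hy := (Finset.mem_filter.1 hy).2
    simp only [hEnd] at hx hy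
    cases x <;> cases y <;> simp only [cond_true, cond_false] at hx hy hxy h h'
    · subst hx; subst hxy; subst hy; rfl
    · omega
    · omega
    · subst hx; subst hxy; subst hy; rfl

lemma qEnd_count {A : Type*} [DecidableEq A] {ψ : A → V} {t k : ℕ} (Q : Fin k → Tr G ψ)
    (ε : Dem t → Fin k) (hε : Function.Injective ε) (a : A) :
    (Finset.univ.filter (fun h : Dem t × Bool => qEnd Q ε h = a)).card ≤ ∑ i, (Q i).load a := by
  classical
  rw [Finset.card_filter, Fintype.sum_prod_type]
  have : ∀ d : Dem t, ∑ y : Bool, (if qEnd Q ε (d, y) = a then 1 else 0) = (Q (ε d)).load a := by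
    intro d
    rw [Fintype.sum_bool]; rfl
  rw [Finset.sum_congr rfl (fun d _ => this d)]
  rw [← Finset.sum_image (s := Finset.univ) (g := ε) (f := fun i => (Q i).load a) (fun x _ y _ h => hε h)]
  exact Finset.sum_le_sum_of_subset (Finset.subset_univ _)

lemma load_total {A : Type*} [DecidableEq A] [Fintype A] {ψ : A → V} {k : ℕ} (Q : Fin k → Tr G ψ) :
    ∑ a, ∑ i, (Q i).load a = 2 * k := by
  rw [Finset.sum_comm]
  have : ∀ i, ∑ a, (Q i).load a = 2 := by
    intro i
    simp [Tr.load, Finset.sum_add_distrib]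
  simp [this, mul_comm]

lemma sat_card {A : Type*} [DecidableEq A] [Fintype A] {ψ : A → V} {k : ℕ} (D : ℕ) (Q : Fin k → Tr G ψ) :
    (Finset.univ.filter (fun a => ¬ ∑ i, (Q i).load a < D)).card * D ≤ 2 * k := by
  rw [← load_total Q, ← smul_eq_mul]
  refine le_trans ?_ (Finset.sum_le_sum_of_subset (Finset.subset_univ (Finset.univ.filter (fun a => ¬ ∑ i, (Q i).load a < D))))
  refine Finset.card_nsmul_le_sum _ _ _ ?_
  intro a ha
  simpa using ha

lemma hit_sum {A : Type*} [Fintype A] {n : ℕ} (idx : A → Fin n) (hidx : Function.Injective idx)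
    (F : Finset (Sym2 (Fin n))) :
    ∑ p : Fin n, (Finset.univ.filter (fun x : A => s(idx x, p) ∈ F)).card ≤ 2 * F.card := by
  classical
  have h1 : ∑ p : Fin n, (Finset.univ.filter (fun x : A => s(idx x, p) ∈ F)).card =
      (Finset.univ.filter (fun y : Fin n × A => s(idx y.2, y.1) ∈ F)).card := by
    simp only [Finset.card_filter]
    rw [Fintype.sum_prod_type]
  rw [h1]
  have : (F ×ˢ (Finset.univ : Finset Bool)).card = 2 * F.card := by
    rw [Finset.card_product]; simp [mul_comm]
  rw [← this]
  apply Finset.card_le_card_of_injOn (fun p => (s(idx p.2, p.1), decide (idx p.2 < p.1)))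
  · intro p hp
    exact Finset.mem_product.2 ⟨(Finset.mem_filter.1 hp).2, Finset.mem_univ _⟩
  · rintro ⟨p, x⟩ - ⟨q, y⟩ - hxy
    simp only [Prod.mk.injEq, decide_eq_decide, Sym2.eq_iff] at hxy
    obtain ⟨⟨h1, h2⟩ | ⟨h1, h2⟩, h3⟩ := hxy
    · rw [hidx h1, h2]
    · have : idx x = idx y ∧ p = q := by
        rw [h1, h2] at h3 ⊢
        omega
      rw [hidx this.1, this.2]

lemma bad_card {A : Type*} [Fintype A] {n : ℕ} (idx : A → Fin n) (hidx : Function.Injective idx)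
    (F : Finset (Sym2 (Fin n))) (m : ℕ) :
    (Finset.univ.filter (fun p : Fin n => m ≤ (Finset.univ.filter (fun x : A => s(idx x, p) ∈ F)).card)).card * m
      ≤ 2 * F.card := by
  refine le_trans ?_ (hit_sum idx hidx F)
  rw [← smul_eq_mul]
  refine le_trans ?_ (Finset.sum_le_sum_of_subset (Finset.subset_univ
    (Finset.univ.filter (fun p : Fin n => m ≤ (Finset.univ.filter (fun x : A => s(idx x, p) ∈ F)).card))))
  refine Finset.card_nsmul_le_sum _ _ _ ?_
  intro a ha
  simpa using ha

lemma mod3_card (t c : ℕ) :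
    333 * t ≤ (Finset.univ.filter (fun x : Fin (1000 * t) => x.1 % 3 = c % 3)).card := by
  have h4 : (Finset.univ : Finset (Fin (333 * t))).card = 333 * t := by simp
  conv_lhs => rw [← h4]
  apply Finset.card_le_card_of_injOn (fun x => (⟨3 * x.1 + c % 3, by have := x.2; omega⟩ : Fin (1000 * t)))
  · intro x _
    simp only [Finset.coe_filter, Finset.mem_univ, true_and, Set.mem_ofPred_eq]
    omega
  · intro x _ y _ h
    simp only [Fin.mk.injEq] at h
    exact Fin.ext (by omega)

lemma dropped_card {A : Type*} [DecidableEq A] {ψ : A → V} {k D : ℕ} (Q : Fin k → Tr G ψ)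
    (hQ : ∀ a, ∑ i, (Q i).load a ≤ D) (B : Finset A) :
    (Finset.univ.filter (fun i => (Q i).p ∈ B ∨ (Q i).q ∈ B)).card ≤ B.card * D := by
  classical
  calc _ ≤ ∑ i, ∑ a ∈ B, (Q i).load a := by
        rw [Finset.card_filter]
        apply Finset.sum_le_sum
        intro i _
        split_ifs with h
        · rcases h with h | h
          · refine le_trans ?_ (Finset.single_le_sum (fun _ _ => Nat.zero_le _) h)
            simp [Tr.load]
          · refine le_trans ?_ (Finset.single_le_sum (fun _ _ => Nat.zero_le _) h)
            simp [Tr.load]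
        · exact Nat.zero_le _
    _ = ∑ a ∈ B, ∑ i, (Q i).load a := Finset.sum_comm
    _ ≤ ∑ a ∈ B, D := Finset.sum_le_sum (fun a _ => hQ a)
    _ = _ := by simp

end Count

section Final
variable {V : Type*} {G : SimpleGraph V}

lemma pack_odd (t : ℕ) (ht : 49 ≤ t) (I : Immersion G (⊤ : SimpleGraph (Fin (1400 * t))))
    (hEven : ∀ ⦃u v : Fin (1400 * t)⦄ (h : (⊤ : SimpleGraph (Fin (1400 * t))).Adj u v),
      Even (I.trail h).length)
    (hP : Pack G (fun p : Fin (1000 * t) × Fin t => I.φ (idxA p.1)) (t ^ 2)) :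
    HasTotallyOddImmersion G (⊤ : SimpleGraph (Fin t)) := by
  classical
  obtain ⟨Q, hQ, F, hF, hfree⟩ := minimal_pack I idxA (pack_goodP (ψ := fun a => I.φ (idxA a)) hP)
  -- bad indices
  set hd : Fin (1400 * t) → Finset (Fin (1000 * t)) := fun p =>
    Finset.univ.filter (fun x => s(idxA x, p) ∈ F) with hhd
  set bad : Finset (Fin (1400 * t)) := Finset.univ.filter (fun p => 100 * t ≤ (hd p).card) with hbad
  have hbc : bad.card * 25 ≤ t := by
    have h1 : bad.card * (100 * t) ≤ 2 * F.card := bad_card idxA idxA_inj F (100 * t)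
    have h2 : (bad.card * 25) * (4 * t) ≤ t * (4 * t) := by nlinarith
    exact Nat.le_of_mul_le_mul_right h2 (by omega)
  have hgood : ∀ p, p ∉ bad → (hd p).card < 100 * t := by
    intro p hp
    simpa [hbad] using hp
  -- saturated indices
  set sat : Finset (Fin (1000 * t)) := Finset.univ.filter (fun a => ¬ ∑ i, (Q i).load a < t) with hsat
  have hsc : sat.card ≤ 2 * t := by
    have h1 : sat.card * t ≤ 2 * t ^ 2 := sat_card t Q
    exact Nat.le_of_mul_le_mul_right (by nlinarith) (show 0 < t by omega)
  -- good trails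
  set badA : Finset (Fin (1000 * t)) := Finset.univ.filter (fun a => idxA a ∈ bad) with hbadA
  have hbAc : badA.card ≤ bad.card := by
    apply Finset.card_le_card_of_injOn idxA
    · intro a ha; exact (Finset.mem_filter.1 ha).2
    · intro x _ y _ h; exact idxA_inj h
  set drop : Finset (Fin (t ^ 2)) := Finset.univ.filter (fun i => (Q i).p ∈ badA ∨ (Q i).q ∈ badA) with hdrop
  have hdc : drop.card ≤ badA.card * t := dropped_card Q hQ.2.2 badA
  have hkeep : Fintype.card (Dem t) ≤ Fintype.card {i // i ∉ drop} := by
    have h1 := dem_card t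
    have h2 : Fintype.card {i // i ∉ drop} = t ^ 2 - drop.card := by
      rw [Fintype.card_subtype_compl, Fintype.card_fin, Fintype.card_coe]
    have h3 : drop.card * 25 ≤ t ^ 2 := by nlinarith
    omega
  obtain ⟨ε0⟩ := Function.Embedding.nonempty_of_card_le hkeep
  let ε : Dem t → Fin (t ^ 2) := fun d => (ε0 d).1
  have hε : Function.Injective ε := fun x y h => ε0.injective (Subtype.ext h)
  have hεg : ∀ h : Dem t × Bool, idxA (qEnd Q ε h) ∉ bad := by
    rintro ⟨d, y⟩ hb
    apply (ε0 d).2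
    refine Finset.mem_filter.2 ⟨Finset.mem_univ _, ?_⟩
    cases y
    · right; exact Finset.mem_filter.2 ⟨Finset.mem_univ _, hb⟩
    · left; exact Finset.mem_filter.2 ⟨Finset.mem_univ _, hb⟩
  -- branch vertices
  have hB : Fintype.card (Fin t) ≤ Fintype.card {p : Fin (1400 * t) // p.1 < 400 * t ∧ p ∉ bad} := by
    rw [Fintype.card_fin, Fintype.card_subtype]
    have h1 : 400 * t ≤ (Finset.univ.filter (fun p : Fin (1400 * t) => p.1 < 400 * t)).card := by
      have h4 : (Finset.univ : Finset (Fin (400 * t))).card = 400 * t := by simp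
      conv_lhs => rw [← h4]
      apply Finset.card_le_card_of_injOn (fun x => (⟨x.1, by have := x.2; omega⟩ : Fin (1400 * t)))
      · intro x _
        exact Finset.mem_filter.2 ⟨Finset.mem_univ _, x.2⟩
      · intro x _ y _ h
        simp only [Fin.mk.injEq] at h
        exact Fin.ext h
    have h2 : (Finset.univ.filter (fun p : Fin (1400 * t) => p.1 < 400 * t)) \ bad ⊆
        Finset.univ.filter (fun p : Fin (1400 * t) => p.1 < 400 * t ∧ p ∉ bad) := by
      intro p hp
      rw [Finset.mem_sdiff, Finset.mem_filter] at hp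
      exact Finset.mem_filter.2 ⟨Finset.mem_univ _, hp.1.2, hp.2⟩
    have h3 := Finset.card_le_card h2
    have h4 := Finset.le_card_sdiff bad (Finset.univ.filter (fun p : Fin (1400 * t) => p.1 < 400 * t))
    omega
  obtain ⟨b0⟩ := Function.Embedding.nonempty_of_card_le hB
  let b : Fin t ↪ Fin (1400 * t) := b0.trans (Function.Embedding.subtype _)
  have hb1 : ∀ i, (b i).1 < 400 * t := fun i => (b0 i).2.1
  have hb2 : ∀ i, b i ∉ bad := fun i => (b0 i).2.2
  -- the middle vertices
  let avail : Dem t × Bool → Finset (Fin (1000 * t)) := fun h =>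
    (((Finset.univ.filter (fun x : Fin (1000 * t) => x.1 % 3 = ((qEnd Q ε h).1 + 1) % 3)) \ sat) \
      hd (b (hEnd h))) \ hd (idxA (qEnd Q ε h))
  have hav : ∀ h, 2 * t < (avail h).card := by
    intro h
    have h1 := mod3_card t ((qEnd Q ε h).1 + 1)
    have h2 := Finset.le_card_sdiff sat (Finset.univ.filter (fun x : Fin (1000 * t) => x.1 % 3 = ((qEnd Q ε h).1 + 1) % 3))
    have h3 := Finset.le_card_sdiff (hd (b (hEnd h))) ((Finset.univ.filter (fun x : Fin (1000 * t) => x.1 % 3 = ((qEnd Q ε h).1 + 1) % 3)) \ sat)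
    have h4 := Finset.le_card_sdiff (hd (idxA (qEnd Q ε h))) (((Finset.univ.filter (fun x : Fin (1000 * t) => x.1 % 3 = ((qEnd Q ε h).1 + 1) % 3)) \ sat) \
      hd (b (hEnd h)))
    have h5 := hgood _ (hb2 (hEnd h))
    have h6 := hgood _ (hεg h)
    show 2 * t < ((((Finset.univ.filter (fun x : Fin (1000 * t) => x.1 % 3 = ((qEnd Q ε h).1 + 1) % 3)) \ sat) \
      hd (b (hEnd h))) \ hd (idxA (qEnd Q ε h))).card
    omega
  obtain ⟨f, hf1, hf2⟩ := greedy avail (fun h h' => hEnd h' = hEnd h ∨ qEnd Q ε h' = qEnd Q ε h)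
    (fun x y h => h.imp Eq.symm Eq.symm) (2 * t) (by
      intro h
      rw [Finset.filter_or]
      refine (Finset.card_union_le _ _).trans ?_
      have h1 := hEnd_count (hEnd h)
      have h2 := (qEnd_count Q ε hε (qEnd Q ε h)).trans (hQ.2.2 _)
      omega) hav
  have hf3 : ∀ h, (f h).1 % 3 = ((qEnd Q ε h).1 + 1) % 3 ∧ ∑ i, (Q i).load (f h) < t ∧
      s(idxA (f h), b (hEnd h)) ∉ F ∧ s(idxA (f h), idxA (qEnd Q ε h)) ∉ F := by
    intro h
    have h1 := hf1 h
    simp only [avail, Finset.mem_sdiff, Finset.mem_filter, Finset.mem_univ, true_and, hsat, hhd, not_not] at h1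
    exact ⟨h1.1.1.1, h1.1.1.2, h1.1.2, h1.2⟩
  have hne1 : ∀ (x : Fin (1000 * t)) i, idxA x ≠ b i := by
    intro x i h
    have h1 := hb1 i
    rw [← h] at h1
    simp only [idxA] at h1
    omega
  have hhalf : ∀ h : Dem t × Bool, ∃ L : G.Walk (I.φ (b (hEnd h))) (I.φ (idxA (qEnd Q ε h))),
      L.IsTrail ∧ Even L.length ∧ (∀ e ∈ L.edges, ¬ ∃ i, e ∈ (Q i).w.edges) ∧
      ∀ e ∈ L.edges, cls I e = some s(idxA (f h), b (hEnd h)) ∨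
        cls I e = some s(idxA (f h), idxA (qEnd Q ε h)) := by
    intro h
    obtain ⟨h1, h2, h3, h4⟩ := hf3 h
    have a1 : (⊤ : SimpleGraph (Fin (1400 * t))).Adj (idxA (f h)) (b (hEnd h)) := hne1 _ _
    have a2 : (⊤ : SimpleGraph (Fin (1400 * t))).Adj (idxA (f h)) (idxA (qEnd Q ε h)) := by
      intro hh
      have := idxA_inj hh
      rw [this] at h1
      omega
    refine half I hEven (fun e => ∃ i, e ∈ (Q i).w.edges) _ _ _ a1 a2 (hne1 _ _).symm ?_ ?_
    · rintro e he ⟨i, hi⟩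
      exact hfree _ h2 _ a1 h3 i he hi
    · rintro e he ⟨i, hi⟩
      exact hfree _ h2 _ a2 h4 i he hi
  choose L hL1 hL2 hL3 hL4 using hhalf
  refine assemble_routes b idxA Q hQ.1 hQ.2.1 ε hε L (fun h => ⟨hL1 h, hL2 h⟩)
    (fun h i e he hf => hL3 h e he ⟨i, hf⟩) ?_
  intro h h' hne e he he'
  have c1 := hL4 h e he
  have c2 := hL4 h' e he'
  have m1 := (hf3 h).1
  have m2 := (hf3 h').1
  have k1 := hf2 h h' hne
  rcases c1 with c1 | c1 <;> rcases c2 with c2 | c2 <;> rw [c1] at c2 <;>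
    simp only [Option.some.injEq, Sym2.eq_iff] at c2
  · rcases c2 with ⟨c2, c3⟩ | ⟨c2, c3⟩
    · exact k1 (Or.inl (b.injective c3).symm) (idxA_inj c2)
    · exact hne1 _ _ c2
  · rcases c2 with ⟨c2, c3⟩ | ⟨c2, c3⟩
    · exact hne1 _ _ c3.symm
    · exact hne1 _ _ c3.symm
  · rcases c2 with ⟨c2, c3⟩ | ⟨c2, c3⟩
    · exact hne1 _ _ c3
    · exact hne1 _ _ c2
  · rcases c2 with ⟨c2, c3⟩ | ⟨c2, c3⟩
    · exact k1 (Or.inr (idxA_inj c3).symm) (idxA_inj c2)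
    · have d2 := idxA_inj c2
      have d3 := idxA_inj c3
      rw [d2] at m1
      rw [← d3] at m2
      omega

end Final

/-- In a 2-edge-connected graph G with no totally odd K_t-immersion, given a
totally even K_{1400t}-immersion with branch vertex set S, there is a set X of at most
14000t² edges such that some connected component of G ∖ X induces a bipartite graph and
contains more than 700t vertices of S. -/
theorem immersion_gives_edge_cut {V : Type*} [Fintype V] (t : ℕ) (ht : 49 ≤ t)
    (G : SimpleGraph V) (hconn : G.Connected) (hbridge : ∀ e, ¬ G.IsBridge e)
    (hno : ¬ HasTotallyOddImmersion G (⊤ : SimpleGraph (Fin t)))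
    (I : Immersion G (⊤ : SimpleGraph (Fin (1400 * t))))
    (hEven : ∀ ⦃u v : Fin (1400 * t)⦄ (h : (⊤ : SimpleGraph (Fin (1400 * t))).Adj u v),
      Even (I.trail h).length)
    (S : Set V) (hS : S = Set.range I.φ) :
    ∃ X ⊆ G.edgeSet, X.ncard ≤ 14000 * t ^ 2 ∧
      ∃ C : (G.deleteEdges X).ConnectedComponent,
        ((G.deleteEdges X).induce C.supp).Colorable 2 ∧ 700 * t < (S ∩ C.supp).ncard := by
  subst hS
  have hk : 2 * t ^ 2 ≤ Fintype.card (Fin (1000 * t) × Fin t) := by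
    rw [Fintype.card_prod, Fintype.card_fin, Fintype.card_fin]
    nlinarith
  rcases EP (G := G) (fun p : Fin (1000 * t) × Fin t => I.φ (idxA p.1)) hconn hbridge (t ^ 2) hk with hP | hC
  · exact absurd (pack_odd t ht I hEven hP) hno
  · exact cut_finish t ht I hC
end

section
/- Let t ≥ 1 be an integer and let G be a finite simple graph that does not admit a totally odd immersion of K_t. Let F ⊆ E(G) be a set of edges such that the subgraph of G with edge set F is bipartite. Then either (1) there exists a set of edges F' ⊆ E(G) such that the subgraph of G with edge set F' is bipartite and |F'| > |F|, or (2) the graph obtained from G by deleting the edges in F does not admit an immersion of K_{98000·t + 4410071}. -/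
open SimpleGraph

namespace OddImm

open scoped Classical in
/-- Number of edges of `F` leaving `X`. -/
noncomputable def cut {V : Type*} [Fintype V] (F : SimpleGraph V) (X : Finset V) : ℤ :=
  ∑ x ∈ X, ∑ y ∈ Xᶜ, if F.Adj x y then 1 else 0

/-- A unit-capacity integral flow on `F`. -/
structure IsFlow {V : Type*} (F : SimpleGraph V) (f : V → V → ℤ) : Prop where
  anti : ∀ x y, f x y = - f y x
  le_one : ∀ x y, f x y ≤ 1
  supp : ∀ x y, f x y ≠ 0 → F.Adj x y

open scoped Classical in
/-- The flow of a walk. -/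
noncomputable def wf {V : Type*} {F : SimpleGraph V} : {u v : V} → F.Walk u v → V → V → ℤ
  | _, _, .nil => fun _ _ => 0
  | _, _, .cons (u := u) (v := w) _ p => fun x y =>
      wf p x y + (if x = u ∧ y = w then 1 else 0) - (if x = w ∧ y = u then 1 else 0)

section
variable {V : Type*} {F : SimpleGraph V}

lemma wf_anti {u v : V} (p : F.Walk u v) (x y : V) : wf p x y = - wf p y x := by
  induction p with
  | nil => simp [wf]
  | cons h p ih =>
    simp only [wf]
    rw [ih]
    grind

lemma wf_zero {u v : V} (p : F.Walk u v) (x y : V) (hxy : s(x, y) ∉ p.edges) : wf p x y = 0 := by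
  induction p with
  | nil => simp [wf]
  | cons h p ih =>
    simp only [Walk.edges_cons, List.mem_cons, not_or] at hxy
    simp only [wf]
    rw [ih hxy.2, if_neg, if_neg]
    · simp
    · rintro ⟨rfl, rfl⟩; exact hxy.1 Sym2.eq_swap
    · rintro ⟨rfl, rfl⟩; exact hxy.1 rfl

lemma wf_dart {u v : V} (p : F.Walk u v) (hp : p.IsTrail) (d : F.Dart) (hd : d ∈ p.darts) :
    wf p d.fst d.snd = 1 := by
  induction p with
  | nil => simp at hd
  | cons h p ih =>
    rw [Walk.isTrail_cons] at hp
    simp only [Walk.darts_cons, List.mem_cons] at hd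
    simp only [wf]
    rcases hd with rfl | hd
    · rw [wf_zero _ _ _ hp.2]
      have := h.ne
      simp [this]
    · rw [ih hp.1 hd]
      have hm : s(d.fst, d.snd) ∈ p.edges := by
        have := List.mem_map_of_mem (f := Dart.edge) hd
        exact this
      rw [if_neg, if_neg]
      · simp
      · rintro ⟨h1, h2⟩; rw [h1, h2, Sym2.eq_swap] at hm; exact hp.2 hm
      · rintro ⟨h1, h2⟩; rw [h1, h2] at hm; exact hp.2 hm

lemma mem_edges_cases {u v : V} (p : F.Walk u v) {x y : V} (h : s(x, y) ∈ p.edges) :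
    (∃ d ∈ p.darts, d.fst = x ∧ d.snd = y) ∨ (∃ d ∈ p.darts, d.fst = y ∧ d.snd = x) := by
  unfold Walk.edges at h
  rw [List.mem_map] at h
  obtain ⟨d, hd, he⟩ := h
  have he' : s(d.fst, d.snd) = s(x, y) := he
  rw [Sym2.eq_iff] at he'
  rcases he' with h | h
  · exact Or.inl ⟨d, hd, h⟩
  · exact Or.inr ⟨d, hd, h⟩

variable [Fintype V]
set_option linter.unusedSectionVars false

open scoped Classical in
lemma wf_net {u v : V} (p : F.Walk u v) (x : V) :
    ∑ y, wf p x y = (if x = u then 1 else 0) - (if x = v then 1 else 0) := by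
  induction p with
  | nil => simp [wf]
  | @cons a b c h p ih =>
    have hs : ∀ r s : V, ∑ y, (if x = r ∧ y = s then (1 : ℤ) else 0) = if x = r then 1 else 0 := by
      intro r s
      by_cases hr : x = r <;> simp [hr]
    simp only [wf, Finset.sum_sub_distrib, Finset.sum_add_distrib, ih, hs]
    ring

lemma IsFlow.add {f : V → V → ℤ} (hf : IsFlow F f) {u v : V} (p : F.Walk u v) (hp : p.IsTrail)
    (hd : ∀ d ∈ p.darts, f d.fst d.snd ≤ 0) : IsFlow F (fun x y => f x y + wf p x y) := by
  refine ⟨fun x y => ?_, fun x y => ?_, fun x y hne => ?_⟩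
  · rw [hf.anti, wf_anti]; ring
  · by_cases h : s(x, y) ∈ p.edges
    · rcases mem_edges_cases p h with ⟨d, hd', rfl, rfl⟩ | ⟨d, hd', rfl, rfl⟩
      · rw [wf_dart p hp d hd']; linarith [hd d hd']
      · rw [wf_anti, wf_dart p hp d hd']; linarith [hf.le_one d.snd d.fst]
    · rw [wf_zero p x y h]; simpa using hf.le_one x y
  · by_cases h : s(x, y) ∈ p.edges
    · exact p.adj_of_mem_edges h
    · rw [wf_zero p x y h] at hne
      exact hf.supp x y (by simpa using hne)

lemma IsFlow.sub {f : V → V → ℤ} (hf : IsFlow F f) {u v : V} (p : F.Walk u v) (hp : p.IsTrail)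
    (hd : ∀ d ∈ p.darts, 0 < f d.fst d.snd) :
    IsFlow F (fun x y => f x y - wf p x y) ∧
      (∀ x y, s(x, y) ∈ p.edges → f x y - wf p x y = 0 ∧ f x y ≠ 0) := by
  have key : ∀ x y, s(x, y) ∈ p.edges → f x y - wf p x y = 0 ∧ f x y ≠ 0 := by
    intro x y h
    rcases mem_edges_cases p h with ⟨d, hd', rfl, rfl⟩ | ⟨d, hd', rfl, rfl⟩
    · have := hf.le_one d.fst d.snd
      have := hd d hd'
      rw [wf_dart p hp d hd']; omega
    · have := hf.le_one d.fst d.snd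
      have := hd d hd'
      have := hf.anti d.snd d.fst
      rw [wf_anti, wf_dart p hp d hd']; omega
  refine ⟨⟨fun x y => ?_, fun x y => ?_, fun x y hne => ?_⟩, key⟩
  · rw [hf.anti, wf_anti]; ring
  · by_cases h : s(x, y) ∈ p.edges
    · rw [(key x y h).1]; norm_num
    · rw [wf_zero p x y h]; simpa using hf.le_one x y
  · by_cases h : s(x, y) ∈ p.edges
    · exact absurd (key x y h).1 hne
    · rw [wf_zero p x y h] at hne
      exact hf.supp x y (by simpa using hne)

open scoped Classical in
lemma IsFlow.sum_net {f : V → V → ℤ} (hf : IsFlow F f) (X : Finset V) :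
    ∑ x ∈ X, ∑ y, f x y = ∑ x ∈ X, ∑ y ∈ Xᶜ, f x y := by
  have h0 : ∑ x ∈ X, ∑ y ∈ X, f x y = 0 := by
    have h1 : ∑ x ∈ X, ∑ y ∈ X, f x y = - ∑ x ∈ X, ∑ y ∈ X, f x y := by
      conv_lhs => rw [Finset.sum_comm]
      rw [← Finset.sum_neg_distrib]
      refine Finset.sum_congr rfl fun x _ => ?_
      rw [← Finset.sum_neg_distrib]
      exact Finset.sum_congr rfl fun y _ => hf.anti y x
    linarith
  have : ∀ x, ∑ y, f x y = ∑ y ∈ X, f x y + ∑ y ∈ Xᶜ, f x y := fun x =>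
    (Finset.sum_add_sum_compl X _).symm
  simp only [this, Finset.sum_add_distrib, h0, zero_add]

open scoped Classical in
lemma exists_flow (b : V → ℤ) (hb : ∑ v, b v = 0) (hcut : ∀ X : Finset V, ∑ v ∈ X, b v ≤ cut F X) :
    ∃ f, IsFlow F f ∧ ∀ v, ∑ y, f v y = b v := by
  let Φ : (V → V → ℤ) → ℕ := fun f => ∑ v, (b v - ∑ y, f v y).natAbs
  have hex : ∃ n, ∃ f, IsFlow F f ∧ Φ f = n :=
    ⟨_, fun _ _ => 0, ⟨by simp, by simp, by simp⟩, rfl⟩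
  obtain ⟨f, hf, hΦ⟩ := Nat.find_spec hex
  have hmin : ∀ g, IsFlow F g → Φ f ≤ Φ g := fun g hg => by
    rw [hΦ]; exact Nat.find_min' hex ⟨g, hg, rfl⟩
  refine ⟨f, hf, ?_⟩
  have hle : ∀ v, b v ≤ ∑ y, f v y := by
    by_contra hcon
    push Not at hcon
    obtain ⟨u, hu⟩ := hcon
    let X : Finset V := Finset.univ.filter fun v =>
      ∃ p : F.Walk u v, ∀ d ∈ p.darts, f d.fst d.snd ≤ 0
    have huX : u ∈ X := by
      simp only [X, Finset.mem_filter, Finset.mem_univ, true_and]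
      exact ⟨.nil, by simp⟩
    have h1 : ∀ w ∈ X, ∑ y, f w y ≤ b w := by
      intro w hw
      by_contra hlt
      push Not at hlt
      simp only [X, Finset.mem_filter, Finset.mem_univ, true_and] at hw
      obtain ⟨p, hp⟩ := hw
      have hpath := p.bypass_isPath
      have hp' : ∀ d ∈ p.bypass.darts, f d.fst d.snd ≤ 0 := fun d hd =>
        hp d (p.darts_bypass_subset_darts hd)
      have hg := hf.add p.bypass hpath.isTrail hp'
      have := hmin _ hg
      have huw : u ≠ w := by rintro rfl; omega
      refine absurd this (not_le.mpr ?_)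
      refine Finset.sum_lt_sum (fun x _ => ?_) ⟨u, Finset.mem_univ _, ?_⟩
      · rw [Finset.sum_add_distrib, wf_net]
        by_cases hxu : x = u
        · subst hxu; simp [huw]; omega
        · by_cases hxw : x = w
          · subst hxw; simp [hxu]; omega
          · simp [hxu, hxw]
      · rw [Finset.sum_add_distrib, wf_net]
        simp [huw]; omega
    have h2 : ∑ x ∈ X, ∑ y, f x y < ∑ x ∈ X, b x :=
      Finset.sum_lt_sum h1 ⟨u, huX, hu⟩
    have h3 : cut F X ≤ ∑ x ∈ X, ∑ y, f x y := by
      rw [hf.sum_net]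
      refine Finset.sum_le_sum fun x hx => Finset.sum_le_sum fun y hy => ?_
      rw [Finset.mem_compl] at hy
      simp only [X, Finset.mem_filter, Finset.mem_univ, true_and] at hx hy
      obtain ⟨p, hp⟩ := hx
      split_ifs with hadj
      · by_contra hlt
        refine hy ⟨p.concat hadj, ?_⟩
        intro d hd
        rw [Walk.darts_concat] at hd
        simp only [List.concat_eq_append, List.mem_append, List.mem_singleton] at hd
        rcases hd with hd | rfl
        · exact hp d hd
        · simp only; omega
      · by_contra hlt
        have := hf.supp y x (by have := hf.anti y x; omega)
        exact hadj this.symm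
    linarith [hcut X]
  have hs : ∑ v, ∑ y, f v y = 0 := by
    rw [hf.sum_net]; simp
  have := (Finset.sum_eq_sum_iff_of_le (fun v _ => hle v)).1 (by rw [hb, hs] : ∑ v, b v = ∑ v, ∑ y, f v y)
  intro v
  exact (this v (Finset.mem_univ _)).symm

open scoped Classical in
lemma decompose {ι : Type*} (u : ι → V) (S : Finset ι) :
    ∀ (f : V → V → ℤ) (c : V → ℕ), IsFlow F f →
      (∀ v, ∑ y, f v y = ((S.filter fun k => u k = v).card : ℤ) - c v) →
      ∃ (τ : ι → V) (E : ι → Set (Sym2 V)),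
        (∀ k ∈ S, ∃ p : F.Walk (u k) (τ k), p.IsTrail ∧ ∀ e ∈ p.edges, e ∈ E k) ∧
        (∀ k ∈ S, ∀ x y, s(x, y) ∈ E k → f x y ≠ 0) ∧
        (∀ k ∈ S, ∀ l ∈ S, k ≠ l → Disjoint (E k) (E l)) ∧
        (∀ z, (S.filter fun k => τ k = z).card ≤ c z) := by
  induction S using Finset.induction_on with
  | empty =>
    intro f c hf hn
    exact ⟨u, fun _ => ∅, by simp, by simp, by simp, by simp⟩
  | insert k S hk ih =>
    intro f c hf hn
    let X : Finset V := Finset.univ.filter fun v =>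
      ∃ p : F.Walk (u k) v, ∀ d ∈ p.darts, 0 < f d.fst d.snd
    have huX : u k ∈ X := by
      simp only [X, Finset.mem_filter, Finset.mem_univ, true_and]
      exact ⟨.nil, by simp⟩
    have h3 : ∑ x ∈ X, ∑ y, f x y ≤ 0 := by
      rw [hf.sum_net]
      refine Finset.sum_nonpos fun x hx => Finset.sum_nonpos fun y hy => ?_
      rw [Finset.mem_compl] at hy
      simp only [X, Finset.mem_filter, Finset.mem_univ, true_and] at hx hy
      obtain ⟨p, hp⟩ := hx
      by_contra hlt
      have hadj := hf.supp x y (by omega)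
      refine hy ⟨p.concat hadj, ?_⟩
      intro d hd
      rw [Walk.darts_concat] at hd
      simp only [List.concat_eq_append, List.mem_append, List.mem_singleton] at hd
      rcases hd with hd | rfl
      · exact hp d hd
      · simp only; omega
    have hv : ∃ v ∈ X, 0 < c v := by
      by_contra hcon
      push Not at hcon
      have : 0 < ∑ x ∈ X, ∑ y, f x y := by
        refine Finset.sum_pos' (fun x hx => ?_) ⟨u k, huX, ?_⟩
        · rw [hn, Nat.le_zero.1 (hcon x hx)]; simp
        · rw [hn, Nat.le_zero.1 (hcon _ huX)]
          have : 0 < ((insert k S).filter fun l => u l = u k).card :=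
            Finset.card_pos.2 ⟨k, by simp⟩
          push_cast; omega
      linarith
    obtain ⟨v, hvX, hcv⟩ := hv
    simp only [X, Finset.mem_filter, Finset.mem_univ, true_and] at hvX
    obtain ⟨p, hp⟩ := hvX
    have htr := p.bypass_isPath.isTrail
    obtain ⟨hg, hz⟩ := hf.sub p.bypass htr (fun d hd => hp d (p.darts_bypass_subset_darts hd))
    obtain ⟨τ, E, h1, h2, h3, h4⟩ := ih _ (fun z => if z = v then c z - 1 else c z) hg (by
      intro x
      rw [Finset.sum_sub_distrib, wf_net, hn]
      rw [Finset.filter_insert]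
      have hnot : k ∉ S.filter fun l => u l = x := by simp [hk]
      by_cases hx : u k = x
      · rw [if_pos hx, Finset.card_insert_of_notMem hnot]
        by_cases hxv : x = v
        · subst hxv; simp [hx]; omega
        · simp [hx, hxv]; ring
      · rw [if_neg hx]
        have hx' : x ≠ u k := fun h => hx h.symm
        by_cases hxv : x = v
        · subst hxv; simp [hx']; omega
        · simp [hx', hxv])
    have hne : ∀ l ∈ S, l ≠ k := fun l hl h => hk (h ▸ hl)
    refine ⟨Function.update τ k v, Function.update E k {e | e ∈ p.bypass.edges}, ?_, ?_, ?_, ?_⟩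
    · intro l hl
      rw [Finset.mem_insert] at hl
      rcases hl with rfl | hl
      · rw [Function.update_self, Function.update_self]
        exact ⟨p.bypass, htr, fun e he => he⟩
      · rw [Function.update_of_ne (hne l hl), Function.update_of_ne (hne l hl)]
        exact h1 l hl
    · intro l hl x y hxy
      rw [Finset.mem_insert] at hl
      rcases hl with rfl | hl
      · rw [Function.update_self] at hxy
        exact (hz x y hxy).2
      · rw [Function.update_of_ne (hne l hl)] at hxy
        have := h2 l hl x y hxy
        by_cases hm : s(x, y) ∈ p.bypass.edges
        · exact absurd (hz x y hm).1 this
        · rw [wf_zero _ _ _ hm] at this; simpa using this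
    · have hdis : ∀ l ∈ S, Disjoint {e | e ∈ p.bypass.edges} (E l) := by
        intro l hl
        rw [Set.disjoint_left]
        intro e
        induction e with
        | h x y =>
          intro he he'
          exact h2 l hl x y he' (hz x y he).1
      intro l hl m hm hlm
      rw [Finset.mem_insert] at hl hm
      rcases hl with rfl | hl <;> rcases hm with rfl | hm
      · exact absurd rfl hlm
      · rw [Function.update_self, Function.update_of_ne (hne m hm)]
        exact hdis m hm
      · rw [Function.update_self, Function.update_of_ne (hne l hl)]
        exact (hdis l hl).symm
      · rw [Function.update_of_ne (hne m hm), Function.update_of_ne (hne l hl)]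
        exact h3 l hl m hm hlm
    · intro z
      have hS : (S.filter fun l => Function.update τ k v l = z) = S.filter fun l => τ l = z :=
        Finset.filter_congr fun l hl => by rw [Function.update_of_ne (hne l hl)]
      rw [Finset.filter_insert, Function.update_self, hS]
      have h4z := h4 z
      have hnot : k ∉ S.filter fun l => τ l = z := by simp [hk]
      by_cases hvz : v = z
      · subst hvz
        simp only [if_true] at h4z ⊢
        rw [Finset.card_insert_of_notMem hnot]; omega
      · rw [if_neg hvz]
        rw [if_neg (fun h => hvz h.symm)] at h4z
        exact h4z

open scoped Classical in
lemma transfer {ι : Type*} (M : SimpleGraph V) (hMF : ∀ X, cut M X ≤ cut F X)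
    (u v : ι → V) (q : ∀ k, M.Walk (u k) (v k)) (S : Finset ι)
    (hq : ∀ k ∈ S, ∀ l ∈ S, k ≠ l → List.Disjoint (q k).edges (q l).edges) :
    ∃ (τ : ι → V) (E : ι → Set (Sym2 V)),
        (∀ k ∈ S, ∃ p : F.Walk (u k) (τ k), p.IsTrail ∧ ∀ e ∈ p.edges, e ∈ E k) ∧
        (∀ k ∈ S, E k ⊆ F.edgeSet) ∧
        (∀ k ∈ S, ∀ l ∈ S, k ≠ l → Disjoint (E k) (E l)) ∧
        (∀ z, (S.filter fun k => τ k = z).card ≤ (S.filter fun k => v k = z).card) := by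
  obtain ⟨f, hf, hn⟩ := exists_flow (F := F)
    (fun x => ((S.filter fun k => u k = x).card : ℤ) - (S.filter fun k => v k = x).card)
    (by
      rw [Finset.sum_sub_distrib]
      rw [← Nat.cast_sum, ← Nat.cast_sum,
        ← Finset.card_eq_sum_card_fiberwise (f := u) (fun _ _ => Finset.mem_coe.2 (Finset.mem_univ _)),
        ← Finset.card_eq_sum_card_fiberwise (f := v) (fun _ _ => Finset.mem_coe.2 (Finset.mem_univ _))]
      simp)
    (by
      intro X
      refine le_trans ?_ (hMF X)
      have hcount : ∀ w : ι → V, ∑ x ∈ X, ((S.filter fun k => w k = x).card : ℤ) =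
          (S.filter fun k => w k ∈ X).card := by
        intro w
        rw [← Nat.cast_sum]
        congr 1
        rw [Finset.card_eq_sum_card_fiberwise (s := S.filter fun k => w k ∈ X) (f := w) (t := X)
          (by intro k hk; simp at hk; exact hk.2)]
        refine Finset.sum_congr rfl fun x hx => ?_
        congr 1
        ext k
        simp only [Finset.mem_filter]
        constructor
        · rintro ⟨h1, rfl⟩; exact ⟨⟨h1, hx⟩, rfl⟩
        · rintro ⟨⟨h1, _⟩, h2⟩; exact ⟨h1, h2⟩
      rw [Finset.sum_sub_distrib, hcount u, hcount v]
      set L := S.filter fun k => u k ∈ X ∧ v k ∉ X with hL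
      have h1 : (S.filter fun k => u k ∈ X).card ≤ L.card + (S.filter fun k => v k ∈ X).card := by
        refine le_trans (Finset.card_le_card ?_) (Finset.card_union_le _ _)
        intro k hk
        simp only [hL, Finset.mem_union, Finset.mem_filter] at hk ⊢
        tauto
      have hd : ∀ k, ∃ d : V × V, k ∈ L → s(d.1, d.2) ∈ (q k).edges ∧ d.1 ∈ X ∧ d.2 ∉ X ∧
          M.Adj d.1 d.2 := by
        intro k
        by_cases hk : k ∉ L
        · exact ⟨(u k, u k), fun h => absurd h hk⟩
        rw [not_not] at hk
        simp only [hL, Finset.mem_filter] at hk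
        obtain ⟨d, hd, h1, h2⟩ := (q k).exists_boundary_dart (X : Set V) hk.2.1 hk.2.2
        exact ⟨(d.fst, d.snd), fun _ => ⟨List.mem_map_of_mem (f := Dart.edge) hd, h1, h2, d.adj⟩⟩
      choose d hd using hd
      have h2 : L.card ≤ ((X ×ˢ Xᶜ).filter fun e => M.Adj e.1 e.2).card := by
        refine Finset.card_le_card_of_injOn d (fun k hk => ?_) (fun k hk l hl hkl => ?_)
        · have := hd k hk
          simp [this]
        · by_contra hne
          have hk' := (Finset.mem_filter.1 hk).1
          have hl' := (Finset.mem_filter.1 hl).1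
          refine hq k hk' l hl' hne (hd k hk).1 ?_
          rw [hkl]; exact (hd l hl).1
      have h3 : cut M X = ((X ×ˢ Xᶜ).filter fun e => M.Adj e.1 e.2).card := by
        unfold cut
        rw [← Finset.sum_product', Finset.card_filter]
        push_cast
        rfl
      rw [h3]
      omega)
  obtain ⟨τ, E, h1, h2, h3, h4⟩ := decompose u S f _ hf hn
  refine ⟨τ, E, h1, fun k hk e => ?_, h3, h4⟩
  induction e with
  | h x y => exact fun he => hf.supp x y (h2 k hk x y he)

end
end OddImm

namespace OddImm

open scoped Classical in
lemma greedy {t : ℕ} {η Λ : Type*} [Fintype Λ] [Nonempty Λ] (src tgt : Λ → η) (Δ : ℕ)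
    (hout : ∀ h, (Finset.univ.filter fun l => src l = h).card ≤ Δ)
    (hin : ∀ h, (Finset.univ.filter fun l => tgt l = h).card ≤ Δ)
    (good : Fin t → Fin t → Λ → Prop)
    (hgood : ∀ i j, i < j → t ^ 2 + 4 * t * Δ < (Finset.univ.filter fun l => good i j l).card)
    (S : Finset (Fin t × Fin t)) (hS : ∀ p ∈ S, p.1 < p.2) :
    ∃ r : Fin t × Fin t → Λ, (∀ p ∈ S, good p.1 p.2 (r p)) ∧
      ∀ p ∈ S, ∀ q ∈ S, p ≠ q → r p ≠ r q ∧ (p.1 = q.1 → src (r p) ≠ src (r q)) ∧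
        (p.1 = q.2 → src (r p) ≠ tgt (r q)) ∧ (p.2 = q.1 → tgt (r p) ≠ src (r q)) ∧
        (p.2 = q.2 → tgt (r p) ≠ tgt (r q)) := by
  induction S using Finset.induction_on with
  | empty => exact ⟨fun _ => Classical.arbitrary _, by simp, by simp⟩
  | insert p S hp ih =>
    obtain ⟨r, hr1, hr2⟩ := ih (fun q hq => hS q (Finset.mem_insert_of_mem hq))
    have hplt := hS p (Finset.mem_insert_self _ _)
    -- hubs blocked for a vertex
    let bad : Fin t → Finset η := fun i =>
      (S.filter fun q => q.1 = i).image (fun q => src (r q)) ∪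
        (S.filter fun q => q.2 = i).image (fun q => tgt (r q))
    have hbad : ∀ i, (bad i).card ≤ 2 * t := by
      intro i
      have h1 : (S.filter fun q => q.1 = i).card ≤ t := by
        have := Finset.card_le_card_of_injOn (s := S.filter fun q => q.1 = i)
          (t := (Finset.univ : Finset (Fin t))) (fun q => q.2) (fun q _ => by simp)
          (fun q hq q' hq' h => by
            simp only [Finset.coe_filter, Set.mem_ofPred_eq] at hq hq'
            exact Prod.ext (hq.2.trans hq'.2.symm) h)
        simpa using this
      have h2 : (S.filter fun q => q.2 = i).card ≤ t := by
        have := Finset.card_le_card_of_injOn (s := S.filter fun q => q.2 = i)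
          (t := (Finset.univ : Finset (Fin t))) (fun q => q.1) (fun q _ => by simp)
          (fun q hq q' hq' h => by
            simp only [Finset.coe_filter, Set.mem_ofPred_eq] at hq hq'
            exact Prod.ext h (hq.2.trans hq'.2.symm))
        simpa using this
      have h3 := Finset.card_union_le ((S.filter fun q => q.1 = i).image (fun q => src (r q)))
        ((S.filter fun q => q.2 = i).image (fun q => tgt (r q)))
      have h4 := Finset.card_image_le (s := S.filter fun q => q.1 = i) (f := fun q => src (r q))
      have h5 := Finset.card_image_le (s := S.filter fun q => q.2 = i) (f := fun q => tgt (r q))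
      simp only [bad]
      omega
    have hblk : ∀ (f : Λ → η), (∀ h, (Finset.univ.filter fun l => f l = h).card ≤ Δ) → ∀ i,
        (Finset.univ.filter fun l => f l ∈ bad i).card ≤ 2 * t * Δ := by
      intro f hf i
      have : (Finset.univ.filter fun l => f l ∈ bad i) =
          (bad i).biUnion fun h => Finset.univ.filter fun l => f l = h := by
        ext l; simp
      rw [this]
      refine Finset.card_biUnion_le.trans ?_
      refine (Finset.sum_le_card_nsmul _ _ Δ (fun h _ => hf h)).trans ?_
      rw [smul_eq_mul]
      exact Nat.mul_le_mul_right _ (hbad i)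
    have hused : (S.image r).card ≤ t ^ 2 := by
      refine Finset.card_image_le.trans ((Finset.card_le_univ S).trans ?_)
      simp [sq]
    have hex : ∃ l, good p.1 p.2 l ∧ l ∉ S.image r ∧ src l ∉ bad p.1 ∧ tgt l ∉ bad p.2 := by
      by_contra hcon
      push Not at hcon
      have hsub : (Finset.univ.filter fun l => good p.1 p.2 l) ⊆
          S.image r ∪ ((Finset.univ.filter fun l => src l ∈ bad p.1) ∪
            (Finset.univ.filter fun l => tgt l ∈ bad p.2)) := by
        intro l hl
        simp only [Finset.mem_filter, Finset.mem_univ, true_and] at hl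
        by_cases h1 : l ∈ S.image r
        · exact Finset.mem_union_left _ h1
        · refine Finset.mem_union_right _ ?_
          by_cases h2 : src l ∈ bad p.1
          · exact Finset.mem_union_left _ (by simpa using h2)
          · exact Finset.mem_union_right _ (by simpa using hcon l hl h1 h2)
      have h1 := Finset.card_le_card hsub
      have h2 := Finset.card_union_le (S.image r) ((Finset.univ.filter fun l => src l ∈ bad p.1) ∪
            (Finset.univ.filter fun l => tgt l ∈ bad p.2))
      have h3 := Finset.card_union_le (Finset.univ.filter fun l => src l ∈ bad p.1)
            (Finset.univ.filter fun l => tgt l ∈ bad p.2)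
      have h4 := hblk src hout p.1
      have h5 := hblk tgt hin p.2
      have h6 := hgood p.1 p.2 hplt
      have h7 : 4 * t * Δ = 2 * t * Δ + 2 * t * Δ := by ring
      omega
    obtain ⟨l, hl1, hl2, hl3, hl4⟩ := hex
    have hne : ∀ q ∈ S, q ≠ p := fun q hq h => hp (h ▸ hq)
    have hnew : ∀ q ∈ S, l ≠ r q ∧ (p.1 = q.1 → src l ≠ src (r q)) ∧
        (p.1 = q.2 → src l ≠ tgt (r q)) ∧ (p.2 = q.1 → tgt l ≠ src (r q)) ∧
        (p.2 = q.2 → tgt l ≠ tgt (r q)) := by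
      intro q hq
      have hb1 : ∀ i, q.1 = i → src (r q) ∈ bad i := fun i hi =>
        Finset.mem_union_left _ (Finset.mem_image_of_mem (fun q => src (r q))
          (Finset.mem_filter.2 ⟨hq, hi⟩))
      have hb2 : ∀ i, q.2 = i → tgt (r q) ∈ bad i := fun i hi =>
        Finset.mem_union_right _ (Finset.mem_image_of_mem (fun q => tgt (r q))
          (Finset.mem_filter.2 ⟨hq, hi⟩))
      refine ⟨fun h => hl2 (h ▸ Finset.mem_image_of_mem r hq), fun h h' => hl3 ?_,
        fun h h' => hl3 ?_, fun h h' => hl4 ?_, fun h h' => hl4 ?_⟩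
      · rw [h']; exact hb1 _ h.symm
      · rw [h']; exact hb2 _ h.symm
      · rw [h']; exact hb1 _ h.symm
      · rw [h']; exact hb2 _ h.symm
    refine ⟨Function.update r p l, ?_, ?_⟩
    · intro q hq
      rw [Finset.mem_insert] at hq
      rcases hq with rfl | hq
      · rw [Function.update_self]; exact hl1
      · rw [Function.update_of_ne (hne q hq)]; exact hr1 q hq
    · intro q hq q' hq' hqq
      rw [Finset.mem_insert] at hq hq'
      rcases hq with rfl | hq <;> rcases hq' with rfl | hq'
      · exact absurd rfl hqq
      · rw [Function.update_self, Function.update_of_ne (hne _ hq')]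
        exact hnew _ hq'
      · rw [Function.update_self, Function.update_of_ne (hne _ hq)]
        obtain ⟨a1, a2, a3, a4, a5⟩ := hnew _ hq
        exact ⟨a1.symm, fun h => (a2 h.symm).symm, fun h => (a4 h.symm).symm,
          fun h => (a3 h.symm).symm, fun h => (a5 h.symm).symm⟩
      · rw [Function.update_of_ne (hne _ hq), Function.update_of_ne (hne _ hq')]
        exact hr2 q hq q' hq' hqq

/-- Building a totally odd immersion from odd walks for ordered pairs. -/
lemma build {V : Type*} {G : SimpleGraph V} {t : ℕ} (b : Fin t → V) (hb : Function.Injective b)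
    (R : ∀ i j : Fin t, i < j → G.Walk (b i) (b j))
    (hR : ∀ i j h, (R i j h).IsTrail) (hodd : ∀ i j h, Odd (R i j h).length)
    (hdis : ∀ i j h i' j' h', (i, j) ≠ (i', j') →
      List.Disjoint (R i j h).edges (R i' j' h').edges) :
    HasTotallyOddImmersion G (⊤ : SimpleGraph (Fin t)) := by
  let T : ∀ i j : Fin t, i ≠ j → G.Walk (b i) (b j) := fun i j hne =>
    if h : i < j then R i j h else (R j i (lt_of_le_of_ne (not_lt.1 h) hne.symm)).reverse
  have hT : ∀ i j hne, ∃ k l, ∃ h : k < l, s(i, j) = s(k, l) ∧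
      (T i j hne).edges ⊆ (R k l h).edges ∧ (T i j hne).IsTrail ∧
      (T i j hne).length = (R k l h).length := by
    intro i j hne
    by_cases h : i < j
    · refine ⟨i, j, h, rfl, ?_⟩
      simp [T, h, hR]
    · refine ⟨j, i, lt_of_le_of_ne (not_lt.1 h) hne.symm, Sym2.eq_swap, ?_⟩
      simp [T, h, hR]
  refine ⟨⟨⟨b, hb⟩, fun i j h => T i j h.ne, ?_, ?_, ?_⟩, ?_⟩
  · intro i j h
    obtain ⟨k, l, hk, h1, h2, h3, h4⟩ := hT i j h.ne
    exact h3
  · intro i j h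
    have hne := h.ne
    rcases lt_or_gt_of_ne hne with hlt | hlt
    · simp [T, hlt, not_lt.2 hlt.le]
    · simp [T, hlt, not_lt.2 hlt.le]
  · intro i j i' j' h h' hs
    obtain ⟨k, l, hk, h1, h2, h3, h4⟩ := hT i j h.ne
    obtain ⟨k', l', hk', h1', h2', h3', h4'⟩ := hT i' j' h'.ne
    have : (k, l) ≠ (k', l') := by
      rintro heq
      rw [Prod.mk.injEq] at heq
      apply hs
      rw [h1, h1', heq.1, heq.2]
    exact fun e he he' => hdis k l hk k' l' hk' this (h2 he) (h2' he')
  · intro i j h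
    obtain ⟨k, l, hk, h1, h2, h3, h4⟩ := hT i j h.ne
    show Odd (T i j h.ne).length
    rw [h4]; exact hodd k l hk

open scoped Classical in
lemma route {V : Type*} {G : SimpleGraph V} {t : ℕ} {η Λ : Type*} [Fintype Λ] [Nonempty Λ]
    (φ : η ↪ V) (W : ∀ x y, G.Walk (φ x) (φ y)) (hW : ∀ x y, (W x y).IsTrail)
    (hWd : ∀ x y x' y', s(x, y) ≠ s(x', y') → List.Disjoint (W x y).edges (W x' y').edges)
    (β : Fin t ↪ η) (src tgt : Λ → η) (hsrc : ∀ l i, src l ≠ β i) (htgt : ∀ l i, tgt l ≠ β i)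
    (L : ∀ l, G.Walk (φ (src l)) (φ (tgt l))) (hL : ∀ l, (L l).IsTrail)
    (hLd : ∀ l l', l ≠ l' → List.Disjoint (L l).edges (L l').edges)
    (hLW : ∀ l i h, h ∉ Set.range β → List.Disjoint (L l).edges (W (β i) h).edges)
    (Δ : ℕ)
    (hout : ∀ h, (Finset.univ.filter fun l => src l = h).card ≤ Δ)
    (hin : ∀ h, (Finset.univ.filter fun l => tgt l = h).card ≤ Δ)
    (hgood : ∀ i j : Fin t, i < j → t ^ 2 + 4 * t * Δ < (Finset.univ.filter fun l =>
      Odd ((W (β i) (src l)).length + (L l).length + (W (β j) (tgt l)).length)).card) :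
    HasTotallyOddImmersion G (⊤ : SimpleGraph (Fin t)) := by
  obtain ⟨r, hr1, hr2⟩ := greedy src tgt Δ hout hin (fun i j l =>
      Odd ((W (β i) (src l)).length + (L l).length + (W (β j) (tgt l)).length)) (by intro i j h; convert hgood i j h)
      (Finset.univ.filter fun p => p.1 < p.2) (by simp)
  simp only [Finset.mem_filter, Finset.mem_univ, true_and] at hr1 hr2
  have hWW : ∀ i h i' h', h ∉ Set.range β → h' ∉ Set.range β → (i ≠ i' ∨ h ≠ h') →
      List.Disjoint (W (β i) h).edges (W (β i') h').edges := by
    intro i h i' h' hh hh' hne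
    apply hWd
    intro heq
    rw [Sym2.eq_iff] at heq
    rcases heq with ⟨h1, h2⟩ | ⟨h1, h2⟩
    · rcases hne with h3 | h3
      · exact h3 (β.injective h1)
      · exact h3 h2
    · exact hh' ⟨i, h1⟩
  have hs : ∀ l, src l ∉ Set.range β := fun l ⟨i, hi⟩ => hsrc l i hi.symm
  have ht : ∀ l, tgt l ∉ Set.range β := fun l ⟨i, hi⟩ => htgt l i hi.symm
  refine build (fun i => φ (β i)) (fun i j h => β.injective (φ.injective h)) (fun i j _ => ((W (β i) (src (r (i, j)))).append (L (r (i, j)))).append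
    (W (β j) (tgt (r (i, j)))).reverse) ?_ ?_ ?_
  · intro i j h
    rw [Walk.isTrail_append, Walk.isTrail_append]
    refine ⟨⟨hW _ _, hL _, (hLW _ _ _ (hs _)).symm⟩, (hW _ _).reverse, ?_⟩
    intro e he he'
    simp only [Walk.edges_append, List.mem_append, Walk.edges_reverse, List.mem_reverse] at he he'
    rcases he with he | he
    · exact hWW i _ j _ (hs _) (ht _) (Or.inl h.ne) he he'
    · exact hLW _ _ _ (ht _) he he'
  · intro i j h
    have := hr1 (i, j) h
    simpa using this
  · intro i j h i' j' h' hne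
    obtain ⟨a1, a2, a3, a4, a5⟩ := hr2 (i, j) h (i', j') h' hne
    have key : ∀ (f g : η) (k k' : Fin t), (k = k' → f ≠ g) → k ≠ k' ∨ f ≠ g := by
      intro f g k k' hh; by_cases hk : k = k'
      · exact Or.inr (hh hk)
      · exact Or.inl hk
    intro e he he'
    simp only [Walk.edges_append, List.mem_append, Walk.edges_reverse, List.mem_reverse] at he he'
    rcases he with (he | he) | he <;> rcases he' with (he' | he') | he'
    · exact hWW _ _ _ _ (hs _) (hs _) (key _ _ _ _ a2) he he'
    · exact hLW _ _ _ (hs _) he' he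
    · exact hWW _ _ _ _ (hs _) (ht _) (key _ _ _ _ a3) he he'
    · exact hLW _ _ _ (hs _) he he'
    · exact hLd _ _ a1 he he'
    · exact hLW _ _ _ (ht _) he he'
    · exact hWW _ _ _ _ (ht _) (hs _) (key _ _ _ _ a4) he he'
    · exact hLW _ _ _ (ht _) he' he
    · exact hWW _ _ _ _ (ht _) (ht _) (key _ _ _ _ a5) he he'

end OddImm

namespace OddImm

/-- Bichromatic edges. -/
def bi {V : Type*} (G : SimpleGraph V) (c : V → Bool) : SimpleGraph V where
  Adj u v := G.Adj u v ∧ c u ≠ c v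
  symm := ⟨fun _ _ h => ⟨h.1.symm, h.2.symm⟩⟩
  loopless := ⟨fun _ h => h.1.ne rfl⟩

lemma bi_sub {V : Type*} (G : SimpleGraph V) (c : V → Bool) : (bi G c).edgeSet ⊆ G.edgeSet := by
  intro e
  induction e with
  | h x y => exact fun h => h.1

lemma bi_col {V : Type*} (G : SimpleGraph V) (c : V → Bool) :
    (SimpleGraph.fromEdgeSet (bi G c).edgeSet).Colorable 2 := by
  rw [SimpleGraph.fromEdgeSet_edgeSet]
  have C : (bi G c).Coloring Bool := Coloring.mk c (fun h => h.2)
  simpa using C.colorable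

open scoped Classical in
lemma two_card {V : Type*} [Fintype V] (H : SimpleGraph V) :
    (2 * H.edgeSet.ncard : ℤ) = ∑ u, ∑ v, if H.Adj u v then 1 else 0 := by
  have h := H.sum_degrees_eq_twice_card_edges
  have h2 : H.edgeSet.ncard = H.edgeFinset.card := by
    rw [Set.ncard_eq_toFinset_card']; rfl
  rw [h2]
  have h3 : ∀ u, (H.degree u : ℤ) = ∑ v, if H.Adj u v then 1 else 0 := by
    intro u
    rw [← H.card_neighborFinset_eq_degree, H.neighborFinset_eq_filter, Finset.card_filter]
    push_cast
    rfl
  simp only [← h3]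
  exact_mod_cast h.symm

open scoped Classical in
lemma cut_eq {V : Type*} [Fintype V] (H : SimpleGraph V) (X : Finset V) :
    cut H X = ∑ u, ∑ v, if u ∈ X ∧ v ∉ X ∧ H.Adj u v then 1 else 0 := by
  unfold cut
  rw [← Finset.sum_subset (Finset.subset_univ X)]
  · refine Finset.sum_congr rfl fun x hx => ?_
    rw [← Finset.sum_subset (Finset.subset_univ Xᶜ)]
    · refine Finset.sum_congr rfl fun y hy => ?_
      rw [Finset.mem_compl] at hy
      simp [hx, hy]
    · intro y _ hy
      rw [Finset.mem_compl, not_not] at hy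
      simp [hy]
  · intro x _ hx
    simp [hx]

open scoped Classical in
lemma cut_eq' {V : Type*} [Fintype V] (H : SimpleGraph V) (X : Finset V) :
    cut H X = ∑ u, ∑ v, if v ∈ X ∧ u ∉ X ∧ H.Adj u v then 1 else 0 := by
  rw [cut_eq, Finset.sum_comm]
  simp only [H.adj_comm]

open scoped Classical in
lemma maxcut {V : Type*} [Fintype V] (G : SimpleGraph V) (F : Set (Sym2 V)) (hF : F ⊆ G.edgeSet)
    (C : V → Bool) (hC : ∀ u v, (SimpleGraph.fromEdgeSet F).Adj u v → C u ≠ C v)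
    (hmax : ∀ F' ⊆ G.edgeSet, (SimpleGraph.fromEdgeSet F').Colorable 2 → F'.ncard ≤ F.ncard) :
    (∀ u v, (G.deleteEdges F).Adj u v → C u = C v) ∧
    ∀ X, cut (G.deleteEdges F) X ≤ cut (SimpleGraph.fromEdgeSet F) X := by
  have hsub : F ⊆ (bi G C).edgeSet := by
    intro e
    induction e with
    | h x y =>
      intro he
      have hadj : G.Adj x y := hF he
      refine ⟨hadj, hC _ _ ?_⟩
      exact (SimpleGraph.fromEdgeSet_adj F).2 ⟨he, hadj.ne⟩
  have hEq : F = (bi G C).edgeSet :=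
    Set.eq_of_subset_of_ncard_le hsub (hmax _ (bi_sub G C) (bi_col G C)) (Set.toFinite _)
  have hadjM : ∀ u v, (G.deleteEdges F).Adj u v ↔ G.Adj u v ∧ C u = C v := by
    intro u v
    rw [SimpleGraph.deleteEdges_adj, hEq]
    have : s(u, v) ∈ (bi G C).edgeSet ↔ G.Adj u v ∧ C u ≠ C v := Iff.rfl
    rw [this]
    tauto
  have hadjF : ∀ u v, (SimpleGraph.fromEdgeSet F).Adj u v ↔ G.Adj u v ∧ C u ≠ C v := by
    intro u v
    rw [hEq, SimpleGraph.fromEdgeSet_edgeSet]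
    exact Iff.rfl
  refine ⟨fun u v h => ((hadjM u v).1 h).2, fun X => ?_⟩
  let c' : V → Bool := fun v => if v ∈ X then !(C v) else C v
  have h1 := hmax _ (bi_sub G c') (bi_col G c')
  rw [hEq] at h1
  have h2 : (2 * (bi G c').edgeSet.ncard : ℤ) ≤ 2 * (bi G C).edgeSet.ncard := by
    exact_mod_cast Nat.mul_le_mul_left 2 h1
  rw [two_card, two_card] at h2
  have h3 : (∑ u, ∑ v, if (bi G c').Adj u v then (1 : ℤ) else 0) +
      (cut (SimpleGraph.fromEdgeSet F) X + cut (SimpleGraph.fromEdgeSet F) X) =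
      (∑ u, ∑ v, if (bi G C).Adj u v then (1 : ℤ) else 0) +
        (cut (G.deleteEdges F) X + cut (G.deleteEdges F) X) := by
    nth_rewrite 1 [cut_eq]
    nth_rewrite 1 [cut_eq']
    nth_rewrite 1 [cut_eq]
    nth_rewrite 1 [cut_eq']
    simp only [← Finset.sum_add_distrib]
    refine Finset.sum_congr rfl fun u _ => Finset.sum_congr rfl fun v _ => ?_
    simp only [hadjM, hadjF]
    have e1 : (bi G c').Adj u v ↔ G.Adj u v ∧ c' u ≠ c' v := Iff.rfl
    have e2 : (bi G C).Adj u v ↔ G.Adj u v ∧ C u ≠ C v := Iff.rfl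
    simp only [e1, e2, c']
    by_cases hu : u ∈ X <;> by_cases hv : v ∈ X <;> by_cases hg : G.Adj u v <;>
      cases hCu : C u <;> cases hCv : C v <;> simp [hu, hv, hg]
  linarith

end OddImm

namespace OddImm

open scoped Classical in
lemma card_fiber_le {Λ η : Type*} [Fintype Λ] (f : Λ → η) (Δ : ℕ)
    (hf : ∀ h, (Finset.univ.filter fun l => f l = h).card ≤ Δ) (B : Finset η) :
    (Finset.univ.filter fun l => f l ∈ B).card ≤ B.card * Δ := by
  have : (Finset.univ.filter fun l => f l ∈ B) =
      B.biUnion fun h => Finset.univ.filter fun l => f l = h := by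
    ext l; simp
  rw [this]
  refine Finset.card_biUnion_le.trans ?_
  simpa using Finset.sum_le_card_nsmul B _ Δ (fun h _ => hf h)

lemma card_pairs {N : ℕ} (H : Finset (Fin N)) :
    2 * ((H ×ˢ H).filter fun p => p.1 < p.2).card + H.card = H.card * H.card := by
  have h1 : ((H ×ˢ H).filter fun p => p.2 < p.1).card =
      ((H ×ˢ H).filter fun p => p.1 < p.2).card := by
    refine Finset.card_bij (fun p _ => p.swap) ?_ ?_ ?_
    · intro p hp
      simp only [Finset.mem_filter, Finset.mem_product] at hp ⊢
      exact ⟨⟨hp.1.2, hp.1.1⟩, hp.2⟩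
    · intro p _ q _ h; exact Prod.swap_injective h
    · intro p hp
      simp only [Finset.mem_filter, Finset.mem_product] at hp
      exact ⟨p.swap, by simp [hp], by simp⟩
  have h2 : H.offDiag = ((H ×ˢ H).filter fun p => p.1 < p.2) ∪
      ((H ×ˢ H).filter fun p => p.2 < p.1) := by
    ext p
    simp only [Finset.mem_offDiag, Finset.mem_union, Finset.mem_filter, Finset.mem_product]
    have := @lt_or_lt_iff_ne _ _ p.1 p.2
    tauto
  have h3 := Finset.card_union_of_disjoint
    (s := (H ×ˢ H).filter fun p => p.1 < p.2) (t := (H ×ˢ H).filter fun p => p.2 < p.1) (by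
      rw [Finset.disjoint_left]
      intro p hp hp'
      simp only [Finset.mem_filter] at hp hp'
      exact lt_asymm hp.2 hp'.2)
  rw [← h2, Finset.offDiag_card, h1] at h3
  have : H.card ≤ H.card * H.card := Nat.le_mul_self _
  omega

/-- The trail system of an immersion of a complete graph. -/
lemma system {V : Type*} {M : SimpleGraph V} {N : ℕ} (I : Immersion M (⊤ : SimpleGraph (Fin N))) :
    ∃ W : ∀ x y, M.Walk (I.φ x) (I.φ y), (∀ x y, (W x y).IsTrail) ∧
      (∀ x y x' y', s(x, y) ≠ s(x', y') → List.Disjoint (W x y).edges (W x' y').edges) ∧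
      (∀ x y, (W x y).length = (W y x).length) ∧ (∀ x, (W x x).length = 0) := by
  have key : ∀ x y, ∃ w : M.Walk (I.φ x) (I.φ y), (x = y → w.length = 0) ∧
      ∀ h : x ≠ y, w = I.trail (u := x) (v := y) h := by
    intro x y
    by_cases h : x = y
    · subst h
      exact ⟨.nil, by simp, fun h => absurd rfl h⟩
    · exact ⟨I.trail (u := x) (v := y) h, fun h' => absurd h' h, fun _ => rfl⟩
  choose W hW0 hW1 using key
  have hnil : ∀ x, (W x x).edges = [] := by
    intro x
    have := hW0 x x rfl
    rw [← Walk.length_edges] at this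
    exact List.length_eq_zero_iff.1 this
  refine ⟨W, ?_, ?_, ?_, fun x => hW0 x x rfl⟩
  · intro x y
    by_cases h : x = y
    · subst h
      rw [Walk.isTrail_def, hnil]; exact List.nodup_nil
    · rw [hW1 x y h]; exact I.isTrail _
  · intro x y x' y' hs
    by_cases h : x = y
    · subst h
      rw [hnil]; exact List.disjoint_nil_left _
    · by_cases h' : x' = y'
      · subst h'
        rw [hnil]; exact List.disjoint_nil_right _
      · rw [hW1 x y h, hW1 x' y' h']; exact I.disjoint _ _ hs
  · intro x y
    by_cases h : x = y
    · subst h; rfl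
    · rw [hW1 x y h, hW1 y x (Ne.symm h)]
      have := I.symm (u := x) (v := y) h
      rw [this, Walk.length_reverse]

open scoped Classical in
lemma caseA {V : Type*} {G : SimpleGraph V} {t N : ℕ} (hN : t < N)
    (φ : Fin N ↪ V) (W : ∀ x y, G.Walk (φ x) (φ y)) (hW : ∀ x y, (W x y).IsTrail)
    (hWd : ∀ x y x' y', s(x, y) ≠ s(x', y') → List.Disjoint (W x y).edges (W x' y').edges)
    (β : Fin t ↪ Fin N) (Q : Finset (Fin N)) (hQ : ∀ h, h ∈ Q ↔ h ∉ Set.range β)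
    (hno : ¬ HasTotallyOddImmersion G (⊤ : SimpleGraph (Fin t))) :
    ∃ i j : Fin t,
      (((Q ×ˢ Q).filter fun p => p.1 < p.2 ∧
        Odd ((W (β i) p.1).length + (W p.1 p.2).length + (W (β j) p.2).length)).card
          ≤ t ^ 2 + 8 * t * N) ∧
      ((Q.filter fun h => Odd ((W (β i) h).length + (W (β j) h).length)).card * N
          ≤ t ^ 2 + 8 * t * N) := by
  by_contra hcon
  push Not at hcon
  apply hno
  obtain ⟨h0, hh0⟩ : ∃ h, h ∈ Q := by
    by_contra hne
    push Not at hne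
    have hsurj : Function.Surjective β := fun h => by
      by_contra hh
      exact hne h ((hQ h).2 hh)
    have := Fintype.card_le_of_surjective β hsurj
    simp at this
    omega
  let Λ := {p : Fin N × Fin N // p.1 ∈ Q ∧ p.2 ∈ Q ∧ p.1 < p.2} ⊕ ({h // h ∈ Q} × Fin N)
  let src : Λ → Fin N := Sum.elim (fun p => p.1.1) (fun q => q.1.1)
  let tgt : Λ → Fin N := Sum.elim (fun p => p.1.2) (fun q => q.1.1)
  let L : ∀ l : Λ, G.Walk (φ (src l)) (φ (tgt l)) := fun l => match l with
    | .inl p => W p.1.1 p.1.2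
    | .inr q => Walk.nil
  have : Nonempty Λ := ⟨.inr (⟨h0, hh0⟩, h0)⟩
  have hsQ : ∀ l, src l ∈ Q := by rintro (p | q); exacts [p.2.1, q.1.2]
  have htQ : ∀ l, tgt l ∈ Q := by rintro (p | q); exacts [p.2.2.1, q.1.2]
  have hQb : ∀ h ∈ Q, ∀ i, h ≠ β i := fun h hh i hi => (hQ h).1 hh ⟨i, hi.symm⟩
  -- degree bound
  have hdeg : ∀ (f g : Λ → Fin N), (∀ l l' : Λ, f l = f l' → g l = g l' → Sum.isLeft l = Sum.isLeft l' →
      l = l') → ∀ h, (Finset.univ.filter fun l => f l = h).card ≤ 2 * N := by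
    intro f g hfg h
    have := Finset.card_le_card_of_injOn (s := Finset.univ.filter fun l => f l = h)
      (t := (Finset.univ : Finset (Bool × Fin N))) (fun l => (Sum.isLeft l, g l))
      (fun _ _ => by simp) (fun l hl l' hl' hll => by
        simp only [Finset.coe_filter, Finset.mem_univ, true_and, Set.mem_ofPred_eq] at hl hl'
        rw [Prod.mk.injEq] at hll
        exact hfg l l' (hl.trans hl'.symm) hll.2 hll.1)
    simpa using this
  refine route φ W hW hWd β src tgt (fun l i => hQb _ (hsQ l) i) (fun l i => hQb _ (htQ l) i)
    L ?_ ?_ ?_ (2 * N) ?_ ?_ ?_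
  · rintro (p | q)
    · exact hW _ _
    · exact Walk.IsTrail.nil
  · rintro (p | q) (p' | q') hne
    · apply hWd
      intro hs
      rw [Sym2.eq_iff] at hs
      rcases hs with ⟨h1, h2⟩ | ⟨h1, h2⟩
      · exact hne (congrArg Sum.inl (Subtype.ext (Prod.ext h1 h2)))
      · have a1 := p.2.2.2
        have a2 := p'.2.2.2
        rw [h1, h2] at a1
        exact lt_asymm a1 a2
    · exact List.disjoint_nil_right _
    · exact List.disjoint_nil_left _
    · exact List.disjoint_nil_left _
  · rintro (p | q) i h hh
    · apply hWd
      intro hs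
      rw [Sym2.eq_iff] at hs
      rcases hs with ⟨h1, h2⟩ | ⟨h1, h2⟩
      · exact hQb _ p.2.1 i h1
      · exact hQb _ p.2.2.1 i h2
    · exact List.disjoint_nil_left _
  · intro h
    have hA := fun hx => hdeg src (Sum.elim (fun p => p.1.2) (fun q => q.2)) hx h
    convert hA ?_
    rintro (p | q) (p' | q') h1 h2 h3
    · exact congrArg Sum.inl (Subtype.ext (Prod.ext h1 h2))
    · simp at h3
    · simp at h3
    · exact congrArg Sum.inr (Prod.ext (Subtype.ext h1) h2)
  · intro h
    have hA := fun hx => hdeg tgt (Sum.elim (fun p => p.1.1) (fun q => q.2)) hx h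
    convert hA ?_
    rintro (p | q) (p' | q') h1 h2 h3
    · exact congrArg Sum.inl (Subtype.ext (Prod.ext h2 h1))
    · simp at h3
    · simp at h3
    · exact congrArg Sum.inr (Prod.ext (Subtype.ext h1) h2)
  · intro i j _
    have hij := hcon i j
    let f : Λ → Fin N × Fin N := Sum.elim (fun p => p.1) (fun q => (q.1.1, q.2))
    set Gd := Finset.univ.filter fun l : Λ =>
      Odd ((W (β i) (src l)).length + (L l).length + (W (β j) (tgt l)).length) with hGd
    have hc1 := Finset.card_le_card_of_surjOn (s := Gd) (t := (Q ×ˢ Q).filter fun p => p.1 < p.2 ∧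
        Odd ((W (β i) p.1).length + (W p.1 p.2).length + (W (β j) p.2).length)) f (by
      intro p hp
      simp only [Finset.coe_filter, Finset.mem_product, Set.mem_ofPred_eq] at hp
      refine ⟨Sum.inl ⟨p, hp.1.1, hp.1.2, hp.2.1⟩, ?_, rfl⟩
      simp only [hGd, Finset.coe_filter, Finset.mem_univ, true_and, Set.mem_ofPred_eq]
      exact hp.2.2)
    have hc2 := Finset.card_le_card_of_surjOn (s := Gd)
      (t := (Q.filter fun h => Odd ((W (β i) h).length + (W (β j) h).length)) ×ˢ
        (Finset.univ : Finset (Fin N))) f (by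
      intro p hp
      simp only [Finset.coe_product, Finset.coe_filter, Set.mem_prod, Set.mem_ofPred_eq] at hp
      refine ⟨Sum.inr (⟨p.1, hp.1.1⟩, p.2), ?_, rfl⟩
      simp only [hGd, Finset.coe_filter, Finset.mem_univ, true_and, Set.mem_ofPred_eq]
      exact hp.1.2)
    rw [Finset.card_product, Finset.card_univ, Fintype.card_fin] at hc2
    have e : 4 * t * (2 * N) = 8 * t * N := by ring
    rw [e]
    by_contra hle
    have := hij (by omega)
    omega

lemma exists_cons {V : Type*} {M : SimpleGraph V} {a b : V} (p : M.Walk a b) (hne : a ≠ b) :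
    ∃ (w : V) (h : M.Adj a w) (q : M.Walk w b), p = Walk.cons h q := by
  cases p with
  | nil => exact absurd rfl hne
  | cons h q => exact ⟨_, h, q, rfl⟩

open scoped Classical in
lemma caseB {V : Type*} [Fintype V] {G M F : SimpleGraph V} {t N : ℕ} (hMG : M ≤ G) (hFG : F ≤ G)
    (hMF : ∀ e ∈ M.edgeSet, e ∉ F.edgeSet)
    (hcut : ∀ X, cut M X ≤ cut F X)
    (C : V → Bool) (hCM : ∀ u v, M.Adj u v → C u = C v) (hCF : ∀ u v, F.Adj u v → C u ≠ C v)
    (φ : Fin N ↪ V) (W : ∀ x y, M.Walk (φ x) (φ y)) (hW : ∀ x y, (W x y).IsTrail)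
    (hWd : ∀ x y x' y', s(x, y) ≠ s(x', y') → List.Disjoint (W x y).edges (W x' y').edges)
    (β : Fin t ↪ Fin N) (H : Finset (Fin N)) (hH : ∀ h ∈ H, ∀ i, h ≠ β i) (D : ℕ)
    (hD : ∀ i, (H.filter fun h => Odd (W (β i) h).length).card ≤ D)
    (hbig : t ^ 2 + 4 * t * N + 2 * (D * N) < ((H ×ˢ H).filter fun p => p.1 < p.2).card) :
    HasTotallyOddImmersion G (⊤ : SimpleGraph (Fin t)) := by
  let Λ := {p : Fin N × Fin N // p ∈ (H ×ˢ H).filter fun p => p.1 < p.2}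
  have hΛ : Fintype.card Λ = ((H ×ˢ H).filter fun p => p.1 < p.2).card := by
    have h0 := Fintype.card_coe ((H ×ˢ H).filter fun p => p.1 < p.2)
    rw [← h0]
    exact Fintype.card_congr (Equiv.refl _)
  have hΛH : ∀ l : Λ, l.1.1 ∈ H ∧ l.1.2 ∈ H ∧ l.1.1 < l.1.2 := by
    intro l
    have := l.2
    simp only [Finset.mem_filter, Finset.mem_product] at this
    exact ⟨this.1.1, this.1.2, this.2⟩
  have : Nonempty Λ := Fintype.card_pos_iff.1 (by omega)
  have hsym : ∀ l l' : Λ, s(l.1.1, l.1.2) = s(l'.1.1, l'.1.2) → l = l' := by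
    intro l l' hs
    rw [Sym2.eq_iff] at hs
    rcases hs with ⟨h1, h2⟩ | ⟨h1, h2⟩
    · exact Subtype.ext (Prod.ext h1 h2)
    · have a1 := (hΛH l).2.2
      have a2 := (hΛH l').2.2
      rw [h1, h2] at a1
      exact absurd a2 (lt_asymm a1)
  have hsplit : ∀ l : Λ, ∃ (w : V) (h : M.Adj (φ l.1.1) w) (q : M.Walk w (φ l.1.2)),
      W l.1.1 l.1.2 = Walk.cons h q := by
    intro l
    exact exists_cons _ (fun h => (hΛH l).2.2.ne (φ.injective h))
  choose u hadj q hq using hsplit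
  have hqe : ∀ l, (W l.1.1 l.1.2).edges = s(φ l.1.1, u l) :: (q l).edges := by
    intro l; rw [hq l, Walk.edges_cons]
  obtain ⟨τ, E, h1, h2, h3, h4⟩ := transfer (F := F) M hcut u (fun l : Λ => φ l.1.2) q Finset.univ (by
    intro l _ l' _ hne e he he'
    refine hWd l.1.1 l.1.2 l'.1.1 l'.1.2 (fun h => hne (hsym _ _ h)) (a := e) ?_ ?_
    · rw [hqe]; exact List.mem_cons_of_mem _ he
    · rw [hqe]; exact List.mem_cons_of_mem _ he')
  have h1' : ∀ l, ∃ z ∈ H, φ z = τ l ∧ ∃ p : F.Walk (u l) (φ z), p.IsTrail ∧ ∀ e ∈ p.edges, e ∈ E l := by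
    intro l
    have hpos : 0 < (Finset.univ.filter fun k : Λ => τ k = τ l).card :=
      Finset.card_pos.2 ⟨l, by simp⟩
    obtain ⟨k, hk⟩ := Finset.card_pos.1 (lt_of_lt_of_le hpos (h4 (τ l)))
    simp only [Finset.mem_filter, Finset.mem_univ, true_and] at hk
    refine ⟨k.1.2, (hΛH k).2.1, hk, ?_⟩
    rw [hk]
    exact h1 l (Finset.mem_univ _)
  choose tgt htH hτ P hPt hPE using h1'
  have hWG : ∀ x y, ((W x y).mapLe hMG).edges = (W x y).edges := fun x y =>
    Walk.edges_mapLe_eq_edges hMG _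
  have hWM : ∀ x y, ∀ e ∈ (W x y).edges, e ∈ M.edgeSet := fun x y e he =>
    Walk.edges_subset_edgeSet _ he
  have hEM : ∀ l, ∀ e ∈ E l, e ∉ M.edgeSet := fun l e he he' =>
    hMF e he' (h2 l (Finset.mem_univ _) he)
  let L : ∀ l : Λ, G.Walk (φ l.1.1) (φ (tgt l)) := fun l =>
    Walk.cons (hMG (hadj l)) ((P l).mapLe hFG)
  have hLe : ∀ l e, e ∈ (L l).edges → (e ∈ (W l.1.1 l.1.2).edges ∨ e ∈ E l) := by
    intro l e he
    simp only [L, Walk.edges_cons, List.mem_cons, Walk.edges_mapLe_eq_edges] at he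
    rcases he with rfl | he
    · left; rw [hqe]; exact List.mem_cons_self
    · right; exact hPE l e he
  -- colours are constant on the walks of `M`
  have hcol : ∀ {x y : V} (w : M.Walk x y), C x = C y := by
    intro x y w
    induction w with
    | nil => rfl
    | cons h _ ih => exact (hCM _ _ h).trans ih
  have hLodd : ∀ l, Odd (L l).length := by
    intro l
    have hC : C (u l) = C (φ (tgt l)) :=
      (hCM _ _ (hadj l)).symm.trans (hcol (W l.1.1 (tgt l)))
    let c : F.Coloring Bool := Coloring.mk C (fun h => hCF _ _ h)
    have hev : Even (P l).length := (c.even_length_iff_congr (P l)).2 (by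
      show (C (u l) = true ↔ C (φ (tgt l)) = true)
      rw [hC])
    simp only [L, Walk.length_cons, Walk.length_map]
    exact hev.add_one
  have hout : ∀ h, (Finset.univ.filter fun l : Λ => l.1.1 = h).card ≤ N := by
    intro h
    have := Finset.card_le_card_of_injOn (s := Finset.univ.filter fun l : Λ => l.1.1 = h)
      (t := (Finset.univ : Finset (Fin N))) (fun l => l.1.2)
      (fun _ _ => by simp) (fun l hl l' hl' hll => by
        simp only [Finset.coe_filter, Finset.mem_univ, true_and, Set.mem_ofPred_eq] at hl hl'
        exact Subtype.ext (Prod.ext (hl.trans hl'.symm) hll))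
    simpa using this
  have hin : ∀ h, (Finset.univ.filter fun l : Λ => tgt l = h).card ≤ N := by
    intro h
    have e1 : (Finset.univ.filter fun l : Λ => tgt l = h) =
        Finset.univ.filter fun l : Λ => τ l = φ h := by
      ext l
      simp only [Finset.mem_filter, Finset.mem_univ, true_and, ← hτ, φ.injective.eq_iff]
    rw [e1]
    refine (h4 (φ h)).trans ?_
    have := Finset.card_le_card_of_injOn (s := Finset.univ.filter fun l : Λ => φ l.1.2 = φ h)
      (t := (Finset.univ : Finset (Fin N))) (fun l => l.1.1)
      (fun _ _ => by simp) (fun l hl l' hl' hll => by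
        simp only [Finset.coe_filter, Finset.mem_univ, true_and, Set.mem_ofPred_eq] at hl hl'
        exact Subtype.ext (Prod.ext hll (φ.injective (hl.trans hl'.symm))))
    simpa using this
  refine route φ (fun x y => (W x y).mapLe hMG) ?_ ?_ β (fun l : Λ => l.1.1) tgt
    (fun l i => hH _ (hΛH l).1 i) (fun l i => hH _ (htH l) i) L ?_ ?_ ?_ N (fun h => by convert hout h) (fun h => by convert hin h) ?_
  · intro x y
    rw [Walk.isTrail_def, hWG]; exact (hW x y).edges_nodup
  · intro x y x' y' hs
    rw [hWG, hWG]; exact hWd x y x' y' hs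
  · intro l
    simp only [L]
    rw [Walk.isTrail_cons]
    refine ⟨?_, ?_⟩
    · rw [Walk.isTrail_def, Walk.edges_mapLe_eq_edges]; exact (hPt l).edges_nodup
    · rw [Walk.edges_mapLe_eq_edges]
      intro he
      exact hEM l _ (hPE l _ he) (hadj l)
  · intro l l' hne e he he'
    rcases hLe l e he with he | he <;> rcases hLe l' e he' with he' | he'
    · exact hWd _ _ _ _ (fun h => hne (hsym _ _ h)) he he'
    · exact hEM _ _ he' (hWM _ _ _ he)
    · exact hEM _ _ he (hWM _ _ _ he')
    · exact Set.disjoint_left.1 (h3 l (Finset.mem_univ _) l' (Finset.mem_univ _) hne) he he'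
  · intro l i h hh e he he'
    rw [hWG] at he'
    rcases hLe l e he with he | he
    · refine hWd _ _ _ _ (fun hs => ?_) he he'
      rw [Sym2.eq_iff] at hs
      rcases hs with ⟨h1, h2⟩ | ⟨h1, h2⟩
      · exact hH _ (hΛH l).1 i h1
      · exact hH _ (hΛH l).2.1 i h2
    · exact hEM _ _ he (hWM _ _ _ he')
  · intro i j _
    set Gd := Finset.univ.filter fun l : Λ => Odd (((W (β i) l.1.1).mapLe hMG).length +
      (L l).length + ((W (β j) (tgt l)).mapLe hMG).length) with hGd
    let Bd : Fin t → Finset (Fin N) := fun i => H.filter fun h => Odd (W (β i) h).length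
    have b1 : (Finset.univ.filter fun l : Λ => l.1.1 ∈ Bd i).card ≤ (Bd i).card * N := by
      convert card_fiber_le (fun l : Λ => l.1.1) N (fun h => by convert hout h) (Bd i)
    have b2 : (Finset.univ.filter fun l : Λ => tgt l ∈ Bd j).card ≤ (Bd j).card * N := by
      convert card_fiber_le tgt N (fun h => by convert hin h) (Bd j)
    have b3 : (Bd i).card * N ≤ D * N := Nat.mul_le_mul_right _ (hD i)
    have b4 : (Bd j).card * N ≤ D * N := Nat.mul_le_mul_right _ (hD j)
    have hsub : (Finset.univ : Finset Λ) ⊆ Gd ∪ ((Finset.univ.filter fun l : Λ => l.1.1 ∈ Bd i) ∪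
        (Finset.univ.filter fun l : Λ => tgt l ∈ Bd j)) := by
      intro l _
      by_cases c1 : l.1.1 ∈ Bd i
      · simp [c1]
      by_cases c2 : tgt l ∈ Bd j
      · simp [c2]
      refine Finset.mem_union_left _ ?_
      simp only [Bd, Finset.mem_filter, (hΛH l).1, htH l, true_and, Nat.not_odd_iff_even] at c1 c2
      simp only [hGd, Finset.mem_filter, Finset.mem_univ, true_and, Walk.length_map]
      exact (c1.add_odd (hLodd l)).add_even c2
    have b5 := Finset.card_le_card hsub
    have b6 := Finset.card_union_le Gd ((Finset.univ.filter fun l : Λ => l.1.1 ∈ Bd i) ∪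
        (Finset.univ.filter fun l : Λ => tgt l ∈ Bd j))
    have b7 := Finset.card_union_le (Finset.univ.filter fun l : Λ => l.1.1 ∈ Bd i)
        (Finset.univ.filter fun l : Λ => tgt l ∈ Bd j)
    rw [Finset.card_univ, hΛ] at b5
    omega

end OddImm

namespace OddImm

lemma final {N t : ℕ} (ht : 1 ≤ t) (hN : N = 98000 * t + 4410071) (ℓ : Fin N → Fin N → ℕ)
    (hsym : ∀ x y, ℓ x y = ℓ y x) (h0 : ∀ x, ℓ x x = 0) (a b : Fin N) (Q : Finset (Fin N))
    (hQ : N ≤ Q.card + t)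
    (h1 : ((Q ×ˢ Q).filter fun p => p.1 < p.2 ∧ Odd (ℓ a p.1 + ℓ p.1 p.2 + ℓ b p.2)).card
      ≤ t ^ 2 + 8 * t * N)
    (h2 : (Q.filter fun h => Odd (ℓ a h + ℓ b h)).card * N ≤ t ^ 2 + 8 * t * N) :
    ∃ (β : Fin t ↪ Fin N) (H : Finset (Fin N)), (∀ h ∈ H, ∀ i, h ≠ β i) ∧
      (∀ i, (H.filter fun h => Odd (ℓ (β i) h)).card ≤ 1000 * t) ∧
      t ^ 2 + 4 * t * N + 2 * (1000 * t * N) < ((H ×ˢ H).filter fun p => p.1 < p.2).card := by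
  have htN : t ≤ N := by omega
  have hNpos : 0 < N := by omega
  have hb : t ^ 2 + 8 * t * N ≤ 9 * t * N := by nlinarith
  set Z := Q.filter fun h => Odd (ℓ a h + ℓ b h) with hZ
  have hZc : Z.card ≤ 9 * t := Nat.le_of_mul_le_mul_right (h2.trans hb) hNpos
  obtain ⟨H0, hH0Q, hH0e, hH0c⟩ : ∃ H0 ⊆ Q, (∀ x ∈ H0, ∀ y ∈ H0, Even (ℓ a x + ℓ a y)) ∧
      Q.card ≤ 2 * H0.card := by
    have hs := Finset.card_filter_add_card_filter_not (s := Q) (fun h => Odd (ℓ a h))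
    rcases le_total (Q.filter fun h => Odd (ℓ a h)).card
      (Q.filter fun h => ¬ Odd (ℓ a h)).card with hle | hle
    · refine ⟨_, Finset.filter_subset _ _, ?_, (by omega :
        Q.card ≤ 2 * (Q.filter fun h => ¬ Odd (ℓ a h)).card)⟩
      intro x hx y hy
      simp only [Finset.mem_filter, Nat.not_odd_iff_even] at hx hy
      exact hx.2.add hy.2
    · refine ⟨_, Finset.filter_subset _ _, ?_, (by omega :
        Q.card ≤ 2 * (Q.filter fun h => Odd (ℓ a h)).card)⟩
      intro x hx y hy
      simp only [Finset.mem_filter] at hx hy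
      exact hx.2.add_odd hy.2
  set P1 := (Q ×ˢ Q).filter fun p => p.1 < p.2 ∧ Odd (ℓ a p.1 + ℓ p.1 p.2 + ℓ b p.2) with hP1
  set E := (H0 ×ˢ H0).filter fun p => p.1 < p.2 ∧ Odd (ℓ p.1 p.2) with hE
  have hEsub : E ⊆ P1 ∪ (Finset.univ ×ˢ Z) := by
    intro p hp
    simp only [hE, Finset.mem_filter, Finset.mem_product] at hp
    obtain ⟨⟨hp1, hp2⟩, hlt, hodd⟩ := hp
    simp only [hP1, hZ, Finset.mem_union, Finset.mem_filter, Finset.mem_product, hH0Q hp1,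
      hH0Q hp2, hlt, Finset.mem_univ, true_and]
    have he := hH0e _ hp1 _ hp2
    by_cases c : Odd (ℓ a p.2 + ℓ b p.2)
    · exact Or.inr c
    · left
      rw [Nat.not_odd_iff_even] at c
      rw [Nat.odd_iff] at *
      rw [Nat.even_iff] at *
      omega
  have hEc : E.card ≤ 18 * t * N := by
    have a1 := (Finset.card_le_card hEsub).trans (Finset.card_union_le _ _)
    rw [Finset.card_product, Finset.card_univ, Fintype.card_fin] at a1
    have a2 : N * Z.card ≤ N * (9 * t) := Nat.mul_le_mul_left _ hZc
    nlinarith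
  set O := (H0 ×ˢ H0).filter fun p => Odd (ℓ p.1 p.2) with hO
  have hOsub : O ⊆ E ∪ E.image Prod.swap := by
    rintro ⟨x, y⟩ hp
    simp only [hO, Finset.mem_filter, Finset.mem_product] at hp
    obtain ⟨⟨hp1, hp2⟩, hodd⟩ := hp
    rcases lt_trichotomy x y with hlt | heq | hlt
    · exact Finset.mem_union_left _ (by simp [hE, hp1, hp2, hlt, hodd])
    · subst heq
      rw [h0] at hodd
      simp at hodd
    · refine Finset.mem_union_right _ (Finset.mem_image.2 ⟨(y, x), ?_, rfl⟩)
      rw [hsym] at hodd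
      simp [hE, hp1, hp2, hlt, hodd]
  have hOc : O.card ≤ 36 * t * N := by
    have a1 := (Finset.card_le_card hOsub).trans (Finset.card_union_le _ _)
    have a2 : (E.image Prod.swap).card ≤ E.card := Finset.card_image_le
    nlinarith
  set Bd := H0.filter fun x => 1000 * t < (H0.filter fun h => Odd (ℓ x h)).card with hBd
  have hBdc : Bd.card * (1000 * t) ≤ O.card := by
    have e1 : O.card = ∑ x ∈ H0, (O.filter fun p => p.1 = x).card :=
      Finset.card_eq_sum_card_fiberwise (f := Prod.fst) (by
        intro p hp
        simp only [hO, Finset.coe_filter, Finset.mem_product, Set.mem_ofPred_eq] at hp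
        exact hp.1.1)
    have e2 : ∑ x ∈ Bd, (O.filter fun p => p.1 = x).card ≤ O.card := by
      rw [e1]
      exact Finset.sum_le_sum_of_subset (Finset.filter_subset _ _)
    refine le_trans ?_ e2
    rw [← smul_eq_mul]
    refine Finset.card_nsmul_le_sum _ _ _ ?_
    intro x hx
    simp only [hBd, Finset.mem_filter] at hx
    refine hx.2.le.trans ?_
    refine Finset.card_le_card_of_injOn (fun h => (x, h)) ?_ ?_
    · intro h hh
      simp only [Finset.coe_filter, Set.mem_ofPred_eq] at hh
      simp [hO, hx.1, hh.1, hh.2]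
    · intro h _ h' _ hh
      exact (Prod.ext_iff.1 hh).2
  have hBd' : 1000 * Bd.card ≤ 36 * N := by
    refine Nat.le_of_mul_le_mul_right (c := t) ?_ ht
    nlinarith
  have hdiff : H0.card ≤ (H0 \ Bd).card + Bd.card := by
    have := Finset.le_card_sdiff Bd H0
    omega
  obtain ⟨B, hBsub, hBc⟩ := Finset.exists_subset_card_eq (s := H0 \ Bd) (n := t) (by omega)
  refine ⟨(B.orderEmbOfFin hBc).toEmbedding, H0 \ B, ?_, ?_, ?_⟩
  · intro h hh i hi
    rw [Finset.mem_sdiff] at hh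
    apply hh.2
    rw [hi]
    exact Finset.orderEmbOfFin_mem B hBc i
  · intro i
    have hm := hBsub (Finset.orderEmbOfFin_mem B hBc i)
    simp only [hBd, Finset.mem_sdiff, Finset.mem_filter, not_and, not_lt] at hm
    refine le_trans (Finset.card_le_card ?_) (hm.2 hm.1)
    exact Finset.filter_subset_filter _ Finset.sdiff_subset
  · have hp := card_pairs (H0 \ B)
    have hd := Finset.le_card_sdiff B H0
    set m := (H0 \ B).card
    have hm1 : N ≤ 2 * m + 3 * t := by omega
    have hm2 : 48998 * t + 2205034 ≤ m := by omega
    have k1 : t * N ≤ t * (2 * m + 3 * t) := Nat.mul_le_mul_left _ hm1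
    have k2 : m * (48998 * t + 2205034) ≤ m * m := Nat.mul_le_mul_left _ hm2
    have k3 : t * (48998 * t + 2205034) ≤ t * m := Nat.mul_le_mul_left _ hm2
    nlinarith

open scoped Classical in
lemma finish {V : Type*} [Fintype V] {G M F : SimpleGraph V} {t N : ℕ} (ht : 1 ≤ t)
    (hN : N = 98000 * t + 4410071) (hMG : M ≤ G) (hFG : F ≤ G)
    (hMF : ∀ e ∈ M.edgeSet, e ∉ F.edgeSet)
    (hcut : ∀ X, cut M X ≤ cut F X)
    (C : V → Bool) (hCM : ∀ u v, M.Adj u v → C u = C v) (hCF : ∀ u v, F.Adj u v → C u ≠ C v)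
    (I : Immersion M (⊤ : SimpleGraph (Fin N))) :
    HasTotallyOddImmersion G (⊤ : SimpleGraph (Fin t)) := by
  by_contra hno
  obtain ⟨W, hW, hWd, hWs, hW0⟩ := system I
  have hWG : ∀ x y, ((W x y).mapLe hMG).edges = (W x y).edges := fun x y =>
    Walk.edges_mapLe_eq_edges hMG _
  have htN : t < N := by omega
  let β0 : Fin t ↪ Fin N := Fin.castLEEmb htN.le
  let Q : Finset (Fin N) := Finset.univ \ Finset.univ.map β0
  have hQ : ∀ h, h ∈ Q ↔ h ∉ Set.range β0 := by
    intro h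
    simp [Q]
  have hQc : N ≤ Q.card + t := by
    have := Finset.le_card_sdiff (Finset.univ.map β0) (Finset.univ : Finset (Fin N))
    rw [Finset.card_map, Finset.card_univ, Finset.card_univ, Fintype.card_fin,
      Fintype.card_fin] at this
    have h2 : N - t ≤ Q.card := this
    omega
  obtain ⟨i, j, h1, h2⟩ := caseA htN I.φ (fun x y => (W x y).mapLe hMG)
    (fun x y => by rw [Walk.isTrail_def, hWG]; exact (hW x y).edges_nodup)
    (fun x y x' y' hs => by rw [hWG, hWG]; exact hWd x y x' y' hs) β0 Q hQ hno
  simp only [Walk.length_map] at h1 h2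
  obtain ⟨β, H, hH, hD, hbig⟩ := final ht hN (fun x y => (W x y).length) hWs hW0
    (β0 i) (β0 j) Q hQc (by convert h1) (by convert h2)
  exact hno (caseB hMG hFG hMF hcut C hCM hCF I.φ W hW hWd β H hH (1000 * t)
    (fun i => by convert hD i) (by convert hbig))

end OddImm

/-- In a graph G with no totally odd K_t-immersion, given F ⊆ E(G) with G[F]
bipartite, either there is a strictly larger bipartite edge set F', or G ∖ F has no
K_{98000t + 4410071}-immersion. -/
theorem growing_bipartite_edge_set {V : Type*} [Fintype V] (t : ℕ) (ht : 1 ≤ t)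
    (G : SimpleGraph V) (h : ¬ HasTotallyOddImmersion G (⊤ : SimpleGraph (Fin t)))
    (F : Set (Sym2 V)) (hFsub : F ⊆ G.edgeSet)
    (hFbip : (SimpleGraph.fromEdgeSet F).Colorable 2) :
    (∃ F' ⊆ G.edgeSet, (SimpleGraph.fromEdgeSet F').Colorable 2 ∧ F.ncard < F'.ncard) ∨
      ¬ HasImmersion (G.deleteEdges F) (⊤ : SimpleGraph (Fin (98000 * t + 4410071))) := by
  by_contra hcon
  rw [not_or, not_not] at hcon
  obtain ⟨hmax, ⟨I⟩⟩ := hcon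
  have hmax' : ∀ F' ⊆ G.edgeSet, (SimpleGraph.fromEdgeSet F').Colorable 2 →
      F'.ncard ≤ F.ncard := by
    intro F' h1 h2
    by_contra h3
    exact hmax ⟨F', h1, h2, not_le.1 h3⟩
  have hcol : (SimpleGraph.fromEdgeSet F).Coloring Bool := hFbip.toColoring (by simp)
  obtain ⟨hCM, hcut⟩ := OddImm.maxcut G F hFsub hcol (fun u v huv => hcol.valid huv) hmax'
  have hMG : G.deleteEdges F ≤ G := deleteEdges_le F
  have hFG : SimpleGraph.fromEdgeSet F ≤ G := by
    intro u v huv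
    exact hFsub ((SimpleGraph.fromEdgeSet_adj F).1 huv).1
  have hMF : ∀ e ∈ (G.deleteEdges F).edgeSet, e ∉ (SimpleGraph.fromEdgeSet F).edgeSet := by
    intro e
    induction e with
    | h x y =>
      intro h1 h2
      rw [mem_edgeSet] at h1 h2
      rw [deleteEdges_adj] at h1
      exact h1.2 ((SimpleGraph.fromEdgeSet_adj F).1 h2).1
  exact h (OddImm.finish ht rfl hMG hFG hMF hcut hcol hCM (fun u v huv => hcol.valid huv) I)
end
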